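/- Interpolation-type a priori estimate for divergence-form equations (Proposition 4.3). Let s ∈ (1/2,1), α ∈ (0,1) with 1+α < 2s, q = n/(2s−1−α), M > 0, and 0 < λ ≤ Λ. Let (K(x,·))_{x∈ℝⁿ} define a divergence-form nonlocal operator L of order 2s with ellipticity constants λ, Λ, satisfying the x-regularity condition with constant M and exponent α and the almost-evenness condition with constant M and exponent α. Then for any δ > 0 there exists C_δ, depending only on δ, n, s, α, M, λ, Λ, such that [u]_{C^{1+α}(B_{1/2})} ≤ δ [u]_{C^{1+α}(ℝⁿ)} + C_δ (‖u‖_{L^∞(B₁)} + ‖∇u‖_{L^∞(ℝⁿ)} + ‖f‖_{L^q(B₁)}) for any compactly supported u ∈ C^{1+α}(ℝⁿ) that is a weak solution of L(u,x) = f in B₁. -/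

import Mathlib

open MeasureTheory Metric Set
open scoped ENNReal Topology RealInnerProductSpace

noncomputable section

abbrev Euc (n : ℕ) := EuclideanSpace ℝ (Fin n)

variable {n : ℕ}

def hDeg (σ : ℝ) : ℕ := ⌈σ⌉₊ - 1

def hSemiOn (σ : ℝ) (Ω A : Set (Euc n)) (u : Euc n → ℝ) : ℝ≥0∞ :=
  ⨆ (x : A) (y : A),
    ENNReal.ofReal
      (‖iteratedFDerivWithin ℝ (hDeg σ) u Ω ↑x - iteratedFDerivWithin ℝ (hDeg σ) u Ω ↑y‖ /
        ‖(x : Euc n) - (y : Euc n)‖ ^ (σ - (hDeg σ : ℝ)))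

def hSemi (σ : ℝ) (Ω : Set (Euc n)) (u : Euc n → ℝ) : ℝ≥0∞ := hSemiOn σ Ω Ω u

def hNormOn (σ : ℝ) (Ω A : Set (Euc n)) (u : Euc n → ℝ) : ℝ≥0∞ :=
  (∑ j ∈ Finset.range (hDeg σ + 1), ⨆ x : A, ENNReal.ofReal ‖iteratedFDerivWithin ℝ j u Ω ↑x‖) +
    hSemiOn σ Ω A u

def hNorm (σ : ℝ) (Ω : Set (Euc n)) (u : Euc n → ℝ) : ℝ≥0∞ := hNormOn σ Ω Ω u

def HolderMem (σ : ℝ) (Ω : Set (Euc n)) (u : Euc n → ℝ) : Prop :=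
  ContDiffOn ℝ (hDeg σ) u Ω ∧ hNorm σ Ω u ≠ ⊤

def HolderMemLoc (σ : ℝ) (Ω : Set (Euc n)) (u : Euc n → ℝ) : Prop :=
  ContDiffOn ℝ (hDeg σ) u Ω ∧
    ∀ A : Set (Euc n), IsCompact A → A ⊆ Ω → hNormOn σ Ω A u ≠ ⊤

def supNorm (Ω : Set (Euc n)) (u : Euc n → ℝ) : ℝ≥0∞ :=
  ⨆ x : Ω, ENNReal.ofReal |u ↑x|

def supNormW (τ : ℝ) (u : Euc n → ℝ) : ℝ≥0∞ :=
  ⨆ x : Euc n, ENNReal.ofReal (|u x| / (1 + ‖x‖ ^ τ))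

def IsLevyMeasure (K : Measure (Euc n)) : Prop :=
  K {0} = 0 ∧ (∫⁻ y, ENNReal.ofReal (min 1 (‖y‖ ^ 2)) ∂K) ≠ ⊤ ∧
    Measure.map (fun y => -y) K = K

def UnifElliptic (s lam Lam : ℝ) (K : Measure (Euc n)) : Prop :=
  (∀ r : ℝ, 0 < r →
    ENNReal.ofReal (r ^ (2 * s)) * K (ball 0 (2 * r) \ ball 0 r) ≤ ENNReal.ofReal Lam) ∧
  (∀ r : ℝ, 0 < r → ∀ e : Euc n, ‖e‖ = 1 →
    ENNReal.ofReal lam ≤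
      ENNReal.ofReal (r ^ (2 * s - 2)) * ∫⁻ y in ball 0 r, ENNReal.ofReal (⟪e, y⟫ ^ 2) ∂K)

def Lop (K : Euc n → Measure (Euc n)) (u : Euc n → ℝ) (x : Euc n) : ℝ :=
  (1 / 2) * ∫ y, (2 * u x - u (x + y) - u (x - y)) ∂(K x)

def LopTI (K : Measure (Euc n)) (u : Euc n → ℝ) (x : Euc n) : ℝ :=
  (1 / 2) * ∫ y, (2 * u x - u (x + y) - u (x - y)) ∂K

def SolvesPtwise (K : Euc n → Measure (Euc n)) (u f : Euc n → ℝ) (Ω : Set (Euc n)) : Prop :=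
  ∀ x ∈ Ω, Integrable (fun y => 2 * u x - u (x + y) - u (x - y)) (K x) ∧ Lop K u x = f x

def tvDiff (μ ν : Measure (Euc n)) (A : Set (Euc n)) : ℝ≥0∞ :=
  (μ.restrict A - ν.restrict A) Set.univ + (ν.restrict A - μ.restrict A) Set.univ

def kernelHolder (s θ : ℝ) (K : Measure (Euc n)) : ℝ≥0∞ :=
  ⨆ (ρ : ℝ) (_ : 0 < ρ) (x : Euc n) (x' : Euc n)
      (_ : x ∈ ball 0 (ρ / 2)) (_ : x' ∈ ball 0 (ρ / 2)) (_ : x ≠ x'),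
    ENNReal.ofReal (ρ ^ (2 * s + θ) / ‖x - x'‖ ^ θ) *
      tvDiff (Measure.map (fun y => x - y) K) (Measure.map (fun y => x' - y) K)
        (ball 0 (2 * ρ) \ ball 0 ρ)

def KantCond (s γ : ℝ) (μ ν : Measure (Euc n)) (c : ℝ) : Prop :=
  ∀ ρ : ℝ, 0 < ρ → ∀ φ : Euc n → ℝ, ContDiff ℝ (hDeg γ) φ →
    hSemi γ Set.univ φ ≤ 1 → φ 0 = 0 →
    |(∫ y in ball 0 (2 * ρ) \ ball 0 ρ, φ y ∂μ) -
        ∫ y in ball 0 (2 * ρ) \ ball 0 ρ, φ y ∂ν| ≤ c * ρ ^ (γ - 2 * s)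


def MeasKernel (K : Euc n → Measure (Euc n)) : Prop :=
  ∀ B : Set (Euc n), MeasurableSet B → Measurable fun x => K x B

/-- Symmetry of a divergence-form kernel: `∫_A K(x,B) dx = ∫_B K(x,A) dx`
for all disjoint Borel sets. -/
def DivSymmetric (K : Euc n → Measure (Euc n)) : Prop :=
  ∀ A B : Set (Euc n), MeasurableSet A → MeasurableSet B → Disjoint A B →
    ∫⁻ x in A, K x B = ∫⁻ x in B, K x A

/-- Uniform ellipticity of a divergence-form kernel. -/
def DivElliptic (s lam Lam : ℝ) (K : Euc n → Measure (Euc n)) : Prop :=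
  (∀ x : Euc n, ∀ r : ℝ, 0 < r →
    ENNReal.ofReal (r ^ (2 * s)) * K x (ball x (2 * r) \ ball x r) ≤ ENNReal.ofReal Lam) ∧
  (∀ x : Euc n, ∀ r : ℝ, 0 < r → ∀ e : Euc n, ‖e‖ = 1 →
    ENNReal.ofReal lam ≤
      ENNReal.ofReal (r ^ (2 * s - 2)) *
        ∫⁻ z in ball x r, ENNReal.ofReal (⟪e, x - z⟫ ^ 2) ∂(K x))

/-- Weak solution of the divergence-form equation `L(u,x) = f` in `Ω`. -/
def WeakSol (K : Euc n → Measure (Euc n)) (u f : Euc n → ℝ) (Ω : Set (Euc n)) : Prop :=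
  (∫⁻ x in Ω, ∫⁻ z, ENNReal.ofReal ((u x - u z) ^ 2) ∂(K x)) ≠ ⊤ ∧
  (∫⁻ x in Ωᶜ, ∫⁻ z in Ω, ENNReal.ofReal ((u x - u z) ^ 2) ∂(K x)) ≠ ⊤ ∧
  ∀ η : Euc n → ℝ, ContDiff ℝ (⊤ : ℕ∞) η → HasCompactSupport η → tsupport η ⊆ Ω →
    (1 / 2) * (∫ x, ∫ z, (u x - u z) * (η x - η z) ∂(K x)) = ∫ x, f x * η x

/-- `C^α` regularity in the `x`-variable of a divergence-form kernel (total variation). -/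
def XReg (s α M : ℝ) (K : Euc n → Measure (Euc n)) : Prop :=
  ∀ x h : Euc n, ∀ ρ : ℝ, 0 < ρ →
    tvDiff (Measure.map (fun z => z - h) (K (x + h))) (K x) (ball x (2 * ρ) \ ball x ρ) ≤
      ENNReal.ofReal (M * ‖h‖ ^ α * ρ ^ (-(2 * s)))

/-- Quantitative almost-evenness of a divergence-form kernel. -/
def AlmostEven (s α M : ℝ) (K : Euc n → Measure (Euc n)) : Prop :=
  ∀ x : Euc n, ∀ ρ : ℝ, 0 < ρ →
    tvDiff (Measure.map (fun z => z - x) (K x)) (Measure.map (fun z => x - z) (K x))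
        (ball 0 (2 * ρ) \ ball 0 ρ) ≤
      ENNReal.ofReal (M * ρ ^ (α - 2 * s))

/-- `C^θ` regularity in the `z`-variable of a divergence-form kernel (total variation). -/
def ZReg (s θ M : ℝ) (K : Euc n → Measure (Euc n)) : Prop :=
  ∀ x : Euc n, ∀ ρ : ℝ, 0 < ρ → ∀ h : Euc n, ‖h‖ < ρ / 2 →
    tvDiff (Measure.map (fun z => z - h) (K x)) (K x) (ball x (2 * ρ) \ ball x ρ) ≤
      ENNReal.ofReal (M * ‖h‖ ^ θ * ρ ^ (-(2 * s) - θ))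

def gradSup (u : Euc n → ℝ) : ℝ≥0∞ :=
  ⨆ x : Euc n, ENNReal.ofReal ‖fderiv ℝ u x‖

def gradSupOn (Ω : Set (Euc n)) (u : Euc n → ℝ) : ℝ≥0∞ :=
  ⨆ x : Ω, ENNReal.ofReal ‖fderiv ℝ u (x : Euc n)‖

def c1Norm (Ω : Set (Euc n)) (u : Euc n → ℝ) : ℝ≥0∞ :=
  supNorm Ω u + gradSupOn Ω u


/-- `ν` has mass at most `D ρ ^ (-β)` on every dyadic annulus of inner radius `ρ` around `0`. -/
def AnnBd (β D : ℝ) (ν : Measure (Euc n)) : Prop :=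
  ∀ ρ : ℝ, 0 < ρ → ν (ball 0 (2 * ρ) \ ball 0 ρ) ≤ ENNReal.ofReal (D * ρ ^ (-β))

lemma summable_dyadic_min {p q β : ℝ} (hqβ : q < β) (hβp : β < p) :
    Summable fun j : ℤ =>
      min (((2 : ℝ) ^ (j + 1)) ^ p) (((2 : ℝ) ^ (j + 1)) ^ q) * ((2 : ℝ) ^ j) ^ (-β) := by
  have key : ∀ (j : ℤ) (t : ℝ), ((2 : ℝ) ^ (j + 1)) ^ t * ((2 : ℝ) ^ j) ^ (-β) =
      2 ^ t * 2 ^ ((j : ℝ) * (t - β)) := by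
    intro j t
    rw [← Real.rpow_intCast, ← Real.rpow_intCast, ← Real.rpow_mul (by norm_num),
      ← Real.rpow_mul (by norm_num), ← Real.rpow_add (by norm_num), ← Real.rpow_add (by norm_num)]
    congr 1
    push_cast
    ring
  have geo : ∀ (c : ℝ), c < 0 → Summable fun k : ℕ => (2 : ℝ) ^ ((k : ℝ) * c) := by
    intro c hc
    have : Summable fun k : ℕ => ((2 : ℝ) ^ c) ^ k :=
      summable_geometric_of_lt_one (by positivity)
        (Real.rpow_lt_one_of_one_lt_of_neg (by norm_num) hc)
    refine this.congr fun k => ?_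
    rw [← Real.rpow_natCast, ← Real.rpow_mul (by norm_num), mul_comm]
  rw [summable_int_iff_summable_nat_and_neg]
  constructor
  · refine Summable.of_nonneg_of_le (fun k => by positivity) (fun k => ?_)
      ((geo (q - β) (by linarith)).mul_left (2 ^ q))
    calc _ ≤ ((2 : ℝ) ^ ((k : ℤ) + 1)) ^ q * ((2 : ℝ) ^ (k : ℤ)) ^ (-β) := by
          gcongr; exact min_le_right _ _
      _ = _ := by rw [key]; simp
  · refine Summable.of_nonneg_of_le (fun k => by positivity) (fun k => ?_)
      ((geo (β - p) (by linarith)).mul_left (2 ^ p))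
    calc _ ≤ ((2 : ℝ) ^ (-(k : ℤ) + 1)) ^ p * ((2 : ℝ) ^ (-(k : ℤ))) ^ (-β) := by
          gcongr; exact min_le_left _ _
      _ = _ := by
          rw [key]
          congr 2
          push_cast
          ring

lemma lintegral_min_rpow_le {p q β : ℝ} (hq : 0 ≤ q) (hqβ : q < β) (hβp : β < p) :
    ∃ c > 0, ∀ {n : ℕ} (ν : Measure (Euc n)) (D r : ℝ), 0 ≤ D → 0 < r → AnnBd β D ν →
      ∫⁻ y, ENNReal.ofReal (min ((‖y‖ / r) ^ p) ((‖y‖ / r) ^ q)) ∂ν ≤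
        ENNReal.ofReal (c * D * r ^ (-β)) := by
  have hs := summable_dyadic_min hqβ hβp
  refine ⟨(∑' j : ℤ, min (((2 : ℝ) ^ (j + 1)) ^ p) (((2 : ℝ) ^ (j + 1)) ^ q) *
    ((2 : ℝ) ^ j) ^ (-β)) + 1, ?_, ?_⟩
  · positivity
  intro n ν D r hD hr hν
  let A : ℤ → Set (Euc n) := fun j => ball 0 (2 * (r * 2 ^ j)) \ ball 0 (r * 2 ^ j)
  have hA : ∀ j, MeasurableSet (A j) := fun j => measurableSet_ball.diff measurableSet_ball
  let b : ℤ → ℝ := fun j => min (((2 : ℝ) ^ (j + 1)) ^ p) (((2 : ℝ) ^ (j + 1)) ^ q)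
  have hb : ∀ j, 0 ≤ b j := fun j => by positivity
  have hpt : ∀ y : Euc n, ENNReal.ofReal (min ((‖y‖ / r) ^ p) ((‖y‖ / r) ^ q)) ≤
      ∑' j : ℤ, (A j).indicator (fun _ => ENNReal.ofReal (b j)) y := by
    intro y
    rcases eq_or_ne y 0 with rfl | hy
    · rw [norm_zero, zero_div, Real.zero_rpow (by linarith)]
      have : min (0 : ℝ) (0 ^ q) ≤ 0 := min_le_left _ _
      rw [ENNReal.ofReal_of_nonpos this]
      exact zero_le
    · have hyr : 0 < ‖y‖ / r := by positivity
      obtain ⟨j, hj1, hj2⟩ := exists_mem_Ico_zpow hyr (by norm_num : (1 : ℝ) < 2)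
      have hyA : y ∈ A j := by
        rw [le_div_iff₀ hr] at hj1
        rw [div_lt_iff₀ hr, zpow_add₀ (by norm_num)] at hj2
        simp only [A, mem_sdiff, mem_ball, dist_zero_right, not_lt]
        constructor <;> nlinarith
      refine le_trans ?_ (ENNReal.le_tsum j)
      rw [indicator_of_mem hyA]
      apply ENNReal.ofReal_le_ofReal
      apply min_le_min <;> exact Real.rpow_le_rpow hyr.le hj2.le (by linarith)
  calc _ ≤ ∫⁻ y, ∑' j : ℤ, (A j).indicator (fun _ => ENNReal.ofReal (b j)) y ∂ν :=
        lintegral_mono hpt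
    _ = ∑' j : ℤ, ENNReal.ofReal (b j) * ν (A j) := by
        rw [lintegral_tsum fun j => (measurable_const.indicator (hA j)).aemeasurable]
        exact tsum_congr fun j => lintegral_indicator_const (hA j) _
    _ ≤ ∑' j : ℤ, ENNReal.ofReal (D * r ^ (-β) * (b j * ((2 : ℝ) ^ j) ^ (-β))) := by
        refine ENNReal.tsum_le_tsum fun j => ?_
        have h1 := hν (r * 2 ^ j) (by positivity)
        calc _ ≤ ENNReal.ofReal (b j) * ENNReal.ofReal (D * (r * 2 ^ j) ^ (-β)) := by gcongr
          _ = _ := by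
            rw [← ENNReal.ofReal_mul (hb j), Real.mul_rpow hr.le (by positivity)]
            congr 1
            ring
    _ = ENNReal.ofReal (∑' j : ℤ, D * r ^ (-β) * (b j * ((2 : ℝ) ^ j) ^ (-β))) :=
        (ENNReal.ofReal_tsum_of_nonneg (fun j => by have := hb j; positivity)
          (hs.mul_left _)).symm
    _ ≤ _ := by
        apply ENNReal.ofReal_le_ofReal
        rw [tsum_mul_left]
        have h2 : 0 ≤ D * r ^ (-β) := by positivity
        have h3 : (∑' j : ℤ, b j * ((2 : ℝ) ^ j) ^ (-β)) ≤
          (∑' j : ℤ, b j * ((2 : ℝ) ^ j) ^ (-β)) + 1 := by linarith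
        have := mul_le_mul_of_nonneg_left h3 h2
        simp only [b] at this ⊢
        linarith

lemma exists_integral_min_rpow_le {p q β : ℝ} (hq : 0 ≤ q) (hqβ : q < β) (hβp : β < p) :
    ∃ c > 0, ∀ {n : ℕ} (ν : Measure (Euc n)) (D r : ℝ), 0 ≤ D → 0 < r → AnnBd β D ν →
      Integrable (fun y => min ((‖y‖ / r) ^ p) ((‖y‖ / r) ^ q)) ν ∧
        ∫ y, min ((‖y‖ / r) ^ p) ((‖y‖ / r) ^ q) ∂ν ≤ c * D * r ^ (-β) := by
  obtain ⟨c, hc, h⟩ := lintegral_min_rpow_le hq hqβ hβp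
  refine ⟨c, hc, fun {n} ν D r hD hr hν => ?_⟩
  have hl := h ν D r hD hr hν
  have hm : AEStronglyMeasurable
      (fun y : Euc n => min ((‖y‖ / r) ^ p) ((‖y‖ / r) ^ q)) ν := by
    apply Measurable.aestronglyMeasurable
    fun_prop
  have h0 : ∀ y : Euc n, 0 ≤ min ((‖y‖ / r) ^ p) ((‖y‖ / r) ^ q) := fun y => by positivity
  constructor
  · refine ⟨hm, ?_⟩
    rw [hasFiniteIntegral_iff_ofReal (ae_of_all _ h0)]
    exact hl.trans_lt ENNReal.ofReal_lt_top
  · rw [integral_eq_lintegral_of_nonneg_ae (ae_of_all _ h0) hm]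
    exact ENNReal.toReal_le_of_le_ofReal (by positivity) hl

/-- Symmetric second difference of `w` at `x` with increment `y`. -/
def secDiff (w : Euc n → ℝ) (x y : Euc n) : ℝ := w (x + y) + w (x - y) - 2 * w x

lemma rpow_add_le_add_min {γ : ℝ} (hγ0 : 0 ≤ γ) (hγ1 : γ ≤ 1) {c t : ℝ} (hc : 1 ≤ c)
    (ht : 0 ≤ t) : (c + t) ^ γ ≤ c ^ γ + min t (t ^ γ) := by
  rw [← min_add_add_left, le_min_iff]
  constructor
  · have hc0 : 0 < c := by linarith
    have h1 : (c + t) ^ γ = c ^ γ * (1 + t / c) ^ γ := by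
      rw [← Real.mul_rpow hc0.le (by positivity)]
      congr 1
      field_simp
    have htc : 0 ≤ t / c := by positivity
    have h2 : (1 + t / c) ^ γ ≤ 1 + γ * (t / c) :=
      rpow_one_add_le_one_add_mul_self (by linarith) hγ0 hγ1
    have h3 : c ^ γ ≤ c := by
      calc c ^ γ ≤ c ^ (1 : ℝ) := Real.rpow_le_rpow_of_exponent_le hc hγ1
        _ = c := Real.rpow_one c
    have h4 : c ^ γ * (t / c) ≤ t := by
      calc c ^ γ * (t / c) ≤ c * (t / c) := by gcongr
        _ = t := by field_simp
    have h5 : 0 ≤ c ^ γ * (t / c) := by positivity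
    rw [h1]
    calc c ^ γ * (1 + t / c) ^ γ ≤ c ^ γ * (1 + γ * (t / c)) := by gcongr
      _ = c ^ γ + γ * (c ^ γ * (t / c)) := by ring
      _ ≤ c ^ γ + 1 * (c ^ γ * (t / c)) := by gcongr
      _ ≤ c ^ γ + t := by linarith
  · exact Real.rpow_add_le_add_rpow (by linarith) ht hγ0 hγ1

/-- Growth function used as a penalization at scale `P`. -/
def growth (γ P : ℝ) (x : Euc n) : ℝ := (1 + (‖x‖ / P) ^ 2) ^ γ

lemma secDiff_growth_le {γ P : ℝ} (hγ0 : 0 ≤ γ) (hγ1 : γ ≤ 1) (hP : 0 < P) (x y : Euc n) :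
    secDiff (growth γ P) x y ≤ 2 * min ((‖y‖ / P) ^ (2 : ℝ)) ((‖y‖ / P) ^ (2 * γ)) := by
  have hpar := parallelogram_law_with_norm ℝ x y
  have ha : (0 : ℝ) ≤ 1 + (‖x + y‖ / P) ^ 2 := by positivity
  have hb : (0 : ℝ) ≤ 1 + (‖x - y‖ / P) ^ 2 := by positivity
  have hconc := (Real.concaveOn_rpow hγ0 hγ1).2 (mem_Ici.2 ha) (mem_Ici.2 hb)
    (show (0 : ℝ) ≤ 1 / 2 by norm_num) (show (0 : ℝ) ≤ 1 / 2 by norm_num) (by norm_num)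
  have hmid : (1 / 2 : ℝ) • (1 + (‖x + y‖ / P) ^ 2) + (1 / 2 : ℝ) • (1 + (‖x - y‖ / P) ^ 2) =
      (1 + (‖x‖ / P) ^ 2) + (‖y‖ / P) ^ 2 := by
    simp only [smul_eq_mul, div_pow]
    field_simp
    linarith
  rw [hmid] at hconc
  have h2 := rpow_add_le_add_min hγ0 hγ1 (c := 1 + (‖x‖ / P) ^ 2) (t := (‖y‖ / P) ^ 2)
    (by linarith [sq_nonneg (‖x‖ / P)]) (by positivity)
  have h3 : ((‖y‖ / P) ^ 2) ^ γ = (‖y‖ / P) ^ (2 * γ) := by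
    rw [Real.rpow_mul (by positivity), Real.rpow_two]
  rw [h3] at h2
  simp only [secDiff, growth, Real.rpow_two, smul_eq_mul] at *
  linarith

lemma continuous_growth {γ P : ℝ} (hγ0 : 0 ≤ γ) : Continuous (growth γ P : Euc n → ℝ) := by
  unfold growth
  exact Continuous.rpow_const (by fun_prop) (fun x => Or.inr hγ0)

lemma secDiff_sq (w : Euc n → ℝ) (x y : Euc n) :
    secDiff (fun x => w x ^ 2) x y =
      2 * w x * secDiff w x y + ((w (x + y) - w x) ^ 2 + (w (x - y) - w x) ^ 2) := by
  simp only [secDiff]; ring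

lemma integral_bernstein_combination {ν : Measure (Euc n)} {f g h k : Euc n → ℝ}
    (hf : Integrable f ν) (hg : Integrable g ν) (hh : Integrable h ν) (hk : Integrable k ν)
    {a b c d e : ℝ} :
    ∫ y, (a * f y + (c * (b * g y - d * h y) - e * k y)) ∂ν =
      a * (∫ y, f y ∂ν) + (c * (b * (∫ y, g y ∂ν) - d * (∫ y, h y ∂ν)) - e * ∫ y, k y ∂ν) := by
  have h1 : Integrable (fun y => b * g y - d * h y) ν := (hg.const_mul b).sub (hh.const_mul d)
  have h2 : Integrable (fun y => c * (b * g y - d * h y) - e * k y) ν :=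
    (h1.const_mul c).sub (hk.const_mul e)
  rw [integral_add (hf.const_mul a) h2, integral_sub (h1.const_mul c) (hk.const_mul e),
    integral_const_mul, integral_const_mul, integral_const_mul,
    integral_sub (hg.const_mul b) (hh.const_mul d), integral_const_mul, integral_const_mul]

set_option maxHeartbeats 1000000 in
lemma exists_bernstein {s α lam D C₁ δ : ℝ} (hα : 0 < α) (hαs : α < s) (hs : s < 1)
    (hlam : 0 < lam) (hD : 0 < D) (hC₁ : 0 < C₁) (hδ : 0 < δ) :
    ∃ R ≥ 1, ∃ E > 0, ∀ {n : ℕ} (ν : Measure (Euc n)), AnnBd (2 * s) D ν →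
      (∀ r : ℝ, 0 < r → ∀ e : Euc n, ‖e‖ = 1 → ENNReal.ofReal lam ≤
        ENNReal.ofReal (r ^ (2 * s - 2)) * ∫⁻ y in ball 0 r, ENNReal.ofReal (⟪e, y⟫ ^ 2) ∂ν) →
      ∀ (w z : Euc n → ℝ) (p : Euc n → Euc n) (e : Euc n), ‖e‖ = 1 → (∀ x, z x = ⟪p x, e⟫) →
        Continuous z → (∀ x y, |w x - w y| ≤ ‖x - y‖ ^ α) →
        (∀ x y, |w (x + y) - w x - ⟪p x, y⟫| ≤ C₁ * ‖y‖ ^ 2) →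
        (∀ x, |z x| ≤ C₁) → (∀ x y, |secDiff z x y| ≤ C₁ * ‖y‖ ^ 2) →
        (∀ x, ‖x‖ ≤ R → |∫ y, secDiff w x y ∂ν| ≤ E ∧ |∫ y, secDiff z x y ∂ν| ≤ E) →
        |z 0| ≤ δ := by
  obtain ⟨γ, hγ⟩ : ∃ γ, γ = (α + s) / 2 := ⟨_, rfl⟩
  have hγ0 : 0 < γ := by linarith
  have hγ1 : γ ≤ 1 := by linarith
  obtain ⟨c₂, hc₂, H₂⟩ := exists_integral_min_rpow_le (p := 2) (q := 2 * γ) (β := 2 * s)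
    (by linarith) (by linarith) (by linarith)
  obtain ⟨c₄, hc₄, H₄⟩ := exists_integral_min_rpow_le (p := 4) (q := 0) (β := 2 * s)
    (by linarith) (by linarith) (by linarith)
  obtain ⟨_, _, Hw⟩ := exists_integral_min_rpow_le (p := 2) (q := α) (β := 2 * s)
    (by linarith) (by linarith) (by linarith)
  obtain ⟨_, _, Hz⟩ := exists_integral_min_rpow_le (p := 2) (q := 0) (β := 2 * s)
    (by linarith) (by linarith) (by linarith)
  obtain ⟨B, hB⟩ : ∃ B, B = C₁ ^ 2 := ⟨_, rfl⟩
  have hB0 : 0 < B := by rw [hB]; positivity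
  obtain ⟨B', hB'⟩ : ∃ B', B' = min (B / 2) (δ ^ 2 / 8) := ⟨_, rfl⟩
  have hB'0 : 0 < B' := by rw [hB']; positivity
  have hB'1 : B' ≤ B / 2 := hB' ▸ min_le_left _ _
  have hB'2 : B' ≤ δ ^ 2 / 8 := hB' ▸ min_le_right _ _
  obtain ⟨ρ, hρ0, hρ⟩ : ∃ ρ > 0, C₁ ^ 2 * c₄ * D * ρ ^ 2 ≤ δ ^ 2 * lam / 16 := by
    have hK : 0 < C₁ ^ 2 * c₄ * D := by positivity
    refine ⟨√(δ ^ 2 * lam / 16 / (C₁ ^ 2 * c₄ * D)), by positivity, ?_⟩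
    rw [Real.sq_sqrt (by positivity)]
    exact (mul_div_cancel₀ _ hK.ne').le
  obtain ⟨k, hk⟩ : ∃ k, k = δ ^ 2 * lam * ρ ^ (2 - 2 * s) / 16 := ⟨_, rfl⟩
  have hk0 : 0 < k := by rw [hk]; positivity
  obtain ⟨P, hP1, hP⟩ : ∃ P ≥ 1, 2 * B * c₂ * D / B' * P ^ (2 * α - 2 * s) ≤ k := by
    have ht : Filter.Tendsto (fun P : ℝ => 2 * B * c₂ * D / B' * P ^ (-(2 * s - 2 * α)))
        Filter.atTop (𝓝 (2 * B * c₂ * D / B' * 0)) :=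
      (tendsto_rpow_neg_atTop (by linarith)).const_mul _
    rw [mul_zero] at ht
    obtain ⟨P, hP, hP1⟩ := ((ht.eventually_le_const hk0).and
      (Filter.eventually_ge_atTop 1)).exists
    refine ⟨P, hP1, ?_⟩
    rwa [neg_sub] at hP
  have hP0 : 0 < P := by linarith
  obtain ⟨A, hA⟩ : ∃ A, A = B' * P ^ (-(2 * α)) := ⟨_, rfl⟩
  have hA0 : 0 < A := by rw [hA]; positivity
  obtain ⟨R, hR⟩ : ∃ R, R = (4 : ℝ) ^ (1 / γ) * P := ⟨_, rfl⟩
  have h4 : (1 : ℝ) ≤ 4 ^ (1 / γ) := Real.one_le_rpow (by norm_num) (by positivity)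
  have hR1 : 1 ≤ R := by rw [hR]; exact one_le_mul_of_one_le_of_one_le h4 hP1
  obtain ⟨E, hE0, hE⟩ : ∃ E > 0, (2 * C₁ / A + 2 * R ^ α) * E ≤ k := by
    have hK : 0 < 2 * C₁ / A + 2 * R ^ α := by positivity
    exact ⟨k / (2 * C₁ / A + 2 * R ^ α), by positivity, (mul_div_cancel₀ _ hK.ne').le⟩
  refine ⟨R, hR1, E, hE0, ?_⟩
  intro n ν hν hell w₀ z p e he hz hzc hw₀ hwp₀ hzb hzd hLE₀
  by_contra! hcon
  obtain ⟨w, hwdef⟩ : ∃ w : Euc n → ℝ, w = fun x => w₀ x - w₀ 0 := ⟨_, rfl⟩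
  have hw : ∀ x y, |w x - w y| ≤ ‖x - y‖ ^ α := fun x y => by simpa [hwdef] using hw₀ x y
  have hwp : ∀ x y, |w (x + y) - w x - ⟪p x, y⟫| ≤ C₁ * ‖y‖ ^ 2 :=
    fun x y => by simpa [hwdef] using hwp₀ x y
  have hsec : ∀ x y, secDiff w x y = secDiff w₀ x y := fun x y => by
    simp only [secDiff, hwdef]; ring
  have hLE : ∀ x, ‖x‖ ≤ R → |∫ y, secDiff w x y ∂ν| ≤ E ∧ |∫ y, secDiff z x y ∂ν| ≤ E := by
    simpa only [hsec] using hLE₀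
  have hw0 : ∀ x, |w x| ≤ ‖x‖ ^ α := fun x => by simpa [hwdef] using hw₀ x 0
  have hwc : Continuous w := by
    rw [Metric.continuous_iff']
    intro x ε hε
    have : Filter.Tendsto (fun y : Euc n => ‖y - x‖ ^ α) (𝓝 x) (𝓝 0) := by
      have h : Continuous fun y : Euc n => ‖y - x‖ ^ α :=
        Continuous.rpow_const (by fun_prop) fun _ => Or.inr hα.le
      simpa [Real.zero_rpow hα.ne'] using h.tendsto x
    filter_upwards [this.eventually_lt_const hε] with y hy
    exact (hw y x).trans_lt hy
  -- the auxiliary function and its maximum point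
  obtain ⟨F, hF⟩ : ∃ F : Euc n → ℝ, F = fun x =>
      z x ^ 2 - B * (growth γ P x - 1) + A * w x ^ 2 := ⟨_, rfl⟩
  have hFc : Continuous F := by
    rw [hF]
    have := continuous_growth (n := n) (P := P) hγ0.le
    fun_prop
  have hAw : ∀ x, A * w x ^ 2 ≤ B' * growth γ P x := by
    intro x
    have h1 : w x ^ 2 ≤ (‖x‖ ^ α) ^ 2 := sq_le_sq' (by linarith [neg_abs_le (w x), hw0 x])
      (le_trans (le_abs_self _) (hw0 x))
    have h2 : P ^ (-(2 * α)) * (‖x‖ ^ α) ^ 2 = ((‖x‖ / P) ^ 2) ^ α := by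
      have h3 : (‖x‖ ^ α) ^ 2 = (‖x‖ ^ 2) ^ α := by
        rw [← Real.rpow_natCast, ← Real.rpow_mul (norm_nonneg x), mul_comm,
          Real.rpow_mul (norm_nonneg x), Real.rpow_natCast]
      rw [h3, Real.rpow_neg hP0.le, Real.rpow_mul hP0.le, Real.rpow_two, div_pow,
        Real.div_rpow (by positivity) (by positivity), div_eq_inv_mul]
    calc A * w x ^ 2 ≤ A * (‖x‖ ^ α) ^ 2 := by gcongr
      _ = B' * ((‖x‖ / P) ^ 2) ^ α := by rw [hA, mul_assoc, h2]
      _ ≤ B' * (1 + (‖x‖ / P) ^ 2) ^ α := by gcongr; linarith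
      _ ≤ B' * (1 + (‖x‖ / P) ^ 2) ^ γ := by
          gcongr
          · linarith [sq_nonneg (‖x‖ / P)]
          · linarith
      _ = _ := rfl
  have hzsq : ∀ x, z x ^ 2 ≤ B := fun x => by
    rw [hB]
    exact sq_le_sq' (by linarith [neg_abs_le (z x), hzb x]) (le_trans (le_abs_self _) (hzb x))
  have hgr1 : ∀ x : Euc n, 1 ≤ growth γ P x := fun x =>
    Real.one_le_rpow (by linarith [sq_nonneg (‖x‖ / P)]) hγ0.le
  have hF0 : δ ^ 2 < F 0 := by
    have h1 : growth γ P (0 : Euc n) = 1 := by simp [growth]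
    have h2 : δ ^ 2 < z 0 ^ 2 := by
      rw [← sq_abs (z 0)]
      gcongr
    have h3 : 0 ≤ A * w 0 ^ 2 := by positivity
    simp only [hF, h1]
    linarith
  have hloc : ∀ x, 0 ≤ F x → growth γ P x ≤ 4 := by
    intro x hx
    have h1 := hAw x
    have h2 := hzsq x
    have h3 := hgr1 x
    have h4 : B' * growth γ P x ≤ B / 2 * growth γ P x := by gcongr
    simp only [hF] at hx
    by_contra! h
    have h5 : B * 4 < B * growth γ P x := by gcongr
    linarith
  have hlocR : ∀ x, 0 ≤ F x → ‖x‖ ≤ R := by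
    intro x hx
    have h1 := hloc x hx
    unfold growth at h1
    have h2 : 1 + (‖x‖ / P) ^ 2 ≤ 4 ^ (1 / γ) := by
      have := Real.rpow_le_rpow (by positivity) h1 (by positivity : 0 ≤ 1 / γ)
      rwa [← Real.rpow_mul (by positivity), mul_one_div_cancel hγ0.ne', Real.rpow_one] at this
    have h3 : ‖x‖ / P ≤ 4 ^ (1 / γ) := by
      by_contra! h
      linarith [le_self_pow₀ (h4.trans h.le) two_ne_zero]
    rw [hR]
    rwa [div_le_iff₀ hP0] at h3
  obtain ⟨x, hxR, hmax⟩ : ∃ x, ‖x‖ ≤ R ∧ ∀ y, F y ≤ F x := by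
    obtain ⟨x, hx, hmax⟩ := (isCompact_closedBall (0 : Euc n) R).exists_isMaxOn
      ⟨0, mem_closedBall_self (by linarith)⟩ hFc.continuousOn
    refine ⟨x, by simpa using hx, fun y => ?_⟩
    by_cases hy : ‖y‖ ≤ R
    · exact hmax (by simpa using hy)
    · have h1 : F y < 0 := by
        by_contra! h
        exact hy (hlocR y h)
      have h2 : F 0 ≤ F x := hmax (mem_closedBall_self (by linarith))
      linarith [sq_nonneg δ]
  have hFx : δ ^ 2 < F x := hF0.trans_le (hmax 0)
  have hzx : δ ^ 2 / 2 ≤ z x ^ 2 := by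
    have h1 := hAw x
    have h2 := hloc x (by linarith [sq_nonneg δ])
    have h3 := hgr1 x
    have h4 : B' * growth γ P x ≤ δ ^ 2 / 8 * 4 := by gcongr
    have h5 : 0 ≤ B * (growth γ P x - 1) := mul_nonneg hB0.le (by linarith)
    simp only [hF] at hFx
    linarith
  have hpx : δ ^ 2 / 2 ≤ ‖p x‖ ^ 2 := by
    have : |z x| ≤ ‖p x‖ := by
      have := abs_real_inner_le_norm (p x) e
      rwa [he, mul_one, ← hz] at this
    calc δ ^ 2 / 2 ≤ z x ^ 2 := hzx
      _ = |z x| ^ 2 := (sq_abs _).symm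
      _ ≤ _ := by gcongr
  have hwx : |w x| ≤ R ^ α := (hw0 x).trans (by gcongr)
  -- pointwise inequality at the maximum point
  have hptw : ∀ y, (w (x + y) - w x) ^ 2 ≤
      (1 / A) * (2 * B * min ((‖y‖ / P) ^ (2 : ℝ)) ((‖y‖ / P) ^ (2 * γ)) -
        2 * z x * secDiff z x y) - 2 * w x * secDiff w x y := by
    intro y
    have h1 := secDiff_growth_le hγ0.le hγ1 hP0 x y
    have h2 := secDiff_sq w x y
    have h3 := secDiff_sq z x y
    have h4 : secDiff F x y = secDiff (fun x => z x ^ 2) x y - B * secDiff (growth γ P) x y +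
        A * secDiff (fun x => w x ^ 2) x y := by
      simp only [hF, secDiff]; ring
    have h5 : secDiff F x y ≤ 0 := by
      simp only [secDiff]
      linarith [hmax (x + y), hmax (x - y)]
    have h6 : A * (w (x + y) - w x) ^ 2 ≤
        2 * B * min ((‖y‖ / P) ^ (2 : ℝ)) ((‖y‖ / P) ^ (2 * γ)) -
        2 * z x * secDiff z x y - A * (2 * w x * secDiff w x y) := by
      have h7 := mul_le_mul_of_nonneg_left h1 hB0.le
      have h8 : 0 ≤ A * (w (x - y) - w x) ^ 2 := by positivity
      rw [h4, h2, h3] at h5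
      linarith [sq_nonneg (z (x + y) - z x), sq_nonneg (z (x - y) - z x)]
    have h9 : (w (x + y) - w x) ^ 2 = 1 / A * (A * (w (x + y) - w x) ^ 2) := by
      field_simp
    rw [h9]
    calc 1 / A * (A * (w (x + y) - w x) ^ 2) ≤ 1 / A * _ :=
          mul_le_mul_of_nonneg_left h6 (by positivity)
      _ = _ := by field_simp
  -- integration against `ν`
  have hpx0 : p x ≠ 0 := by
    intro h
    rw [h, norm_zero] at hpx
    have := sq_pos_of_pos hδ
    norm_num at hpx
    linarith
  obtain ⟨e', he'⟩ : ∃ e', e' = (‖p x‖⁻¹ : ℝ) • p x := ⟨_, rfl⟩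
  have he'1 : ‖e'‖ = 1 := by rw [he']; exact norm_smul_inv_norm hpx0
  have hpe' : ∀ y, ⟪p x, y⟫ = ‖p x‖ * ⟪e', y⟫ := by
    intro y
    rw [he', real_inner_smul_left, mul_inv_cancel_left₀ (norm_ne_zero_iff.2 hpx0)]
  let G : Euc n → ℝ := (ball 0 ρ).indicator fun y => ⟪e', y⟫ ^ 2
  have hlow : ∀ y, ‖p x‖ ^ 2 / 2 * G y ≤
      C₁ ^ 2 * ρ ^ 4 * min ((‖y‖ / ρ) ^ (4 : ℝ)) ((‖y‖ / ρ) ^ (0 : ℝ)) +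
      ((1 / A) * (2 * B * min ((‖y‖ / P) ^ (2 : ℝ)) ((‖y‖ / P) ^ (2 * γ)) -
        2 * z x * secDiff z x y) - 2 * w x * secDiff w x y) := by
    intro y
    have h1 := hptw y
    by_cases hy : y ∈ ball (0 : Euc n) ρ
    · have hyρ : ‖y‖ / ρ ≤ 1 := by
        rw [div_le_one hρ0]
        exact (mem_ball_zero_iff.1 hy).le
      have hm : min ((‖y‖ / ρ) ^ (4 : ℝ)) ((‖y‖ / ρ) ^ (0 : ℝ)) = ‖y‖ ^ 4 / ρ ^ 4 := by
        rw [Real.rpow_zero, ← div_pow, min_eq_left]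
        · exact Real.rpow_natCast _ 4
        · exact Real.rpow_le_one (by positivity) hyρ (by norm_num)
      rw [hm]
      simp only [G, indicator_of_mem hy]
      have h2 : ‖p x‖ ^ 2 / 2 * ⟪e', y⟫ ^ 2 = ⟪p x, y⟫ ^ 2 / 2 := by rw [hpe']; ring
      have h3 : C₁ ^ 2 * ρ ^ 4 * (‖y‖ ^ 4 / ρ ^ 4) = (C₁ * ‖y‖ ^ 2) ^ 2 := by
        field_simp
      have h4 : (w (x + y) - w x - ⟪p x, y⟫) ^ 2 ≤ (C₁ * ‖y‖ ^ 2) ^ 2 := by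
        rw [← sq_abs (w (x + y) - w x - ⟪p x, y⟫)]
        gcongr
        exact hwp x y
      rw [h2, h3]
      linarith [sq_nonneg (2 * (w (x + y) - w x) - ⟪p x, y⟫),
        show ⟪p x, y⟫ ^ 2 / 2 = (w (x + y) - w x - ⟪p x, y⟫) ^ 2 + (w (x + y) - w x) ^ 2 -
          (2 * (w (x + y) - w x) - ⟪p x, y⟫) ^ 2 / 2 by ring]
    · simp only [G, indicator_of_notMem hy, mul_zero]
      have : 0 ≤ C₁ ^ 2 * ρ ^ 4 * min ((‖y‖ / ρ) ^ (4 : ℝ)) ((‖y‖ / ρ) ^ (0 : ℝ)) := by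
        positivity
      linarith [sq_nonneg (w (x + y) - w x)]
  obtain ⟨hI₂, hJ₂⟩ := H₂ ν D P hD.le hP0 hν
  obtain ⟨hI₄, hJ₄⟩ := H₄ ν D ρ hD.le hρ0 hν
  have hIw : Integrable (fun y => secDiff w x y) ν := by
    refine ((Hw ν D 1 hD.le one_pos hν).1.const_mul (2 * (C₁ + 1))).mono' ?_ (ae_of_all _ ?_)
    · apply Continuous.aestronglyMeasurable
      unfold secDiff
      fun_prop
    · intro y
      have h1 := abs_le.1 (hwp x y)
      have h2 := abs_le.1 (hwp x (-y))
      have h3 := abs_le.1 (hw (x + y) x)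
      have h4 := abs_le.1 (hw (x - y) x)
      rw [← sub_eq_add_neg, norm_neg, inner_neg_right] at h2
      rw [show x + y - x = y by abel] at h3
      rw [show x - y - x = -y by abel, norm_neg] at h4
      have h5 : 0 ≤ ‖y‖ ^ α := by positivity
      have h6 : 0 ≤ ‖y‖ ^ 2 := by positivity
      rw [div_one, Real.rpow_two, mul_min_of_nonneg _ _ (by positivity), le_min_iff,
        Real.norm_eq_abs]
      simp only [secDiff]
      constructor <;> rw [abs_le] <;> constructor <;> linarith [mul_nonneg hC₁.le h5, mul_nonneg hC₁.le h6]
  have hIz : Integrable (fun y => secDiff z x y) ν := by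
    refine ((Hz ν D 1 hD.le one_pos hν).1.const_mul (4 * C₁)).mono' ?_ (ae_of_all _ ?_)
    · apply Continuous.aestronglyMeasurable
      unfold secDiff
      fun_prop
    · intro y
      have h1 := hzd x y
      have h2 := abs_le.1 (hzb (x + y))
      have h3 := abs_le.1 (hzb (x - y))
      have h4 := abs_le.1 (hzb x)
      have h6 : 0 ≤ C₁ * ‖y‖ ^ 2 := by positivity
      rw [div_one, Real.rpow_two, Real.rpow_zero, mul_min_of_nonneg _ _ (by positivity),
        le_min_iff, Real.norm_eq_abs]
      refine ⟨by linarith, ?_⟩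
      simp only [secDiff]
      rw [abs_le]
      constructor <;> linarith
  have hGm : Measurable G := by
    apply Measurable.indicator _ measurableSet_ball
    fun_prop
  have hG0 : ∀ y, 0 ≤ G y := fun y => indicator_nonneg (fun _ _ => by positivity) y
  have hIR := (hI₄.const_mul (C₁ ^ 2 * ρ ^ 4)).add
    ((((hI₂.const_mul (2 * B)).sub (hIz.const_mul (2 * z x))).const_mul (1 / A)).sub
      (hIw.const_mul (2 * w x)))
  have hIG' : Integrable (fun y => ‖p x‖ ^ 2 / 2 * G y) ν := by
    refine hIR.mono' (hGm.const_mul _).aestronglyMeasurable (ae_of_all _ fun y => ?_)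
    rw [Real.norm_of_nonneg (mul_nonneg (by positivity) (hG0 y))]
    exact hlow y
  have hIG : Integrable G ν := by
    have h := hIG'.const_mul (‖p x‖ ^ 2 / 2)⁻¹
    have h0 : ‖p x‖ ^ 2 / 2 ≠ 0 := by
      have := norm_ne_zero_iff.2 hpx0
      positivity
    simpa only [inv_mul_cancel_left₀ h0] using h
  have hint := integral_mono hIG' hIR hlow
  have hGlow : lam * ρ ^ (2 - 2 * s) ≤ ∫ y, G y ∂ν := by
    have h1 := hell ρ hρ0 e' he'1
    have h2 : ∫⁻ y in ball 0 ρ, ENNReal.ofReal (⟪e', y⟫ ^ 2) ∂ν = ENNReal.ofReal (∫ y, G y ∂ν) := by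
      rw [ofReal_integral_eq_lintegral_ofReal hIG (ae_of_all _ hG0),
        ← lintegral_indicator measurableSet_ball]
      refine lintegral_congr fun y => ?_
      by_cases hy : y ∈ ball (0 : Euc n) ρ <;> simp only [G, hy, indicator_of_mem,
        indicator_of_notMem, not_false_eq_true, ENNReal.ofReal_zero]
    have hG00 : 0 ≤ ∫ y, G y ∂ν := integral_nonneg hG0
    rw [h2, ← ENNReal.ofReal_mul (by positivity), ENNReal.ofReal_le_ofReal_iff (by positivity)]
      at h1
    have h3 : ρ ^ (2 - 2 * s) * ρ ^ (2 * s - 2) = 1 := by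
      rw [← Real.rpow_add hρ0]; norm_num
    calc lam * ρ ^ (2 - 2 * s) ≤ ρ ^ (2 * s - 2) * (∫ y, G y ∂ν) * ρ ^ (2 - 2 * s) := by gcongr
      _ = ρ ^ (2 - 2 * s) * ρ ^ (2 * s - 2) * ∫ y, G y ∂ν := by ring
      _ = _ := by rw [h3, one_mul]
  have hRHS : ∫ y, (C₁ ^ 2 * ρ ^ 4 * min ((‖y‖ / ρ) ^ (4 : ℝ)) ((‖y‖ / ρ) ^ (0 : ℝ)) +
      ((1 / A) * (2 * B * min ((‖y‖ / P) ^ (2 : ℝ)) ((‖y‖ / P) ^ (2 * γ)) -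
        2 * z x * secDiff z x y) - 2 * w x * secDiff w x y)) ∂ν =
      C₁ ^ 2 * ρ ^ 4 * (∫ y, min ((‖y‖ / ρ) ^ (4 : ℝ)) ((‖y‖ / ρ) ^ (0 : ℝ)) ∂ν) +
      ((1 / A) * (2 * B * (∫ y, min ((‖y‖ / P) ^ (2 : ℝ)) ((‖y‖ / P) ^ (2 * γ)) ∂ν) -
        2 * z x * (∫ y, secDiff z x y ∂ν)) - 2 * w x * (∫ y, secDiff w x y ∂ν)) := 
    integral_bernstein_combination hI₄ hI₂ hIz hIw
  obtain ⟨hLw, hLz⟩ := hLE x hxR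
  have t1 : C₁ ^ 2 * ρ ^ 4 * (∫ y, min ((‖y‖ / ρ) ^ (4 : ℝ)) ((‖y‖ / ρ) ^ (0 : ℝ)) ∂ν) ≤ k := by
    calc _ ≤ C₁ ^ 2 * ρ ^ 4 * (c₄ * D * ρ ^ (-(2 * s))) := by gcongr
      _ = C₁ ^ 2 * c₄ * D * ρ ^ 2 * ρ ^ (2 - 2 * s) := by
          rw [Real.rpow_sub hρ0, Real.rpow_neg hρ0.le, Real.rpow_two]; field_simp
      _ ≤ δ ^ 2 * lam / 16 * ρ ^ (2 - 2 * s) := by gcongr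
      _ = k := by rw [hk]; ring
  have t2 : (1 / A) * (2 * B * (∫ y, min ((‖y‖ / P) ^ (2 : ℝ)) ((‖y‖ / P) ^ (2 * γ)) ∂ν)) ≤ k := by
    calc _ ≤ (1 / A) * (2 * B * (c₂ * D * P ^ (-(2 * s)))) := by gcongr
      _ = 2 * B * c₂ * D / B' * P ^ (2 * α - 2 * s) := by
          rw [hA, Real.rpow_sub hP0, Real.rpow_neg hP0.le, Real.rpow_neg hP0.le]; field_simp
      _ ≤ k := hP
  have t3 : |(1 / A) * (2 * z x * (∫ y, secDiff z x y ∂ν))| ≤ 2 * C₁ / A * E := by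
    rw [abs_mul, abs_mul, abs_mul, abs_of_pos (by positivity : 0 < 1 / A), abs_two]
    calc _ ≤ 1 / A * (2 * C₁ * E) := by gcongr; exact hzb x
      _ = _ := by ring
  have t4 : |2 * w x * (∫ y, secDiff w x y ∂ν)| ≤ 2 * R ^ α * E := by
    rw [abs_mul, abs_mul, abs_two]
    gcongr
  have t5 : 4 * k ≤ ‖p x‖ ^ 2 / 2 * ∫ y, G y ∂ν := by
    calc 4 * k = δ ^ 2 / 2 / 2 * (lam * ρ ^ (2 - 2 * s)) := by rw [hk]; ring
      _ ≤ _ := by gcongr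
  rw [integral_const_mul] at hint
  have hint' := hint.trans_eq hRHS
  have t6 := abs_le.1 t3
  have t7 := abs_le.1 t4
  rw [mul_sub (1 / A)] at hint'
  linarith

/-- The annulus with inner radius `r * 2 ^ j` and outer radius twice as large. -/
def dyadAnn (r : ℝ) (j : ℤ) : Set (Euc n) := ball 0 (2 * (r * 2 ^ j)) \ ball 0 (r * 2 ^ j)

lemma measurableSet_dyadAnn (r : ℝ) (j : ℤ) : MeasurableSet (dyadAnn r j : Set (Euc n)) :=
  measurableSet_ball.diff measurableSet_ball

lemma mem_dyadAnn {r : ℝ} {j : ℤ} {y : Euc n} :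
    y ∈ dyadAnn r j ↔ ‖y‖ < 2 * (r * 2 ^ j) ∧ r * 2 ^ j ≤ ‖y‖ := by
  simp [dyadAnn]

lemma pairwise_disjoint_dyadAnn {r : ℝ} (hr : 0 < r) :
    Pairwise (Function.onFun Disjoint (dyadAnn r : ℤ → Set (Euc n))) := by
  have key : ∀ i j : ℤ, i < j → Disjoint (dyadAnn r i : Set (Euc n)) (dyadAnn r j) := by
    intro i j hij
    rw [Set.disjoint_left]
    intro y hi hj
    rw [mem_dyadAnn] at hi hj
    have h : (2 : ℝ) ^ (i + 1) ≤ 2 ^ j := zpow_le_zpow_right₀ (by norm_num) (by lia)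
    rw [zpow_add₀ (by norm_num), zpow_one] at h
    have := mul_le_mul_of_nonneg_left h hr.le
    linarith [hi.1, hj.2]
  intro i j hij
  rcases lt_or_gt_of_ne hij with h | h
  · exact key i j h
  · exact (key j i h).symm

lemma iUnion_dyadAnn {r : ℝ} (hr : 0 < r) : ⋃ j, dyadAnn r j = ({0}ᶜ : Set (Euc n)) := by
  ext y
  simp only [mem_iUnion, mem_compl_iff, mem_singleton_iff, mem_dyadAnn]
  constructor
  · rintro ⟨j, -, h⟩ rfl
    rw [norm_zero] at h
    have : 0 < r * (2 : ℝ) ^ j := by positivity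
    linarith
  · intro hy
    have hyr : 0 < ‖y‖ / r := by positivity
    obtain ⟨j, hj1, hj2⟩ := exists_mem_Ico_zpow hyr (by norm_num : (1 : ℝ) < 2)
    rw [le_div_iff₀ hr] at hj1
    rw [div_lt_iff₀ hr, zpow_add₀ (by norm_num), zpow_one] at hj2
    exact ⟨j, by linarith, by linarith⟩

lemma add_sub_eq_add_sub_of_isFinite {X : Type*} [MeasurableSpace X] (μ ν : Measure X)
    [IsFiniteMeasure μ] [IsFiniteMeasure ν] : μ + (ν - μ) = ν + (μ - ν) := by
  rw [← Measure.toSignedMeasure_eq_toSignedMeasure_iff, Measure.toSignedMeasure_add,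
    Measure.toSignedMeasure_add]
  have := Measure.sub_toSignedMeasure_eq_toSignedMeasure_sub (μ := μ) (ν := ν)
  rw [sub_eq_sub_iff_add_eq_add] at this
  rw [this, add_comm]

lemma abs_integral_sub_le_of_isFinite {X : Type*} [MeasurableSpace X] {μ ν : Measure X}
    [IsFiniteMeasure μ] [IsFiniteMeasure ν] {H : X → ℝ} {b : ℝ} (hHμ : Integrable H μ)
    (hHν : Integrable H ν) (hbμ : ∀ᵐ y ∂μ, |H y| ≤ b) (hbν : ∀ᵐ y ∂ν, |H y| ≤ b) :
    |(∫ y, H y ∂μ) - ∫ y, H y ∂ν| ≤ b * ((μ - ν) univ + (ν - μ) univ).toReal := by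
  have hle₁ : μ - ν ≤ μ := Measure.sub_le
  have hle₂ : ν - μ ≤ ν := Measure.sub_le
  have key : (∫ y, H y ∂μ) + ∫ y, H y ∂(ν - μ) = (∫ y, H y ∂ν) + ∫ y, H y ∂(μ - ν) := by
    rw [← integral_add_measure hHμ (hHν.mono_measure hle₂),
      ← integral_add_measure hHν (hHμ.mono_measure hle₁), add_sub_eq_add_sub_of_isFinite]
  have h1 : ‖∫ y, H y ∂(μ - ν)‖ ≤ b * (μ - ν).real univ :=
    norm_integral_le_of_norm_le_const (ae_mono hle₁ hbμ)
  have h2 : ‖∫ y, H y ∂(ν - μ)‖ ≤ b * (ν - μ).real univ :=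
    norm_integral_le_of_norm_le_const (ae_mono hle₂ hbν)
  rw [ENNReal.toReal_add (by finiteness) (by finiteness), mul_add,
    show (∫ y, H y ∂μ) - ∫ y, H y ∂ν = (∫ y, H y ∂(μ - ν)) - ∫ y, H y ∂(ν - μ) by linarith]
  exact (abs_sub _ _).trans (add_le_add h1 h2)

lemma abs_setIntegral_sub_le_tvDiff {μ ν : Measure (Euc n)} {A : Set (Euc n)} {H : Euc n → ℝ}
    {b : ℝ} (hA : MeasurableSet A) (hμ : μ A ≠ ⊤) (hν : ν A ≠ ⊤) (hHμ : IntegrableOn H A μ)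
    (hHν : IntegrableOn H A ν) (hb : ∀ y ∈ A, |H y| ≤ b) :
    |(∫ y in A, H y ∂μ) - ∫ y in A, H y ∂ν| ≤ b * (tvDiff μ ν A).toReal := by
  have : IsFiniteMeasure (μ.restrict A) := ⟨by simpa using hμ.lt_top⟩
  have : IsFiniteMeasure (ν.restrict A) := ⟨by simpa using hν.lt_top⟩
  exact abs_integral_sub_le_of_isFinite hHμ hHν (ae_restrict_of_forall_mem hA hb)
    (ae_restrict_of_forall_mem hA hb)

/-- Quantitative comparison of integrals against two measures whose difference is controlled in
total variation on dyadic annuli. -/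
lemma exists_abs_integral_sub_le {p q β : ℝ} (hq : 0 ≤ q) (hqβ : q < β) (hβp : β < p) :
    ∃ c > 0, ∀ {n : ℕ} (μ ν : Measure (Euc n)) (H : Euc n → ℝ) (T r b : ℝ), 0 ≤ T → 0 < r →
      0 ≤ b → μ {0} = 0 → ν {0} = 0 →
      (∀ ρ : ℝ, 0 < ρ → μ (ball 0 (2 * ρ) \ ball 0 ρ) ≠ ⊤) →
      (∀ ρ : ℝ, 0 < ρ → ν (ball 0 (2 * ρ) \ ball 0 ρ) ≠ ⊤) →
      (∀ ρ : ℝ, 0 < ρ → tvDiff μ ν (ball 0 (2 * ρ) \ ball 0 ρ) ≤ ENNReal.ofReal (T * ρ ^ (-β))) →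
      Integrable H μ → Integrable H ν →
      (∀ y, |H y| ≤ b * min ((‖y‖ / r) ^ p) ((‖y‖ / r) ^ q)) →
      |(∫ y, H y ∂μ) - ∫ y, H y ∂ν| ≤ c * b * T * r ^ (-β) := by
  have hs := summable_dyadic_min hqβ hβp
  refine ⟨(∑' j : ℤ, min (((2 : ℝ) ^ (j + 1)) ^ p) (((2 : ℝ) ^ (j + 1)) ^ q) *
    ((2 : ℝ) ^ j) ^ (-β)) + 1, by positivity, ?_⟩
  intro n μ ν H T r b hT hr hb hμ0 hν0 hμ hν hτ hHμ hHν hH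
  have hsum : ∀ m : Measure (Euc n), m {0} = 0 → Integrable H m →
      HasSum (fun j => ∫ y in dyadAnn r j, H y ∂m) (∫ y, H y ∂m) := by
    intro m hm hHm
    have h := hasSum_integral_iUnion (f := H) (μ := m) (measurableSet_dyadAnn r)
      (pairwise_disjoint_dyadAnn hr) hHm.integrableOn
    rwa [iUnion_dyadAnn hr, Measure.restrict_eq_self_of_ae_mem] at h
    exact compl_mem_ae_iff.2 hm
  have hbd : ∀ j : ℤ, ‖(∫ y in dyadAnn r j, H y ∂μ) - ∫ y in dyadAnn r j, H y ∂ν‖ ≤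
      b * T * r ^ (-β) * (min (((2 : ℝ) ^ (j + 1)) ^ p) (((2 : ℝ) ^ (j + 1)) ^ q) *
        ((2 : ℝ) ^ j) ^ (-β)) := by
    intro j
    have hrj : 0 < r * (2 : ℝ) ^ j := by positivity
    have hτj := hτ _ hrj
    refine (abs_setIntegral_sub_le_tvDiff (measurableSet_dyadAnn r j) (hμ _ hrj) (hν _ hrj)
      hHμ.integrableOn hHν.integrableOn
      (b := b * min (((2 : ℝ) ^ (j + 1)) ^ p) (((2 : ℝ) ^ (j + 1)) ^ q)) ?_).trans ?_
    · intro y hy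
      refine (hH y).trans ?_
      have hyr : ‖y‖ / r ≤ 2 ^ (j + 1) := by
        rw [div_le_iff₀ hr, zpow_add₀ (by norm_num), zpow_one]
        linarith [(mem_dyadAnn.1 hy).1]
      gcongr; linarith
    · have h1 : (tvDiff μ ν (dyadAnn r j)).toReal ≤ T * (r * 2 ^ j) ^ (-β) :=
        ENNReal.toReal_le_of_le_ofReal (by positivity) hτj
      calc _ ≤ b * min (((2 : ℝ) ^ (j + 1)) ^ p) (((2 : ℝ) ^ (j + 1)) ^ q) *
            (T * (r * 2 ^ j) ^ (-β)) := by gcongr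
        _ = _ := by
          rw [Real.mul_rpow hr.le (by positivity)]
          ring
  have htot := (hsum μ hμ0 hHμ).sub (hsum ν hν0 hHν)
  have := tsum_of_norm_bounded (hs.hasSum.mul_left (b * T * r ^ (-β))) hbd
  rw [htot.tsum_eq] at this
  refine this.trans ?_
  have h2 : 0 ≤ b * T * r ^ (-β) := by positivity
  linarith

lemma exists_measure_compl_ball_le {β : ℝ} (hβ : 0 < β) :
    ∃ c > 0, ∀ {n : ℕ} (ν : Measure (Euc n)) (D r : ℝ), 0 ≤ D → 0 < r → AnnBd β D ν →
      ν (ball 0 r)ᶜ ≤ ENNReal.ofReal (c * D * r ^ (-β)) := by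
  obtain ⟨c, hc, h⟩ := lintegral_min_rpow_le (p := β + 1) (q := 0) (β := β) le_rfl hβ (by linarith)
  refine ⟨c, hc, fun {n} ν D r hD hr hν => le_trans ?_ (h ν D r hD hr hν)⟩
  rw [← lintegral_indicator_one measurableSet_ball.compl]
  refine lintegral_mono fun y => ?_
  by_cases hy : y ∈ (ball (0 : Euc n) r)ᶜ
  · rw [indicator_of_mem hy, Pi.one_apply, ENNReal.one_le_ofReal, Real.rpow_zero]
    have : 1 ≤ ‖y‖ / r := by
      rw [le_div_iff₀ hr, one_mul]
      simpa using hy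
    exact le_min (Real.one_le_rpow this (by linarith)) le_rfl
  · rw [indicator_of_notMem hy]
    exact zero_le

/-- The measure `K(x, ·)` centred at `x`, without its possible atom there. -/
def centred (K : Euc n → Measure (Euc n)) (x : Euc n) : Measure (Euc n) :=
  (Measure.map (fun z => z - x) (K x)).restrict {0}ᶜ

lemma centred_apply (K : Euc n → Measure (Euc n)) (x : Euc n) {A : Set (Euc n)}
    (hA : MeasurableSet A) : centred K x A = K x {z | z - x ∈ A ∧ z ≠ x} := by
  rw [centred, Measure.restrict_apply hA, Measure.map_apply (by fun_prop)
    (hA.inter (measurableSet_singleton 0).compl)]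
  congr 1
  ext z
  simp [sub_eq_zero]

lemma centred_eq_map (K : Euc n → Measure (Euc n)) (x : Euc n) :
    centred K x = Measure.map (fun z => z - x) ((K x).restrict {x}ᶜ) := by
  rw [centred, Measure.restrict_map (by fun_prop) (measurableSet_singleton 0).compl]
  congr 2
  ext z
  simp [sub_eq_zero]

lemma centred_singleton_zero (K : Euc n → Measure (Euc n)) (x : Euc n) : centred K x {0} = 0 := by
  rw [centred, Measure.restrict_apply (measurableSet_singleton 0)]
  simp

lemma annBd_centred {s lam Lam : ℝ} {K : Euc n → Measure (Euc n)} (hK : DivElliptic s lam Lam K)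
    (x : Euc n) : AnnBd (2 * s) Lam (centred K x) := by
  intro ρ hρ
  have h := hK.1 x ρ hρ
  have h1 : centred K x (ball 0 (2 * ρ) \ ball 0 ρ) ≤ K x (ball x (2 * ρ) \ ball x ρ) := by
    rw [centred_apply K x (measurableSet_ball.diff measurableSet_ball)]
    refine measure_mono fun z hz => ?_
    simpa [dist_eq_norm] using hz.1
  have h2 : 0 < ρ ^ (2 * s) := by positivity
  calc _ ≤ K x (ball x (2 * ρ) \ ball x ρ) := h1
    _ = ENNReal.ofReal (ρ ^ (-(2 * s))) * (ENNReal.ofReal (ρ ^ (2 * s)) *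
        K x (ball x (2 * ρ) \ ball x ρ)) := by
      rw [← mul_assoc, ← ENNReal.ofReal_mul (by positivity), ← Real.rpow_add hρ]
      simp
    _ ≤ ENNReal.ofReal (ρ ^ (-(2 * s))) * ENNReal.ofReal Lam := by gcongr
    _ = _ := by rw [← ENNReal.ofReal_mul (by positivity), mul_comm]

lemma centred_compl_ball (K : Euc n → Measure (Euc n)) (x : Euc n) {r : ℝ} (hr : 0 < r) :
    centred K x (ball 0 r)ᶜ = K x (ball x r)ᶜ := by
  rw [centred_apply K x measurableSet_ball.compl]
  congr 1
  ext z
  simp only [mem_compl_iff, mem_ball, dist_eq_norm, sub_zero, mem_ofPred_eq, not_lt,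
    and_iff_left_iff_imp]
  rintro h rfl
  simp at h
  linarith

lemma measurable_section_of_bounded {K : Euc n → Measure (Euc n)} (hK : MeasKernel K)
    (hfin : ∀ r : ℝ, 0 < r → ∃ C : ℝ≥0∞, C < ⊤ ∧ ∀ x, K x (ball x r)ᶜ ≤ C)
    {S : Set (Euc n × Euc n)} (hS : MeasurableSet S) {ε : ℝ} (hε : 0 < ε)
    (hSε : ∀ x, Prod.mk x ⁻¹' S ⊆ (ball x ε)ᶜ) : Measurable fun x => K x (Prod.mk x ⁻¹' S) := by
  classical
  let κ : ProbabilityTheory.Kernel (Euc n) (Euc n) :=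
    ⟨K, Measure.measurable_of_measurable_coe K hK⟩
  let q := TopologicalSpace.denseSeq (Euc n)
  let k : ℕ → ProbabilityTheory.Kernel (Euc n) (Euc n) := fun i =>
    ProbabilityTheory.Kernel.piecewise (measurableSet_ball (x := q i) (ε := ε / 4))
      (κ.restrict (measurableSet_ball (x := q i) (ε := ε / 2)).compl) 0
  have hk : ∀ i x, k i x = if x ∈ ball (q i) (ε / 4) then (K x).restrict (ball (q i) (ε / 2))ᶜ
      else 0 := by
    intro i x
    simp only [k, ProbabilityTheory.Kernel.piecewise_apply, ProbabilityTheory.Kernel.restrict_apply]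
    rfl
  obtain ⟨C, hC, hKC⟩ := hfin (ε / 4) (by positivity)
  have hkf : ∀ i, ProbabilityTheory.IsFiniteKernel (k i) := by
    refine fun i => ⟨C, hC, fun x => ?_⟩
    rw [hk]
    split_ifs with hx
    · rw [Measure.restrict_apply_univ]
      refine (measure_mono ?_).trans (hKC x)
      rw [compl_subset_compl]
      intro z hz
      rw [mem_ball] at hz hx ⊢
      linarith [dist_triangle z x (q i)]
    · simp
  have hm : ∀ i, Measurable fun x => k i x (Prod.mk x ⁻¹' S) := fun i =>
    have := hkf i
    ProbabilityTheory.Kernel.measurable_kernel_prodMk_left hS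
  have heq : (fun x => K x (Prod.mk x ⁻¹' S)) = fun x => ⨆ i, k i x (Prod.mk x ⁻¹' S) := by
    funext x
    apply le_antisymm
    · obtain ⟨i, hi⟩ := (TopologicalSpace.denseRange_denseSeq (Euc n)).exists_mem_open
        isOpen_ball (nonempty_ball.2 (by positivity : 0 < ε / 4) : (ball x (ε / 4)).Nonempty)
      have hx : x ∈ ball (q i) (ε / 4) := by rwa [mem_ball_comm]
      refine le_iSup_of_le i ?_
      rw [hk, if_pos hx, Measure.restrict_apply (measurable_prodMk_left hS)]
      refine measure_mono fun z hz => ⟨hz, ?_⟩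
      have := hSε x hz
      simp only [mem_compl_iff, mem_ball, not_lt] at this hx ⊢
      rw [dist_comm x] at hx
      linarith [dist_triangle z (q i) x]
    · refine iSup_le fun i => ?_
      rw [hk]
      split_ifs
      · exact Measure.restrict_apply_le _ _
      · simp
  rw [heq]
  exact Measurable.iSup hm

lemma exists_offDiag_kernel {K : Euc n → Measure (Euc n)} (hK : MeasKernel K)
    (hfin : ∀ r : ℝ, 0 < r → ∃ C : ℝ≥0∞, C < ⊤ ∧ ∀ x, K x (ball x r)ᶜ ≤ C) :
    ∃ κ : ProbabilityTheory.Kernel (Euc n) (Euc n), ProbabilityTheory.IsSFiniteKernel κ ∧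
      ∀ x, κ x = (K x).restrict {x}ᶜ := by
  let ann : ℤ → Euc n → Set (Euc n) := fun j x => {z | z - x ∈ dyadAnn 1 j}
  have hann : ∀ j x, MeasurableSet (ann j x) := fun j x =>
    (by fun_prop : Measurable fun z : Euc n => z - x) (measurableSet_dyadAnn 1 j)
  have hfar : ∀ j x, ann j x ⊆ (ball x (2 ^ j))ᶜ := by
    intro j x z hz
    have := (mem_dyadAnn.1 hz).2
    simpa [dist_eq_norm] using this
  have hmeas : ∀ j, Measurable fun x => (K x).restrict (ann j x) := by
    intro j
    refine Measure.measurable_of_measurable_coe _ fun A hA => ?_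
    have hS : MeasurableSet {p : Euc n × Euc n | p.2 ∈ A ∧ p.2 - p.1 ∈ dyadAnn 1 j} :=
      (measurable_snd hA).inter
        ((by fun_prop : Measurable fun p : Euc n × Euc n => p.2 - p.1) (measurableSet_dyadAnn 1 j))
    have := measurable_section_of_bounded hK hfin hS (by positivity : (0 : ℝ) < 2 ^ j)
      (fun x z hz => hfar j x hz.2)
    simp only [Measure.restrict_apply hA]
    exact this
  let k : ℤ → ProbabilityTheory.Kernel (Euc n) (Euc n) := fun j => ⟨_, hmeas j⟩
  have hk : ∀ j, ProbabilityTheory.IsFiniteKernel (k j) := by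
    intro j
    obtain ⟨C, hC, hKC⟩ := hfin (2 ^ j) (by positivity)
    refine ⟨C, hC, fun x => ?_⟩
    change (K x).restrict (ann j x) univ ≤ C
    rw [Measure.restrict_apply_univ]
    exact (measure_mono (hfar j x)).trans (hKC x)
  refine ⟨ProbabilityTheory.Kernel.sum k, inferInstance, fun x => ?_⟩
  have hU : ⋃ j, ann j x = {x}ᶜ := by
    have h := iUnion_dyadAnn (n := n) one_pos
    ext z
    have hz := Set.ext_iff.1 h (z - x)
    simp only [mem_iUnion, mem_compl_iff, mem_singleton_iff, sub_eq_zero] at hz ⊢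
    exact hz
  have hd : Pairwise (Function.onFun Disjoint fun j => ann j x) := fun i j hij =>
    (pairwise_disjoint_dyadAnn one_pos hij).preimage fun z => z - x
  ext A hA
  rw [ProbabilityTheory.Kernel.sum_apply' _ _ hA, ← hU,
    Measure.restrict_iUnion_apply hd (fun j => hann j x) hA]
  rfl

open ProbabilityTheory in
lemma map_swap_compProd {κ : Kernel (Euc n) (Euc n)} [IsSFiniteKernel κ]
    (hsym : ∀ A B : Set (Euc n), MeasurableSet A → MeasurableSet B → Disjoint A B →
      ∫⁻ x in A, κ x B = ∫⁻ x in B, κ x A)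
    (hdiag : ∀ x, κ x {x} = 0)
    (hfin : ∀ r : ℝ, 0 < r → ∃ C : ℝ≥0∞, C < ⊤ ∧ ∀ x, κ x (ball x r)ᶜ ≤ C) :
    Measure.map Prod.swap ((volume : Measure (Euc n)) ⊗ₘ κ) = volume ⊗ₘ κ := by
  obtain ⟨Θ, hΘ⟩ : ∃ Θ, Θ = (volume : Measure (Euc n)) ⊗ₘ κ := ⟨_, rfl⟩
  rw [← hΘ]
  have hrect : ∀ A B : Set (Euc n), MeasurableSet A → MeasurableSet B →
      Θ (A ×ˢ B) = ∫⁻ x in A, κ x B := fun A B hA hB => by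
    rw [hΘ, Measure.compProd_apply_prod hA hB]
  have hswap : ∀ A B : Set (Euc n), MeasurableSet A → MeasurableSet B →
      Measure.map Prod.swap Θ (A ×ˢ B) = ∫⁻ x in B, κ x A := fun A B hA hB => by
    rw [Measure.map_apply measurable_swap (hA.prod hB), preimage_swap_prod, hrect B A hB hA]
  let q := TopologicalSpace.denseSeq (Euc n)
  let r : ℕ → ℝ := fun m => 1 / ((m : ℝ) + 1)
  have hr : ∀ m, 0 < r m := fun m => by positivity
  let S : ℕ × ℕ × ℕ → Set (Euc n × Euc n) := fun i =>
    {p | 4 * r i.2.2 ≤ dist (q i.1) (q i.2.1) ∧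
      p ∈ ball (q i.1) (r i.2.2) ×ˢ ball (q i.2.1) (r i.2.2)}
  have hS : ⋃ i, S i = {p : Euc n × Euc n | p.1 ≠ p.2} := by
    ext ⟨x, z⟩
    simp only [S, mem_iUnion, mem_ofPred_eq, mem_prod, mem_ball, Prod.exists]
    constructor
    · rintro ⟨i, j, m, h1, h2, h3⟩ rfl
      have := hr m
      rw [dist_comm] at h2
      linarith [dist_triangle (q i) x (q j)]
    · intro hxz
      obtain ⟨m, hm⟩ := exists_nat_one_div_lt (by
        have := dist_pos.2 hxz
        positivity : 0 < dist x z / 6)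
      have hex : ∀ y : Euc n, ∃ i, dist y (q i) < r m := fun y => by
        obtain ⟨i, hi⟩ := (TopologicalSpace.denseRange_denseSeq (Euc n)).exists_mem_open
          isOpen_ball (nonempty_ball.2 (hr m) : (ball y (r m)).Nonempty)
        exact ⟨i, mem_ball'.1 hi⟩
      obtain ⟨i, hi⟩ := hex x
      obtain ⟨j, hj⟩ := hex z
      refine ⟨i, j, m, ?_, hi, hj⟩
      have h1 := dist_triangle4 x (q i) (q j) z
      rw [dist_comm (q j)] at h1
      change r m < _ at hm
      linarith
  have hSr : ∀ i, (Measure.map Prod.swap Θ).restrict (S i) = Θ.restrict (S i) := by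
    rintro ⟨i, j, m⟩
    by_cases hij : 4 * r m ≤ dist (q i) (q j)
    · have hSeq : S (i, j, m) = ball (q i) (r m) ×ˢ ball (q j) (r m) := by
        ext p
        simp [S, hij]
      have hfar : ∀ x ∈ ball (q i) (r m), ball (q j) (r m) ⊆ (ball x (r m))ᶜ := by
        intro x hx z hz
        simp only [mem_ball, mem_compl_iff, not_lt] at hx hz ⊢
        have h1 := dist_triangle4 (q i) x z (q j)
        rw [dist_comm (q i) x, dist_comm x z] at h1
        linarith [hr m]
      have hdisj : Disjoint (ball (q i) (r m)) (ball (q j) (r m)) :=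
        ball_disjoint_ball (by linarith [hr m])
      obtain ⟨C, hC, hκC⟩ := hfin (r m) (hr m)
      have hfinΘ : Θ (ball (q i) (r m) ×ˢ ball (q j) (r m)) < ⊤ := by
        rw [hrect _ _ measurableSet_ball measurableSet_ball]
        calc _ ≤ ∫⁻ x in ball (q i) (r m), C :=
              setLIntegral_mono measurable_const fun x hx => (measure_mono (hfar x hx)).trans (hκC x)
          _ = C * volume (ball (q i) (r m)) := setLIntegral_const _ _
          _ < ⊤ := ENNReal.mul_lt_top hC measure_ball_lt_top
      rw [hSeq]
      have : IsFiniteMeasure (Θ.restrict (ball (q i) (r m) ×ˢ ball (q j) (r m))) :=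
        ⟨by rwa [Measure.restrict_apply_univ]⟩
      symm
      refine Measure.ext_prod fun {s t} hs ht => ?_
      rw [Measure.restrict_apply (hs.prod ht), Measure.restrict_apply (hs.prod ht), prod_inter_prod,
        hrect _ _ (hs.inter measurableSet_ball) (ht.inter measurableSet_ball),
        hswap _ _ (hs.inter measurableSet_ball) (ht.inter measurableSet_ball)]
      exact hsym _ _ (hs.inter measurableSet_ball) (ht.inter measurableSet_ball)
        (hdisj.mono inter_subset_right inter_subset_right)
    · have hSeq : S (i, j, m) = ∅ := by
        ext p
        simp [S, hij]
      simp [hSeq]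
  have hoff := (Measure.restrict_iUnion_congr).2 hSr
  rw [hS] at hoff
  have hD : MeasurableSet {p : Euc n × Euc n | p.1 = p.2} :=
    measurableSet_eq_fun measurable_fst measurable_snd
  have h0 : Θ {p : Euc n × Euc n | p.1 = p.2} = 0 := by
    rw [hΘ, Measure.compProd_apply hD]
    refine (lintegral_congr fun x => ?_).trans lintegral_zero
    rw [← hdiag x]
    congr 1
    ext z
    simp [eq_comm]
  have h0' : Measure.map Prod.swap Θ {p : Euc n × Euc n | p.1 = p.2} = 0 := by
    rw [Measure.map_apply measurable_swap hD, ← h0]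
    congr 1
    ext p
    simp [eq_comm]
  have hres : ∀ m : Measure (Euc n × Euc n), m {p | p.1 = p.2} = 0 →
      m.restrict {p | p.1 ≠ p.2} = m := fun m hm =>
    Measure.restrict_eq_self_of_ae_mem (by
      rw [ae_iff]
      simpa using hm)
  rwa [hres _ h0', hres _ h0] at hoff

open ProbabilityTheory in
/-- For a swap-invariant measure `volume ⊗ₘ κ` and a symmetric integrand vanishing off
`(B × ℝⁿ) ∪ (ℝⁿ × B)`, the double integral reduces to one where the outer variable is in `B`. -/
lemma integral_symm_eq_setIntegral {p q β : ℝ} (hq : 0 ≤ q) (hqβ : q < β) (hβp : β < p)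
    {κ : Kernel (Euc n) (Euc n)} [IsSFiniteKernel κ]
    (hκ : Measure.map Prod.swap ((volume : Measure (Euc n)) ⊗ₘ κ) = volume ⊗ₘ κ)
    {D : ℝ} (hD : 0 ≤ D) (hκD : ∀ x, AnnBd β D (Measure.map (fun z => z - x) (κ x)))
    {B : Set (Euc n)} [DecidablePred (· ∈ B)] (hB : MeasurableSet B) (hBv : volume B ≠ ⊤)
    {G : Euc n × Euc n → ℝ} (hG : Measurable G) (hGs : ∀ x z, G (x, z) = G (z, x))
    (hG0 : ∀ x ∉ B, ∀ z ∉ B, G (x, z) = 0) {b r : ℝ} (hb : 0 ≤ b) (hr : 0 < r)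
    (hGb : ∀ x z, |G (x, z)| ≤ b * min ((‖z - x‖ / r) ^ p) ((‖z - x‖ / r) ^ q)) :
    Integrable G ((volume : Measure (Euc n)) ⊗ₘ κ) ∧
    ∫ x, ∫ z, G (x, z) ∂(κ x) = ∫ x in B, ∫ z, (if z ∈ B then 1 else 2) * G (x, z) ∂(κ x) ∧
    IntegrableOn (fun x => ∫ z, (if z ∈ B then 1 else 2) * G (x, z) ∂(κ x)) B := by
  obtain ⟨c, hc, hcb⟩ := lintegral_min_rpow_le hq hqβ hβp
  obtain ⟨Θ, hΘ⟩ : ∃ Θ, Θ = (volume : Measure (Euc n)) ⊗ₘ κ := ⟨_, rfl⟩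
  let H : Euc n × Euc n → ℝ := fun p => (if p.2 ∈ B then 1 else 2) * G p
  have hHm : Measurable H :=
    (Measurable.ite (measurable_snd hB) measurable_const measurable_const).mul hG
  have hBu : MeasurableSet (B ×ˢ (univ : Set (Euc n))) := hB.prod MeasurableSet.univ
  let H₁ := (B ×ˢ (univ : Set (Euc n))).indicator H
  have hH₁m : Measurable H₁ := hHm.indicator hBu
  have hHb : ∀ p, ‖G p‖ ≤ ‖H p‖ ∧ ‖H p‖ ≤ 2 * ‖G p‖ := by
    intro p
    simp only [H, norm_mul]
    have := norm_nonneg (G p)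
    split_ifs
    · simp only [norm_one]; constructor <;> linarith
    · rw [Real.norm_two]; constructor <;> linarith
  have hH₁ : Integrable H₁ Θ := by
    refine ⟨hH₁m.aestronglyMeasurable, ?_⟩
    rw [HasFiniteIntegral, hΘ, Measure.lintegral_compProd hH₁m.enorm]
    calc _ ≤ ∫⁻ x, B.indicator (fun _ => ENNReal.ofReal (2 * b) *
          ENNReal.ofReal (c * D * r ^ (-β))) x := by
          refine lintegral_mono fun x => ?_
          by_cases hx : x ∈ B
          · rw [indicator_of_mem hx]
            refine le_trans ?_ (mul_le_mul_right (hcb _ D r hD hr (hκD x)) _)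
            rw [lintegral_map (by fun_prop) (by fun_prop),
              ← lintegral_const_mul _ (by fun_prop)]
            refine lintegral_mono fun z => ?_
            rw [← ENNReal.ofReal_mul (by positivity), ← ofReal_norm]
            apply ENNReal.ofReal_le_ofReal
            have h1 : H₁ (x, z) = H (x, z) := indicator_of_mem (by simp [hx]) _
            rw [h1, mul_assoc]
            exact (hHb _).2.trans (mul_le_mul_of_nonneg_left (hGb x z) (by norm_num))
          · rw [indicator_of_notMem hx]
            simp [H₁, hx]
      _ = ENNReal.ofReal (2 * b) * ENNReal.ofReal (c * D * r ^ (-β)) * volume B :=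
          lintegral_indicator_const hB _
      _ < ⊤ := by finiteness
  let G₁ := (B ×ˢ (univ : Set (Euc n))).indicator G
  let G₂ := (Bᶜ ×ˢ B).indicator G
  let G₃ := (B ×ˢ Bᶜ).indicator G
  have hG₁ : Integrable G₁ Θ := hH₁.mono (hG.indicator hBu).aestronglyMeasurable
    (ae_of_all _ fun p => by
      simp only [G₁, H₁, norm_indicator_eq_indicator_norm]
      exact indicator_le_indicator (hHb p).1)
  have hG₃ : Integrable G₃ Θ := hG₁.mono (hG.indicator (hB.prod hB.compl)).aestronglyMeasurable
    (ae_of_all _ fun p => by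
      simp only [G₁, G₃, norm_indicator_eq_indicator_norm]
      exact indicator_le_indicator_of_subset (prod_mono_right (subset_univ _))
        (fun _ => norm_nonneg _) p)
  have hG₂m : Measurable G₂ := hG.indicator (hB.compl.prod hB)
  have hG₂₃ : G₂ ∘ Prod.swap = G₃ := by
    funext ⟨x, z⟩
    simp only [G₂, G₃, Function.comp_apply, Prod.swap_prod_mk, indicator, mem_prod, hGs z x,
      and_comm]
  have hmp : MeasurePreserving Prod.swap Θ Θ := ⟨measurable_swap, by rw [hΘ, hκ]⟩
  have hG₂ : Integrable G₂ Θ := by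
    rw [← hmp.integrable_comp hG₂m.aestronglyMeasurable, hG₂₃]
    exact hG₃
  have hsum : G = G₁ + G₂ := by
    funext ⟨x, z⟩
    simp only [Pi.add_apply, G₁, G₂, indicator, mem_prod, mem_univ, and_true, mem_compl_iff]
    by_cases hx : x ∈ B <;> by_cases hz : z ∈ B <;> simp [hx, hz, hG0]
  have hsum' : H₁ = G₁ + G₃ := by
    funext ⟨x, z⟩
    simp only [Pi.add_apply, G₁, G₃, H₁, H, indicator, mem_prod, mem_univ, and_true, mem_compl_iff]
    by_cases hx : x ∈ B <;> by_cases hz : z ∈ B <;> simp [hx, hz]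
    ring
  have hGi : Integrable G Θ := hsum ▸ hG₁.add hG₂
  have hint₂₃ : ∫ p, G₂ p ∂Θ = ∫ p, G₃ p ∂Θ := by
    conv_lhs => rw [← hmp.map_eq]
    rw [integral_map measurable_swap.aemeasurable hG₂m.aestronglyMeasurable]
    exact integral_congr_ae (ae_of_all _ fun p => congrFun hG₂₃ p)
  have hint : ∫ p, G p ∂Θ = ∫ p, H₁ p ∂Θ := by
    rw [hsum, hsum', integral_add' hG₁ hG₂, integral_add' hG₁ hG₃, hint₂₃]
  have hfst : (fun x => ∫ z, H₁ (x, z) ∂(κ x)) = B.indicator fun x => ∫ z, H (x, z) ∂(κ x) := by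
    funext x
    by_cases hx : x ∈ B <;> simp [H₁, hx, indicator]
  rw [hΘ] at hGi hint hH₁
  refine ⟨hGi, ?_, ?_⟩
  · rw [← Measure.integral_compProd hGi, hint, Measure.integral_compProd hH₁, hfst,
      integral_indicator hB]
  · rw [← integrable_indicator_iff hB, ← hfst]
    exact Integrable.integral_compProd hH₁

open ProbabilityTheory in
/-- The translation-invariant kernel `x ↦ ν(· - x)`. -/
def translationKernel (ν : Measure (Euc n)) : Kernel (Euc n) (Euc n) :=
  (Kernel.id ×ₖ Kernel.const (Euc n) ν).map fun p => p.1 + p.2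

lemma translationKernel_apply (ν : Measure (Euc n)) [SFinite ν] (x : Euc n) :
    translationKernel ν x = Measure.map (fun y => x + y) ν := by
  rw [translationKernel, ProbabilityTheory.Kernel.map_apply _ (by fun_prop),
    ProbabilityTheory.Kernel.prod_apply, ProbabilityTheory.Kernel.id_apply,
    ProbabilityTheory.Kernel.const_apply, Measure.dirac_prod,
    Measure.map_map (by fun_prop) (by fun_prop)]
  rfl

instance (ν : Measure (Euc n)) [SFinite ν] :
    ProbabilityTheory.IsSFiniteKernel (translationKernel ν) := by
  unfold translationKernel
  infer_instance

lemma map_sub_translationKernel (ν : Measure (Euc n)) [SFinite ν] (x : Euc n) :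
    Measure.map (fun z => z - x) (translationKernel ν x) = ν := by
  rw [translationKernel_apply, Measure.map_map (by fun_prop) (by fun_prop)]
  convert Measure.map_id
  ext1 y
  simp

lemma integral_translationKernel {ν : Measure (Euc n)} [SFinite ν] (x : Euc n) (g : Euc n → ℝ) :
    ∫ z, g z ∂(translationKernel ν x) = ∫ y, g (x + y) ∂ν := by
  rw [translationKernel_apply]
  exact (MeasurableEquiv.addLeft x).measurableEmbedding.integral_map g

lemma setLIntegral_translationKernel_comm {ν : Measure (Euc n)} [SFinite ν]
    (hν : Measure.map (fun y => -y) ν = ν) {A B : Set (Euc n)}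
    (hA : MeasurableSet A) (hB : MeasurableSet B) :
    ∫⁻ x in A, translationKernel ν x B = ∫⁻ x in B, translationKernel ν x A := by
  have h : ∀ S T : Set (Euc n), MeasurableSet S → MeasurableSet T →
      ∫⁻ x in S, translationKernel ν x T =
        ∫⁻ y, ∫⁻ x, S.indicator 1 x * T.indicator 1 (x + y) ∂volume ∂ν := by
    intro S T hS hT
    rw [lintegral_lintegral_swap]
    · rw [← lintegral_indicator hS]
      refine lintegral_congr fun x => ?_
      by_cases hx : x ∈ S
      · simp only [hx, indicator_of_mem, Pi.one_apply, one_mul]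
        rw [translationKernel_apply, Measure.map_apply (by fun_prop) hT]
        rw [← lintegral_indicator_one (hT.preimage (by fun_prop))]
        rfl
      · simp [hx]
    · exact Measurable.aemeasurable (by
        apply Measurable.mul
        · exact (measurable_one.indicator hS).comp measurable_snd
        · exact (measurable_one.indicator hT).comp (by fun_prop))
  rw [h A B hA hB, h B A hB hA]
  conv_rhs => rw [← hν]
  rw [lintegral_map _ (by fun_prop)]
  · refine lintegral_congr fun y => ?_
    rw [← lintegral_add_right_eq_self (fun x => B.indicator 1 x * A.indicator 1 (x + -y)) y]
    simp [mul_comm]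
  · apply Measurable.lintegral_prod_right'
      (f := fun p : Euc n × Euc n => B.indicator (1 : Euc n → ℝ≥0∞) p.2 *
        A.indicator (1 : Euc n → ℝ≥0∞) (p.2 + p.1))
    apply Measurable.mul
    · exact (measurable_one.indicator hB).comp measurable_snd
    · exact (measurable_one.indicator hA).comp (by fun_prop)

open ProbabilityTheory in
lemma map_swap_compProd_translationKernel {β D : ℝ} (hβ : 0 < β) (hD : 0 ≤ D)
    {ν : Measure (Euc n)} [SFinite ν] (hν : Measure.map (fun y => -y) ν = ν)
    (hν0 : ν {0} = 0) (hνD : AnnBd β D ν) :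
    Measure.map Prod.swap ((volume : Measure (Euc n)) ⊗ₘ translationKernel ν) =
      volume ⊗ₘ translationKernel ν := by
  obtain ⟨c, hc, hcb⟩ := exists_measure_compl_ball_le hβ
  refine map_swap_compProd (fun A B hA hB _ => setLIntegral_translationKernel_comm hν hA hB) ?_ ?_
  · intro x
    rw [translationKernel_apply, Measure.map_apply (by fun_prop) (measurableSet_singleton x)]
    convert hν0
    ext y
    simp
  · refine fun r hr => ⟨ENNReal.ofReal (c * D * r ^ (-β)), ENNReal.ofReal_lt_top, fun x => ?_⟩
    rw [translationKernel_apply, Measure.map_apply (by fun_prop) measurableSet_ball.compl]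
    refine le_of_eq_of_le ?_ (hcb ν D r hD hr hνD)
    congr 1
    ext y
    simp

/-- The Dirichlet form of an even translation-invariant operator, tested against `η`, in terms of
second differences. -/
lemma integral_dirichlet_eq {p q β : ℝ} (hq : 0 ≤ q) (hqβ : q < β) (hβp : β < p)
    {D : ℝ} (hD : 0 ≤ D) {ν : Measure (Euc n)} [SFinite ν]
    (hν : Measure.map (fun y => -y) ν = ν) (hν0 : ν {0} = 0) (hνD : AnnBd β D ν)
    {u η : Euc n → ℝ} (hu : Continuous u) (huc : HasCompactSupport u) (hη : Continuous η)
    (hηc : HasCompactSupport η) {b r : ℝ} (hb : 0 ≤ b) (hr : 0 < r)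
    (hGb : ∀ x z, |(u x - u z) * (η x - η z)| ≤
      b * min ((‖z - x‖ / r) ^ p) ((‖z - x‖ / r) ^ q)) :
    ∫ x, ∫ y, (u x - u (x + y)) * (η x - η (x + y)) ∂ν =
      -∫ y, ∫ x, η x * secDiff u x y ∂volume ∂ν := by
  classical
  obtain ⟨ρ, hρ⟩ := hηc.isCompact.isBounded.subset_ball (0 : Euc n)
  have hG0 : ∀ x ∉ ball (0 : Euc n) ρ, ∀ z ∉ ball (0 : Euc n) ρ,
      (u x - u z) * (η x - η z) = 0 := by
    intro x hx z hz
    rw [image_eq_zero_of_notMem_tsupport fun h => hx (hρ h),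
      image_eq_zero_of_notMem_tsupport fun h => hz (hρ h)]
    simp
  obtain ⟨hint, -, -⟩ := integral_symm_eq_setIntegral hq hqβ hβp
    (map_swap_compProd_translationKernel (by linarith) hD hν hν0 hνD) hD
    (fun x => by rwa [map_sub_translationKernel]) measurableSet_ball measure_ball_lt_top.ne
    (G := fun p => (u p.1 - u p.2) * (η p.1 - η p.2)) (by fun_prop) (fun x z => by ring) hG0 hb hr
    hGb
  have hmap : Measure.map (fun p : Euc n × Euc n => (p.1, p.1 + p.2)) (volume.prod ν) =
      volume.compProd (translationKernel ν) := by
    ext S hS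
    rw [Measure.map_apply (by fun_prop) hS, Measure.compProd_apply hS,
      Measure.prod_apply (hS.preimage (by fun_prop))]
    refine lintegral_congr fun x => ?_
    rw [translationKernel_apply, Measure.map_apply (by fun_prop) (hS.preimage (by fun_prop))]
    rfl
  rw [← hmap, integrable_map_measure (by fun_prop) (by fun_prop)] at hint
  rw [integral_integral_swap (f := fun x y => (u x - u (x + y)) * (η x - η (x + y))) hint,
    ← integral_neg]
  refine integral_congr_ae (ae_of_all _ fun y => ?_)
  have i1 : Integrable (fun x => u x * η x) :=
    (hu.mul hη).integrable_of_hasCompactSupport huc.mul_right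
  have i2 : Integrable (fun x => u (x + y) * η x) :=
    ((hu.comp (continuous_add_const y)).mul hη).integrable_of_hasCompactSupport hηc.mul_left
  have i3 : Integrable (fun x => u (x - y) * η x) :=
    ((hu.comp (continuous_sub_right y)).mul hη).integrable_of_hasCompactSupport hηc.mul_left
  have i1' : Integrable (fun x => u (x + y) * η (x + y)) := i1.comp_add_right y
  have i3' : Integrable (fun x => u x * η (x + y)) := by simpa using i3.comp_add_right y
  have a1 : Integrable (fun x => u x * η x + u (x + y) * η (x + y)) := i1.add i1'
  have a2 : Integrable (fun x => u (x + y) * η x + u x * η (x + y)) := i2.add i3'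
  have a3 : Integrable (fun x => u (x + y) * η x + u (x - y) * η x) := i2.add i3
  have a4 : Integrable (fun x => u x * η x + u x * η x) := i1.add i1
  have e1 : ∫ x, u (x + y) * η (x + y) = ∫ x, u x * η x :=
    integral_add_right_eq_self (fun x => u x * η x) y
  have e3 : ∫ x, u x * η (x + y) = ∫ x, u (x - y) * η x := by
    simpa using integral_add_right_eq_self (fun x => u (x - y) * η x) y
  calc ∫ x, (u x - u (x + y)) * (η x - η (x + y))
      = ∫ x, ((u x * η x + u (x + y) * η (x + y)) - (u (x + y) * η x + u x * η (x + y))) := by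
        congr 1; ext x; ring
    _ = -∫ x, (u (x + y) * η x + u (x - y) * η x - (u x * η x + u x * η x)) := by
        rw [integral_sub a1 a2, integral_sub a3 a4,
          integral_add i1 i1', integral_add i2 i3', integral_add i2 i3, integral_add i1 i1, e1, e3]
        ring
    _ = -∫ x, η x * secDiff u x y := by
        congr 2; ext x; rw [secDiff]; ring

lemma map_sub_measure_le {μ ν : Measure (Euc n)} [IsFiniteMeasure μ] [IsFiniteMeasure ν]
    {g : Euc n → Euc n} (hg : Measurable g) :
    Measure.map g μ - Measure.map g ν ≤ Measure.map g (μ - ν) := by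
  apply Measure.sub_le_of_le_add
  rw [← Measure.map_add _ _ hg]
  refine Measure.map_mono ?_ hg
  rw [add_comm, add_sub_eq_add_sub_of_isFinite]
  exact Measure.le_add_right le_rfl

lemma tvDiff_map_sub_le {μ ν : Measure (Euc n)} (a : Euc n) {A : Set (Euc n)}
    (hA : MeasurableSet A) (hμ : μ {z | z - a ∈ A} ≠ ⊤) (hν : ν {z | z - a ∈ A} ≠ ⊤) :
    tvDiff (Measure.map (fun z => z - a) μ) (Measure.map (fun z => z - a) ν) A ≤
      tvDiff μ ν {z | z - a ∈ A} := by
  have hm : Measurable fun z : Euc n => z - a := by fun_prop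
  have : IsFiniteMeasure (μ.restrict ((fun z => z - a) ⁻¹' A)) :=
    ⟨by rw [Measure.restrict_apply_univ]; exact hμ.lt_top⟩
  have : IsFiniteMeasure (ν.restrict ((fun z => z - a) ⁻¹' A)) :=
    ⟨by rw [Measure.restrict_apply_univ]; exact hν.lt_top⟩
  rw [tvDiff, Measure.restrict_map hm hA, Measure.restrict_map hm hA]
  refine add_le_add ?_ ?_ <;>
  · refine (map_sub_measure_le hm _).trans_eq ?_
    rw [Measure.map_apply hm MeasurableSet.univ]
    rfl

lemma restrict_centred (K : Euc n → Measure (Euc n)) (x : Euc n) {A : Set (Euc n)}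
    (hA : MeasurableSet A) (h0 : (0 : Euc n) ∉ A) :
    (centred K x).restrict A = (Measure.map (fun z => z - x) (K x)).restrict A := by
  rw [centred, Measure.restrict_restrict hA, inter_eq_left.2]
  rintro y hy rfl
  exact h0 hy

lemma zero_notMem_annulus {ρ : ℝ} (hρ : 0 < ρ) :
    (0 : Euc n) ∉ ball (0 : Euc n) (2 * ρ) \ ball 0 ρ := fun h => h.2 (mem_ball_self hρ)

lemma tvDiff_centred_le {s α lam Lam M : ℝ} {K : Euc n → Measure (Euc n)}
    (hK : DivElliptic s lam Lam K) (hreg : XReg s α M K) (x₀ x : Euc n) {ρ : ℝ} (hρ : 0 < ρ) :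
    tvDiff (centred K x) (centred K x₀) (ball 0 (2 * ρ) \ ball 0 ρ) ≤
      ENNReal.ofReal (M * ‖x - x₀‖ ^ α * ρ ^ (-(2 * s))) := by
  have hAm : MeasurableSet (ball (0 : Euc n) (2 * ρ) \ ball 0 ρ) :=
    measurableSet_ball.diff measurableSet_ball
  have h := hreg x₀ (x - x₀) ρ hρ
  have hfin : ∀ y, K y (ball y (2 * ρ) \ ball y ρ) ≠ ⊤ := by
    intro y hy
    have := hK.1 y ρ hρ
    rw [hy, ENNReal.mul_top (by simpa using by positivity)] at this
    simp at this
  have hset : {z : Euc n | z - x₀ ∈ ball (0 : Euc n) (2 * ρ) \ ball 0 ρ} =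
      ball x₀ (2 * ρ) \ ball x₀ ρ := by
    ext z
    simp [dist_eq_norm]
  rw [add_sub_cancel] at h
  refine le_trans ?_ h
  rw [← hset]
  refine le_trans (le_of_eq ?_) (tvDiff_map_sub_le x₀ hAm ?_ ?_)
  · rw [tvDiff, tvDiff, restrict_centred _ _ hAm (zero_notMem_annulus hρ),
      restrict_centred _ _ hAm (zero_notMem_annulus hρ),
      Measure.map_map (by fun_prop) (by fun_prop)]
    have : ((fun z => z - x₀) ∘ fun z => z - (x - x₀)) = fun z => z - x := by
      funext z
      simp only [Function.comp_apply]
      abel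
    rw [this]
  · rw [hset, Measure.map_apply (by fun_prop) (measurableSet_ball.diff measurableSet_ball)]
    convert hfin x using 2
    ext z
    simp [dist_eq_norm, sub_sub]
  · rw [hset]
    exact hfin x₀

lemma tvDiff_centred_neg_le {s α M : ℝ} {K : Euc n → Measure (Euc n)} (heven : AlmostEven s α M K)
    (x : Euc n) {ρ : ℝ} (hρ : 0 < ρ) :
    tvDiff (centred K x) (Measure.map (fun y => -y) (centred K x)) (ball 0 (2 * ρ) \ ball 0 ρ) ≤
      ENNReal.ofReal (M * ρ ^ (α - 2 * s)) := by
  have hAm : MeasurableSet (ball (0 : Euc n) (2 * ρ) \ ball 0 ρ) :=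
    measurableSet_ball.diff measurableSet_ball
  refine le_of_eq_of_le ?_ (heven x ρ hρ)
  have hneg : (fun y : Euc n => -y) ⁻¹' (ball (0 : Euc n) (2 * ρ) \ ball 0 ρ) =
      ball (0 : Euc n) (2 * ρ) \ ball 0 ρ := by
    ext y
    simp
  have hmap : Measure.map (fun z => x - z) (K x) =
      Measure.map (fun y => -y) (Measure.map (fun z => z - x) (K x)) := by
    rw [Measure.map_map (by fun_prop) (by fun_prop)]
    congr 1
    funext z
    simp
  have hres : ∀ m : Measure (Euc n), (Measure.map (fun y => -y) m).restrict
      (ball (0 : Euc n) (2 * ρ) \ ball 0 ρ) =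
      Measure.map (fun y => -y) (m.restrict (ball (0 : Euc n) (2 * ρ) \ ball 0 ρ)) := fun m => by
    rw [Measure.restrict_map (by fun_prop) hAm, hneg]
  rw [tvDiff, tvDiff, hmap, hres, hres, restrict_centred _ _ hAm (zero_notMem_annulus hρ)]

/-- The even translation-invariant Lévy measure `K(x, x + ·) + K(x, x - ·)`. -/
def evenCentred (K : Euc n → Measure (Euc n)) (x : Euc n) : Measure (Euc n) :=
  centred K x + Measure.map (fun y => -y) (centred K x)

lemma map_neg_evenCentred (K : Euc n → Measure (Euc n)) (x : Euc n) :
    Measure.map (fun y => -y) (evenCentred K x) = evenCentred K x := by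
  rw [evenCentred, Measure.map_add _ _ (by fun_prop), Measure.map_map (by fun_prop) (by fun_prop),
    add_comm]
  congr 1
  convert Measure.map_id
  ext1 y
  simp

lemma map_neg_centred_singleton_zero (K : Euc n → Measure (Euc n)) (x : Euc n) :
    Measure.map (fun y => -y) (centred K x) {0} = 0 := by
  rw [Measure.map_apply (by fun_prop) (measurableSet_singleton 0)]
  convert centred_singleton_zero K x
  ext y
  simp

lemma evenCentred_singleton_zero (K : Euc n → Measure (Euc n)) (x : Euc n) :
    evenCentred K x {0} = 0 := by
  rw [evenCentred, Measure.add_apply, centred_singleton_zero, map_neg_centred_singleton_zero,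
    add_zero]

lemma annBd_map_neg {β D : ℝ} {ν : Measure (Euc n)} (hν : AnnBd β D ν) :
    AnnBd β D (Measure.map (fun y => -y) ν) := by
  intro ρ hρ
  rw [Measure.map_apply (by fun_prop) (measurableSet_ball.diff measurableSet_ball)]
  convert hν ρ hρ using 2
  ext y
  simp

lemma annBd_evenCentred {s lam Lam : ℝ} (hLam : 0 ≤ Lam) {K : Euc n → Measure (Euc n)}
    (hK : DivElliptic s lam Lam K) (x : Euc n) : AnnBd (2 * s) (2 * Lam) (evenCentred K x) := by
  intro ρ hρ
  have h := annBd_centred hK x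
  rw [evenCentred, Measure.add_apply, two_mul Lam, add_mul,
    ENNReal.ofReal_add (by positivity) (by positivity)]
  exact add_le_add (h ρ hρ) (annBd_map_neg h ρ hρ)

lemma le_lintegral_evenCentred {s lam Lam : ℝ} {K : Euc n → Measure (Euc n)}
    (hK : DivElliptic s lam Lam K) (x : Euc n) {r : ℝ} (hr : 0 < r) {e : Euc n} (he : ‖e‖ = 1) :
    ENNReal.ofReal lam ≤ ENNReal.ofReal (r ^ (2 * s - 2)) *
      ∫⁻ y in ball 0 r, ENNReal.ofReal (⟪e, y⟫ ^ 2) ∂(evenCentred K x) := by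
  refine (hK.2 x r hr e he).trans (mul_le_mul_right ?_ _)
  rw [evenCentred, Measure.restrict_add, lintegral_add_measure]
  refine le_trans (le_of_eq ?_) le_self_add
  rw [centred_eq_map, Measure.restrict_map (by fun_prop) measurableSet_ball,
    lintegral_map (by fun_prop) (by fun_prop), Measure.restrict_restrict (by measurability)]
  have : (fun z => z - x) ⁻¹' ball (0 : Euc n) r ∩ {x}ᶜ = ball x r \ {x} := by
    ext z
    simp [dist_eq_norm]
  rw [this, ← lintegral_indicator measurableSet_ball,
    ← lintegral_indicator (measurableSet_ball.diff (measurableSet_singleton x))]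
  refine lintegral_congr fun z => ?_
  have hz' : ⟪e, z - x⟫ ^ 2 = ⟪e, x - z⟫ ^ 2 := by rw [← neg_sub x z, inner_neg_right, neg_sq]
  by_cases hz : z = x
  · subst hz
    simp [indicator]
  · simp [indicator, hz, hz']

lemma exists_measure_compl_ball_le_of_divElliptic {s lam Lam : ℝ} (hs : 0 < s) (hLam : 0 ≤ Lam)
    {K : Euc n → Measure (Euc n)} (hK : DivElliptic s lam Lam K) {r : ℝ} (hr : 0 < r) :
    ∃ C : ℝ≥0∞, C < ⊤ ∧ ∀ x, K x (ball x r)ᶜ ≤ C := by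
  obtain ⟨c, -, hc⟩ := exists_measure_compl_ball_le (β := 2 * s) (by linarith)
  refine ⟨ENNReal.ofReal (c * Lam * r ^ (-(2 * s))), ENNReal.ofReal_lt_top, fun x => ?_⟩
  rw [← centred_compl_ball K x hr]
  exact hc _ Lam r hLam hr (annBd_centred hK x)

lemma sFinite_centred {s lam Lam : ℝ} (hs : 0 < s) (hLam : 0 ≤ Lam)
    {K : Euc n → Measure (Euc n)} (hKm : MeasKernel K) (hK : DivElliptic s lam Lam K) (x : Euc n) :
    SFinite (centred K x) := by
  obtain ⟨κ, _, hκ⟩ := exists_offDiag_kernel hKm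
    fun r hr => exists_measure_compl_ball_le_of_divElliptic hs hLam hK hr
  rw [centred_eq_map, ← hκ x]
  infer_instance

lemma sFinite_evenCentred {s lam Lam : ℝ} (hs : 0 < s) (hLam : 0 ≤ Lam)
    {K : Euc n → Measure (Euc n)} (hKm : MeasKernel K) (hK : DivElliptic s lam Lam K) (x : Euc n) :
    SFinite (evenCentred K x) := by
  have := sFinite_centred hs hLam hKm hK x
  unfold evenCentred
  infer_instance

/-- Freezing the kernel at `x₀` changes the bilinear form of a function supported near `x₀` by a
controlled amount. -/
lemma exists_freezing_error {s α lam Lam M : ℝ} (hs : s ∈ Ioo (1 / 2 : ℝ) 1) (hα : 0 < α)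
    (hα2 : 1 + α < 2 * s) (hM : 0 < M) (hLam : 0 < Lam) :
    ∃ c > 0, ∀ {n : ℕ} (K : Euc n → Measure (Euc n)), MeasKernel K → DivSymmetric K →
      DivElliptic s lam Lam K → XReg s α M K → AlmostEven s α M K →
      ∀ (x₀ : Euc n) (ρ r b : ℝ) (G : Euc n × Euc n → ℝ), 0 < r → 0 ≤ b → Measurable G →
        (∀ x z, G (x, z) = G (z, x)) →
        (∀ x ∉ ball x₀ ρ, ∀ z ∉ ball x₀ ρ, G (x, z) = 0) →
        (∀ x z, |G (x, z)| ≤ b * min ((‖z - x‖ / r) ^ (2 : ℝ)) ((‖z - x‖ / r) ^ (1 : ℝ))) →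
        |2 * (∫ x, ∫ z, G (x, z) ∂(K x)) - ∫ x, ∫ y, G (x, x + y) ∂(evenCentred K x₀)| ≤
          c * b * (ρ ^ α * r ^ (-(2 * s)) + r ^ (-(2 * s - α))) * volume.real (ball x₀ ρ) := by
  classical
  obtain ⟨hs1, hs2⟩ := hs
  have hβ1 : (1 : ℝ) < 2 * s := by linarith
  have hβ2 : 2 * s < 2 := by linarith
  obtain ⟨c₁, hc₁, hreg'⟩ := exists_abs_integral_sub_le (p := 2) (q := 1) (β := 2 * s)
    zero_le_one hβ1 hβ2
  obtain ⟨c₂, hc₂, heven'⟩ := exists_abs_integral_sub_le (p := 2) (q := 1) (β := 2 * s - α)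
    zero_le_one (by linarith) (by linarith)
  obtain ⟨c₃, hc₃, hint'⟩ := exists_integral_min_rpow_le (p := 2) (q := 1) (β := 2 * s)
    zero_le_one hβ1 hβ2
  refine ⟨4 * c₁ * M + 2 * c₂ * M, by positivity, ?_⟩
  intro n K hKm hKs hK hreg heven x₀ ρ r b G hr hb hG hGs hG0 hGb
  have hfin : ∀ r : ℝ, 0 < r → ∃ C : ℝ≥0∞, C < ⊤ ∧ ∀ x, K x (ball x r)ᶜ ≤ C := fun r hr =>
    exists_measure_compl_ball_le_of_divElliptic (by linarith) hLam.le hK hr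
  obtain ⟨κ, _, hκ⟩ := exists_offDiag_kernel hKm hfin
  have hκc : ∀ x, Measure.map (fun z => z - x) (κ x) = centred K x := fun x => by
    rw [hκ, centred_eq_map]
  have hswap := map_swap_compProd (κ := κ)
    (fun A B hA hB hAB => by
      have h : ∀ S T : Set (Euc n), MeasurableSet S → MeasurableSet T → Disjoint S T →
          ∫⁻ x in S, κ x T = ∫⁻ x in S, K x T := fun S T hS hT hST =>
        setLIntegral_congr_fun hS fun x hx => by
          simp only [hκ]
          rw [Measure.restrict_apply hT, inter_eq_left.2]
          rintro z hz rfl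
          exact disjoint_left.1 hST hx hz
      rw [h A B hA hB hAB, h B A hB hA hAB.symm, hKs A B hA hB hAB])
    (fun x => by rw [hκ, Measure.restrict_apply (measurableSet_singleton x)]; simp)
    (fun r hr => by
      obtain ⟨C, hC, h⟩ := hfin r hr
      exact ⟨C, hC, fun x => by rw [hκ]; exact (Measure.restrict_apply_le _ _).trans (h x)⟩)
  obtain ⟨-, hI₁, hJ₁⟩ := integral_symm_eq_setIntegral zero_le_one hβ1 hβ2 hswap hLam.le
    (fun x => by rw [hκc]; exact annBd_centred hK x) measurableSet_ball measure_ball_lt_top.ne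
    hG hGs hG0 hb hr hGb
  have := sFinite_centred (by linarith) hLam.le hKm hK x₀
  have := sFinite_evenCentred (by linarith) hLam.le hKm hK x₀
  have hν := annBd_evenCentred hLam.le hK x₀
  obtain ⟨-, hI₂, hJ₂⟩ := integral_symm_eq_setIntegral zero_le_one hβ1 hβ2
    (map_swap_compProd_translationKernel (by linarith) (by linarith) (map_neg_evenCentred K x₀)
      (evenCentred_singleton_zero K x₀) hν) (by linarith : (0 : ℝ) ≤ 2 * Lam)
    (fun x => by rwa [map_sub_translationKernel]) measurableSet_ball measure_ball_lt_top.ne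
    hG hGs hG0 hb hr hGb
  have hG0' : ∀ x, G (x, x) = 0 := fun x => by
    have := hGb x x
    rw [sub_self, norm_zero, zero_div, Real.zero_rpow two_ne_zero, Real.zero_rpow one_ne_zero,
      min_self, mul_zero] at this
    exact abs_nonpos_iff.1 this
  have hL : ∫ x, ∫ z, G (x, z) ∂(K x) = ∫ x, ∫ z, G (x, z) ∂(κ x) := by
    congr 1
    ext x
    rw [hκ]
    refine (setIntegral_eq_integral_of_forall_compl_eq_zero fun z hz => ?_).symm
    rw [mem_compl_iff, not_not, mem_singleton_iff] at hz
    rw [hz, hG0']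
  have hR : ∫ x, ∫ y, G (x, x + y) ∂(evenCentred K x₀) =
      ∫ x, ∫ z, G (x, z) ∂(translationKernel (evenCentred K x₀) x) := by
    congr 1
    ext x
    rw [integral_translationKernel]
  let H : Euc n → Euc n → ℝ := fun x y => (if x + y ∈ ball x₀ ρ then 1 else 2) * G (x, x + y)
  have hHm : ∀ x, Measurable (H x) := fun x =>
    (Measurable.ite (measurableSet_ball.preimage (by fun_prop)) measurable_const
      measurable_const).mul (hG.comp (by fun_prop))
  have hHb : ∀ x y, |H x y| ≤ 2 * b * min ((‖y‖ / r) ^ (2 : ℝ)) ((‖y‖ / r) ^ (1 : ℝ)) := by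
    intro x y
    have h := hGb x (x + y)
    rw [add_sub_cancel_left] at h
    have h2 : |(if x + y ∈ ball x₀ ρ then (1 : ℝ) else 2)| ≤ 2 := by split_ifs <;> norm_num
    simp only [H, abs_mul, mul_assoc]
    exact mul_le_mul h2 h (abs_nonneg _) zero_le_two
  have hHi : ∀ (ν : Measure (Euc n)) x, AnnBd (2 * s) Lam ν → Integrable (H x) ν :=
    fun ν x hν => ((hint' ν Lam r hLam.le hr hν).1.const_mul (2 * b)).mono'
      (hHm x).aestronglyMeasurable (ae_of_all _ (hHb x))
  have hann := annBd_centred hK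
  have hannf : ∀ {ν : Measure (Euc n)}, AnnBd (2 * s) Lam ν → ∀ t : ℝ, 0 < t →
      ν (ball 0 (2 * t) \ ball 0 t) ≠ ⊤ := fun h t ht => ne_top_of_le_ne_top (by simp) (h t ht)
  have hκH : ∀ x, ∫ z, (if z ∈ ball x₀ ρ then 1 else 2) * G (x, z) ∂(κ x) =
      ∫ y, H x y ∂(centred K x) := fun x => by
    rw [← hκc, integral_map (by fun_prop) (hHm x).aestronglyMeasurable]
    simp [H]
  have hτH : ∀ x, ∫ z, (if z ∈ ball x₀ ρ then 1 else 2) * G (x, z)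
      ∂(translationKernel (evenCentred K x₀) x) =
      ∫ y, H x y ∂(centred K x₀) + ∫ y, H x y ∂(Measure.map (fun y => -y) (centred K x₀)) :=
    fun x => by
    rw [integral_translationKernel, evenCentred, integral_add_measure (hHi _ x (hann x₀))
      (hHi _ x (annBd_map_neg (hann x₀)))]
  rw [hL, hR, hI₁, hI₂, ← integral_const_mul, ← integral_sub (hJ₁.const_mul 2) hJ₂]
  rw [← Real.norm_eq_abs]
  refine norm_setIntegral_le_of_norm_le_const measure_ball_lt_top fun x hx => ?_
  rw [hκH, hτH, Real.norm_eq_abs]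
  have hxρ : ‖x - x₀‖ ≤ ρ := by
    rw [← dist_eq_norm]
    exact (mem_ball.1 hx).le
  have e1 := hreg' _ _ (H x) (M * ‖x - x₀‖ ^ α) r (2 * b) (by positivity) hr (by positivity)
    (centred_singleton_zero K x) (centred_singleton_zero K x₀) (hannf (hann x)) (hannf (hann x₀))
    (fun t ht => tvDiff_centred_le hK hreg x₀ x ht) (hHi _ x (hann x)) (hHi _ x (hann x₀)) (hHb x)
  have e2 := heven' _ _ (H x) M r (2 * b) hM.le hr (by positivity)
    (centred_singleton_zero K x₀) (map_neg_centred_singleton_zero K x₀) (hannf (hann x₀))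
    (hannf (annBd_map_neg (hann x₀)))
    (fun t ht => by rw [neg_sub]; exact tvDiff_centred_neg_le heven x₀ ht)
    (hHi _ x (hann x₀)) (hHi _ x (annBd_map_neg (hann x₀))) (hHb x)
  have e3 : ‖x - x₀‖ ^ α ≤ ρ ^ α := Real.rpow_le_rpow (norm_nonneg _) hxρ hα.le
  have e1' : c₁ * (2 * b) * (M * ‖x - x₀‖ ^ α) * r ^ (-(2 * s)) ≤
      c₁ * (2 * b) * (M * ρ ^ α) * r ^ (-(2 * s)) := by gcongr
  have hρ0 : 0 ≤ ρ := (norm_nonneg _).trans hxρ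
  have p1 : 0 ≤ c₁ * M * b * r ^ (-(2 * s - α)) := by positivity
  have p2 : 0 ≤ c₂ * M * b * (ρ ^ α * r ^ (-(2 * s))) := by positivity
  rw [abs_le] at *
  constructor <;> linarith [e1.1, e1.2, e2.1, e2.2]

lemma abs_integral_mul_le_of_eLpNorm_le {f η : Euc n → ℝ} {q F C x₀ ρ} {Ω : Set (Euc n)}
    (hq : 1 ≤ q) (hF : 0 ≤ F) (hC : 0 ≤ C) (hΩ : ball x₀ ρ ⊆ Ω)
    (hη0 : ∀ x ∉ ball x₀ ρ, η x = 0) (hη : ∀ x, |η x| ≤ C)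
    (hf : eLpNorm f (ENNReal.ofReal q) (volume.restrict Ω) ≤ ENNReal.ofReal F) :
    |∫ x, f x * η x| ≤ C * F * volume.real (ball x₀ ρ) ^ (1 - 1 / q) := by
  by_cases hi : Integrable fun x => f x * η x
  swap
  · rw [integral_undef hi, abs_zero]
    positivity
  have h0 : ∫ x, f x * η x = ∫ x in ball x₀ ρ, f x * η x :=
    (setIntegral_eq_integral_of_forall_compl_eq_zero fun x hx => by rw [hη0 x hx, mul_zero]).symm
  have h1 : eLpNorm (fun x => f x * η x) 1 (volume.restrict (ball x₀ ρ)) ≤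
      ENNReal.ofReal (C * F * volume.real (ball x₀ ρ) ^ (1 - 1 / q)) := by
    refine (eLpNorm_le_eLpNorm_mul_rpow_measure_univ (q := ENNReal.ofReal q) (by simpa)
      hi.aestronglyMeasurable.restrict).trans ?_
    rw [ENNReal.ofReal_mul (by positivity), Measure.restrict_apply_univ, ENNReal.toReal_one,
      ENNReal.toReal_ofReal (by linarith), div_one]
    have hq' : 0 ≤ 1 - 1 / q := by
      rw [sub_nonneg, div_le_one (by linarith)]
      exact hq
    refine mul_le_mul' ?_ ?_
    · rw [ENNReal.ofReal_mul hC]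
      refine (eLpNorm_le_mul_eLpNorm_of_ae_le_mul (g := f) (c := C) (ae_of_all _ fun x => ?_)
        _).trans (mul_le_mul_right ((eLpNorm_mono_measure f
          (Measure.restrict_mono hΩ le_rfl)).trans hf) _)
      rw [norm_mul, mul_comm]
      exact mul_le_mul_of_nonneg_right (hη x) (norm_nonneg _)
    · rw [← ENNReal.ofReal_rpow_of_nonneg measureReal_nonneg hq', measureReal_def,
        ENNReal.ofReal_toReal measure_ball_lt_top.ne]
  rw [h0, ← Real.norm_eq_abs, ← ENNReal.ofReal_le_ofReal_iff (by positivity), ofReal_norm]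
  exact (enorm_integral_le_lintegral_enorm _).trans (eLpNorm_one_eq_lintegral_enorm.symm.trans_le h1)

/-- The average of `h` over the scale `κ` with weight `φ`. -/
def scaledAvg (κ : ℝ) (φ h : Euc n → ℝ) (x : Euc n) : ℝ := ∫ t, h (x - κ • t) * φ t

lemma integral_comp_sub_smul {κ : ℝ} (hκ : 0 < κ) (F : Euc n → ℝ) (x : Euc n) :
    ∫ x', F x' = κ ^ n * ∫ t, F (x - κ • t) := by
  rw [Measure.integral_comp_smul_of_nonneg volume (fun y => F (x - y)) κ (hR := hκ.le),
    integral_sub_left_eq_self F volume x]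
  simp
  field_simp

lemma integrable_comp_sub_smul_mul {h φ : Euc n → ℝ} (hh : Continuous h) (hφ : Continuous φ)
    (hφc : HasCompactSupport φ) (κ : ℝ) (x : Euc n) :
    Integrable fun t => h (x - κ • t) * φ t :=
  Continuous.integrable_of_hasCompactSupport (by fun_prop) hφc.mul_left

lemma secDiff_scaledAvg {h φ : Euc n → ℝ} (hh : Continuous h) (hφ : Continuous φ)
    (hφc : HasCompactSupport φ) (κ : ℝ) (x y : Euc n) :
    secDiff (scaledAvg κ φ h) x y = ∫ t, secDiff h (x - κ • t) y * φ t := by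
  have i := integrable_comp_sub_smul_mul hh hφ hφc κ
  simp only [secDiff, scaledAvg]
  rw [← integral_const_mul, ← integral_add (i _) (i _),
    ← integral_sub (by exact (i _).add (i _)) ((i _).const_mul 2)]
  congr 1
  ext t
  rw [add_sub_right_comm x y, sub_right_comm x y]
  ring

lemma min_mul_le_min_rpow {C d κ : ℝ} (hC : 0 ≤ C) (hd : 0 ≤ d) (hκ : 0 < κ) {a : ℝ}
    (h1 : a ≤ C * (d / κ)) (h2 : a ≤ 2 * C) :
    d * a ≤ 2 * C * κ * min ((d / κ) ^ (2 : ℝ)) ((d / κ) ^ (1 : ℝ)) := by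
  obtain ⟨t, ht, rfl⟩ : ∃ t, 0 ≤ t ∧ d = κ * t := ⟨d / κ, by positivity, by field_simp⟩
  rw [mul_div_cancel_left₀ _ hκ.ne'] at *
  rw [Real.rpow_one, Real.rpow_two]
  rcases le_total (t ^ 2) t with h | h
  · rw [min_eq_left h]
    have := mul_le_mul_of_nonneg_left h1 hd
    have : 0 ≤ C * κ * t ^ 2 := by positivity
    nlinarith
  · rw [min_eq_right h]
    have := mul_le_mul_of_nonneg_left h2 hd
    nlinarith

/-- A weak solution, averaged at scale `κ` near `x₀`, almost solves the equation with kernel frozen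
at `x₀`. -/
lemma exists_frozen_estimate (hn : 0 < n) {s α lam Lam M C₀ R : ℝ} (hs : s ∈ Ioo (1 / 2 : ℝ) 1)
    (hα : 0 < α) (hα2 : 1 + α < 2 * s) (hM : 0 < M) (hLam : 0 < Lam) (hC₀ : 0 < C₀) (hR : 0 ≤ R) :
    ∃ C > 0, ∀ K : Euc n → Measure (Euc n), MeasKernel K → DivSymmetric K →
      DivElliptic s lam Lam K → XReg s α M K → AlmostEven s α M K →
      ∀ (u f : Euc n → ℝ) (A F : ℝ), 0 ≤ A → 0 ≤ F → HasCompactSupport u → Continuous u →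
      (∀ x y, |u x - u y| ≤ A * ‖x - y‖) → WeakSol K u f (ball 0 1) →
      eLpNorm f (ENNReal.ofReal ((n : ℝ) / (2 * s - 1 - α))) (volume.restrict (ball 0 1)) ≤
        ENNReal.ofReal F →
      ∀ φ : Euc n → ℝ, ContDiff ℝ (⊤ : ℕ∞) φ → tsupport φ ⊆ closedBall 0 1 →
      (∀ x, |φ x| ≤ C₀) → (∀ x y, |φ x - φ y| ≤ C₀ * ‖x - y‖) →
      ∀ (x₀ x₁ : Euc n) (κ : ℝ), 0 < κ → x₀ ∈ ball (0 : Euc n) (1 / 2) → (R + 2) * κ ≤ 1 / 2 →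
      ‖x₁ - x₀‖ ≤ R * κ →
      |∫ y, secDiff (scaledAvg κ φ u) x₁ y ∂(evenCentred K x₀)| ≤
        C * κ ^ (1 + α - 2 * s) * (A + F) := by
  obtain ⟨c, hc, hfreeze⟩ := exists_freezing_error (lam := lam) hs hα hα2 hM hLam
  obtain ⟨hs1, hs2⟩ := hs
  set V : ℝ := (R + 2) ^ n * volume.real (ball (0 : Euc n) 1) with hV
  have hV0 : 0 ≤ V := by positivity
  set q : ℝ := (n : ℝ) / (2 * s - 1 - α) with hq
  have hn1 : (1 : ℝ) ≤ n := by exact_mod_cast hn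
  have hq1 : 1 ≤ q := by
    rw [hq, le_div_iff₀ (by linarith)]
    linarith
  refine ⟨c * (2 * C₀) * ((R + 2) ^ α + 1) * V + 4 * (C₀ * V ^ (1 - 1 / q)) + 1, by positivity, ?_⟩
  intro K hKm hKs hK hreg heven u f A F hA hF huc hu huL hsol hf φ hφ hφs hφC hφL x₀ x₁ κ hκ hx₀ hRκ
    hx₁
  have hφc : HasCompactSupport φ := (isCompact_closedBall 0 1).of_isClosed_subset
    (isClosed_tsupport φ) hφs
  let ρ := (R + 2) * κ
  have hρ : 0 < ρ := by positivity
  let η : Euc n → ℝ := fun x => φ (κ⁻¹ • (x₁ - x))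
  have hη0 : ∀ x ∉ closedBall x₁ κ, η x = 0 := by
    intro x hx
    refine image_eq_zero_of_notMem_tsupport (f := φ) fun h => hx ?_
    have h := hφs h
    rw [mem_closedBall_zero_iff, norm_smul, norm_inv, Real.norm_of_nonneg hκ.le,
      inv_mul_le_iff₀ hκ, mul_one] at h
    rwa [mem_closedBall', dist_eq_norm]
  have hcb : closedBall x₁ κ ⊆ ball x₀ ρ := by
    intro x hx
    rw [mem_closedBall, dist_eq_norm] at hx
    rw [mem_ball, dist_eq_norm]
    have := norm_add_le (x - x₁) (x₁ - x₀)
    rw [sub_add_sub_cancel] at this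
    have : (R + 2) * κ = R * κ + κ + κ := by ring
    simp only [ρ]
    linarith
  have hb1 : ball x₀ ρ ⊆ ball (0 : Euc n) 1 := by
    refine ball_subset_ball' ?_
    rw [mem_ball] at hx₀
    simp only [ρ]
    linarith
  have hηs : tsupport η ⊆ closedBall x₁ κ :=
    closure_minimal (fun x hx => by_contra fun h => hx (hη0 x h)) isClosed_closedBall
  have hηc : HasCompactSupport η := (isCompact_closedBall x₁ κ).of_isClosed_subset
    (isClosed_tsupport η) hηs
  have hηd : ContDiff ℝ (⊤ : ℕ∞) η := by
    apply hφ.comp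
    fun_prop
  have hη0' : ∀ x ∉ ball x₀ ρ, η x = 0 := fun x hx => hη0 x fun h => hx (hcb h)
  let G : Euc n × Euc n → ℝ := fun p => (u p.1 - u p.2) * (η p.1 - η p.2)
  have hηcont := hηd.continuous
  have hGm : Measurable G := by
    apply Continuous.measurable
    fun_prop
  have hGb : ∀ x z, |G (x, z)| ≤
      2 * C₀ * A * κ * min ((‖z - x‖ / κ) ^ (2 : ℝ)) ((‖z - x‖ / κ) ^ (1 : ℝ)) := by
    intro x z
    have h1 : |η x - η z| ≤ C₀ * (‖z - x‖ / κ) := by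
      refine (hφL _ _).trans_eq ?_
      rw [← smul_sub, norm_smul, norm_inv, Real.norm_of_nonneg hκ.le, sub_sub_sub_cancel_left]
      ring
    have h2 : |η x - η z| ≤ 2 * C₀ := by
      refine (abs_sub _ _).trans ?_
      linarith [hφC (κ⁻¹ • (x₁ - x)), hφC (κ⁻¹ • (x₁ - z))]
    have h3 := min_mul_le_min_rpow hC₀.le (norm_nonneg (z - x)) hκ h1 h2
    have h4 := huL x z
    rw [norm_sub_rev] at h4
    calc |G (x, z)| = |u x - u z| * |η x - η z| := abs_mul _ _
      _ ≤ A * ‖z - x‖ * |η x - η z| := mul_le_mul_of_nonneg_right h4 (abs_nonneg _)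
      _ = A * (‖z - x‖ * |η x - η z|) := by ring
      _ ≤ A * _ := mul_le_mul_of_nonneg_left h3 hA
      _ = _ := by ring
  have hvol : volume.real (ball x₀ ρ) = κ ^ n * V := by
    rw [measureReal_def, Measure.addHaar_ball_of_pos _ _ hρ, ENNReal.toReal_mul,
      ENNReal.toReal_ofReal (by positivity), finrank_euclideanSpace_fin, hV, measureReal_def,
      mul_pow]
    ring
  have hfr := hfreeze K hKm hKs hK hreg heven x₀ ρ κ (2 * C₀ * A * κ) G hκ (by positivity) hGm
    (fun x z => by simp only [G]; ring)
    (fun x hx z hz => by simp only [G]; rw [hη0' x hx, hη0' z hz]; simp) hGb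
  have heq := hsol.2.2 η hηd hηc ((hηs.trans hcb).trans hb1)
  have := sFinite_evenCentred (by linarith) hLam.le hKm hK x₀
  have hdir := integral_dirichlet_eq (p := 2) (q := 1) (β := 2 * s) zero_le_one (by linarith)
    (by linarith) (by linarith : 0 ≤ 2 * Lam) (map_neg_evenCentred K x₀)
    (evenCentred_singleton_zero K x₀) (annBd_evenCentred hLam.le hK x₀) hu huc hηcont hηc
    (by positivity) hκ hGb
  have havg : ∫ y, ∫ x, η x * secDiff u x y ∂volume ∂(evenCentred K x₀) =
      κ ^ n * ∫ y, secDiff (scaledAvg κ φ u) x₁ y ∂(evenCentred K x₀) := by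
    rw [← integral_const_mul]
    congr 1
    ext y
    rw [integral_comp_sub_smul hκ _ x₁, secDiff_scaledAvg hu hφ.continuous hφc]
    congr 2
    ext t
    simp only [η]
    rw [sub_sub_cancel, inv_smul_smul₀ hκ.ne', mul_comm]
  have hrhs := abs_integral_mul_le_of_eLpNorm_le hq1 hF hC₀.le hb1 hη0' (fun x => hφC _) hf
  rw [hvol] at hfr hrhs
  change ∫ x, ∫ y, G (x, x + y) ∂(evenCentred K x₀) = _ at hdir
  change 1 / 2 * (∫ x, ∫ z, G (x, z) ∂(K x)) = _ at heq
  rw [hdir, havg] at hfr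
  set X := ∫ y, secDiff (scaledAvg κ φ u) x₁ y ∂(evenCentred K x₀)
  set Y := ∫ x, f x * η x
  have hκn : 0 < κ ^ n := by positivity
  set e := κ ^ (1 + α - 2 * s) with he
  have he0 : 0 < e := by positivity
  have hp1 : κ * (ρ ^ α * κ ^ (-(2 * s)) + κ ^ (-(2 * s - α))) = ((R + 2) ^ α + 1) * e := by
    have a1 : κ ^ (1 + α - 2 * s) = κ * κ ^ α * κ ^ (-(2 * s)) := by
      rw [show 1 + α - 2 * s = 1 + α + -(2 * s) by ring, Real.rpow_add hκ, Real.rpow_add hκ,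
        Real.rpow_one]
    have a2 : κ ^ (-(2 * s - α)) = κ ^ α * κ ^ (-(2 * s)) := by
      rw [← Real.rpow_add hκ]
      congr 1
      ring
    rw [he, a1, a2, Real.mul_rpow (by positivity) hκ.le]
    ring
  have hp2 : (κ ^ n * V) ^ (1 - 1 / q) = κ ^ n * e * V ^ (1 - 1 / q) := by
    rw [Real.mul_rpow hκn.le hV0, he, ← Real.rpow_natCast, ← Real.rpow_mul hκ.le,
      ← Real.rpow_add hκ]
    congr 2
    rw [hq]
    field_simp
    ring
  rw [hp2] at hrhs
  have h1 : κ ^ n * |X| ≤ c * (2 * C₀ * A) * (((R + 2) ^ α + 1) * e) * (κ ^ n * V) +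
      4 * (C₀ * F * (κ ^ n * e * V ^ (1 - 1 / q))) := by
    have h3 : κ ^ n * |X| = |κ ^ n * X| := by rw [abs_mul, abs_of_pos hκn]
    rw [h3, ← hp1]
    have h4 : c * (2 * C₀ * A * κ) * (ρ ^ α * κ ^ (-(2 * s)) + κ ^ (-(2 * s - α))) * (κ ^ n * V) =
      c * (2 * C₀ * A) * (κ * (ρ ^ α * κ ^ (-(2 * s)) + κ ^ (-(2 * s - α)))) * (κ ^ n * V) := by
      ring
    rw [h4] at hfr
    rw [abs_le] at *
    constructor <;> linarith [hfr.1, hfr.2, hrhs.1, hrhs.2]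
  refine le_of_mul_le_mul_left (h1.trans ?_) hκn
  have hW : 0 ≤ V ^ (1 - 1 / q) := by positivity
  have z1 : 0 ≤ c * (2 * C₀) * ((R + 2) ^ α + 1) * V * κ ^ n * e * F := by positivity
  have z2 : 0 ≤ 4 * (C₀ * V ^ (1 - 1 / q)) * κ ^ n * e * A := by positivity
  have z3 : 0 ≤ κ ^ n * e * (A + F) := by positivity
  linarith

/-- A test function supported in the unit ball that is bounded by `B` together with its first two
derivatives. -/
structure SmoothBd (B : ℝ) (χ : Euc n → ℝ) : Prop where
  contDiff : ContDiff ℝ (⊤ : ℕ∞) χ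
  tsupport_subset : tsupport χ ⊆ closedBall 0 1
  abs_le : ∀ t, |χ t| ≤ B
  norm_fderiv_le : ∀ t, ‖fderiv ℝ χ t‖ ≤ B
  norm_fderiv_sub_le : ∀ t t', ‖fderiv ℝ χ t - fderiv ℝ χ t'‖ ≤ B * ‖t - t'‖

namespace SmoothBd

variable {B : ℝ} {χ : Euc n → ℝ}

lemma hasCompactSupport (h : SmoothBd B χ) : HasCompactSupport χ :=
  (isCompact_closedBall 0 1).of_isClosed_subset (isClosed_tsupport χ) h.tsupport_subset

lemma differentiable (h : SmoothBd B χ) : Differentiable ℝ χ := h.contDiff.differentiable (by simp)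

lemma contDiff_fderiv_apply (h : SmoothBd B χ) (y : Euc n) :
    ContDiff ℝ (⊤ : ℕ∞) fun t => fderiv ℝ χ t y :=
  (h.contDiff.fderiv_right (m := (⊤ : ℕ∞)) (by simp)).clm_apply contDiff_const

lemma tsupport_fderiv_apply_subset (h : SmoothBd B χ) (y : Euc n) :
    tsupport (fun t => fderiv ℝ χ t y) ⊆ closedBall 0 1 := by
  refine subset_trans ?_ ((tsupport_fderiv_subset ℝ).trans h.tsupport_subset)
  exact tsupport_comp_subset (g := fun L : Euc n →L[ℝ] ℝ => L y) (by simp) (fderiv ℝ χ)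

lemma hasCompactSupport_fderiv_apply (h : SmoothBd B χ) (y : Euc n) :
    HasCompactSupport fun t => fderiv ℝ χ t y :=
  (isCompact_closedBall 0 1).of_isClosed_subset (isClosed_tsupport _)
    (h.tsupport_fderiv_apply_subset y)

lemma abs_sub_le (h : SmoothBd B χ) (x y : Euc n) : |χ x - χ y| ≤ B * ‖x - y‖ :=
  convex_univ.norm_image_sub_le_of_norm_fderiv_le (fun x _ => h.differentiable x)
    (fun x _ => h.norm_fderiv_le x) (mem_univ _) (mem_univ _)

lemma abs_taylor_le (h : SmoothBd B χ) (t y : Euc n) :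
    |χ (t + y) - χ t - fderiv ℝ χ t y| ≤ B * ‖y‖ ^ 2 := by
  have hB : 0 ≤ B := (abs_nonneg _).trans (h.abs_le 0)
  have := (convex_closedBall t ‖y‖).norm_image_sub_le_of_norm_fderiv_le' (f := χ)
    (C := B * ‖y‖) (x := t) (y := t + y) (φ := fderiv ℝ χ t) (fun x _ => h.differentiable x)
    (fun x hx => (h.norm_fderiv_sub_le x t).trans (mul_le_mul_of_nonneg_left
      (by rwa [← dist_eq_norm]) hB)) (mem_closedBall_self (norm_nonneg _)) (by simp)
  rw [add_sub_cancel_left] at this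
  rw [← Real.norm_eq_abs]
  linarith

lemma integral_fderiv_apply (h : SmoothBd B χ) (y : Euc n) : ∫ t, fderiv ℝ χ t y = 0 := by
  have h1 : Integrable (fun t => 1 * fderiv ℝ χ t y) := by
    simpa only [one_mul] using (h.contDiff_fderiv_apply y).continuous.integrable_of_hasCompactSupport
      (h.hasCompactSupport_fderiv_apply y)
  have h2 : Integrable (fun t => 1 * χ t) := by
    simpa only [one_mul] using
      h.contDiff.continuous.integrable_of_hasCompactSupport h.hasCompactSupport
  have := integral_mul_fderiv_eq_neg_fderiv_mul_of_integrable (μ := (volume : Measure (Euc n)))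
    (f := fun _ : Euc n => (1 : ℝ)) (g := χ) (v := y) (by simp) h1 h2 (by simp)
    (fun x _ => h.differentiable x)
  simpa using this

end SmoothBd

lemma fderiv_continuousLinearMap_comp {F : Type*} [NormedAddCommGroup F] [NormedSpace ℝ F]
    {Φ : Euc n → F} {L : F →L[ℝ] ℝ} {t : Euc n} (hΦ : DifferentiableAt ℝ Φ t) :
    fderiv ℝ (fun t => L (Φ t)) t = L.comp (fderiv ℝ Φ t) :=
  (L.hasFDerivAt.comp t hΦ.hasFDerivAt).fderiv

lemma exists_bound_lipschitz {F : Type*} [NormedAddCommGroup F] [NormedSpace ℝ F] {Φ : Euc n → F}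
    (hΦ : ContDiff ℝ (⊤ : ℕ∞) Φ) (hc : HasCompactSupport Φ) :
    ∃ B : ℝ, (∀ t, ‖Φ t‖ ≤ B) ∧ ∀ t t', ‖Φ t - Φ t'‖ ≤ B * ‖t - t'‖ := by
  have hΦ1 : ContDiff ℝ (⊤ : ℕ∞) (fderiv ℝ Φ) := hΦ.fderiv_right (by simp)
  obtain ⟨B₀, h0⟩ := hΦ.continuous.bounded_above_of_compact_support hc
  obtain ⟨B₁, h1⟩ := hΦ1.continuous.bounded_above_of_compact_support (hc.fderiv ℝ)
  refine ⟨max B₀ B₁, fun t => (h0 t).trans (le_max_left _ _), fun t t' => ?_⟩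
  exact convex_univ.norm_image_sub_le_of_norm_fderiv_le
    (fun x _ => hΦ.differentiable (by simp) x) (fun x _ => (h1 x).trans (le_max_right _ _))
    (mem_univ _) (mem_univ _)

lemma exists_bounds_fderiv {F : Type*} [NormedAddCommGroup F] [NormedSpace ℝ F] {Φ : Euc n → F}
    (hΦ : ContDiff ℝ (⊤ : ℕ∞) Φ) (hc : HasCompactSupport Φ) :
    ∃ B : ℝ, (∀ t, ‖Φ t‖ ≤ B) ∧ (∀ t, ‖fderiv ℝ Φ t‖ ≤ B) ∧
      ∀ t t', ‖fderiv ℝ Φ t - fderiv ℝ Φ t'‖ ≤ B * ‖t - t'‖ := by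
  obtain ⟨B₀, h0⟩ := hΦ.continuous.bounded_above_of_compact_support hc
  obtain ⟨B₁, h1, h2⟩ := exists_bound_lipschitz (F := Euc n →L[ℝ] F) (Φ := fderiv ℝ Φ)
    (hΦ.fderiv_right (by simp)) (hc.fderiv ℝ)
  exact ⟨max B₀ B₁, fun t => (h0 t).trans (le_max_left _ _), fun t => (h1 t).trans
    (le_max_right _ _), fun t t' => (h2 t t').trans
      (mul_le_mul_of_nonneg_right (le_max_right _ _) (norm_nonneg _))⟩

lemma exists_smoothBd_comp {F : Type*} [NormedAddCommGroup F] [NormedSpace ℝ F] {Φ : Euc n → F}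
    (hΦ : ContDiff ℝ (⊤ : ℕ∞) Φ) (hs : tsupport Φ ⊆ closedBall 0 1) :
    ∃ B : ℝ, ∀ L : F →L[ℝ] ℝ, (∀ v, |L v| ≤ ‖v‖) → ∀ B' ≥ B, SmoothBd B' fun t => L (Φ t) := by
  have hc : HasCompactSupport Φ := (isCompact_closedBall 0 1).of_isClosed_subset
    (isClosed_tsupport Φ) hs
  obtain ⟨B, h0, h1, h2⟩ := exists_bounds_fderiv hΦ hc
  refine ⟨B, fun L hL B' hB => ?_⟩
  have hd : ∀ t, fderiv ℝ (fun t => L (Φ t)) t = L.comp (fderiv ℝ Φ t) := fun t =>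
    fderiv_continuousLinearMap_comp (hΦ.differentiable (by simp) t)
  have hLc : ∀ T : Euc n →L[ℝ] F, ‖L.comp T‖ ≤ ‖T‖ := fun T =>
    ContinuousLinearMap.opNorm_le_bound _ (norm_nonneg _) fun y => (hL _).trans (T.le_opNorm y)
  refine ⟨L.contDiff.comp hΦ, (tsupport_comp_subset (map_zero L) Φ).trans hs,
    fun t => (hL _).trans ((h0 t).trans hB), fun t => ?_, fun t t' => ?_⟩
  · rw [hd]
    exact (hLc _).trans ((h1 t).trans hB)
  · rw [hd, hd, ← ContinuousLinearMap.comp_sub]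
    exact (hLc _).trans ((h2 t t').trans (mul_le_mul_of_nonneg_right hB (norm_nonneg _)))

/-- A standard mollifier that is bounded by `B` together with its derivatives up to order four. -/
structure IsMollifier (B : ℝ) (ρ : Euc n → ℝ) : Prop where
  nonneg : ∀ t, 0 ≤ ρ t
  integral_eq_one : ∫ t, ρ t = 1
  smoothBd : SmoothBd B ρ
  smoothBd_fderiv : ∀ a : Euc n, ‖a‖ = 1 → SmoothBd B fun t => fderiv ℝ ρ t a
  smoothBd_fderiv_fderiv : ∀ a e : Euc n, ‖a‖ = 1 → ‖e‖ = 1 →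
    SmoothBd B fun t => fderiv ℝ (fun t' => fderiv ℝ ρ t' a) t e

lemma exists_isMollifier (n : ℕ) : ∃ B > 0, ∃ ρ : Euc n → ℝ, IsMollifier B ρ := by
  let b : ContDiffBump (0 : Euc n) := ⟨1 / 2, 1, by norm_num, by norm_num⟩
  have hρ : ContDiff ℝ (⊤ : ℕ∞) (b.normed volume) := b.contDiff_normed
  have hs : tsupport (b.normed volume) ⊆ closedBall 0 1 := b.tsupport_normed_eq.subset
  have hρ1 : ContDiff ℝ (⊤ : ℕ∞) (fderiv ℝ (b.normed volume)) := hρ.fderiv_right (by simp)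
  have hρ2 : ContDiff ℝ (⊤ : ℕ∞) (fderiv ℝ (fderiv ℝ (b.normed volume))) :=
    hρ1.fderiv_right (by simp)
  have hs1 := (tsupport_fderiv_subset ℝ).trans hs
  obtain ⟨B₀, h0⟩ := exists_smoothBd_comp hρ hs
  obtain ⟨B₁, h1⟩ := exists_smoothBd_comp hρ1 hs1
  obtain ⟨B₂, h2⟩ := exists_smoothBd_comp hρ2 ((tsupport_fderiv_subset ℝ).trans hs1)
  refine ⟨max 1 (max B₀ (max B₁ B₂)), lt_max_of_lt_left one_pos, b.normed volume, b.nonneg_normed,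
    b.integral_normed, h0 (ContinuousLinearMap.id ℝ ℝ) (fun v => le_rfl) _ ?_, fun a ha => ?_,
    fun a e ha he => ?_⟩
  · exact (le_max_left _ _).trans (le_max_right _ _)
  · refine h1 (ContinuousLinearMap.apply ℝ ℝ a) (fun v => ?_) _
      ((le_max_left _ _).trans ((le_max_right _ _).trans (le_max_right _ _)))
    simpa [ha] using v.le_opNorm a
  · have : (fun t => fderiv ℝ (fun t' => fderiv ℝ (b.normed volume) t' a) t e) =
        fun t => (ContinuousLinearMap.apply ℝ ℝ a).comp
          (ContinuousLinearMap.apply ℝ (Euc n →L[ℝ] ℝ) e)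
          (fderiv ℝ (fderiv ℝ (b.normed volume)) t) := by
      funext t
      rw [fderiv_clm_apply (hρ1.differentiable (by simp) t) (differentiableAt_const a)]
      simp
    rw [this]
    refine h2 _ (fun v => ?_) _
      ((le_max_right _ _).trans ((le_max_right _ _).trans (le_max_right _ _)))
    have e1 := (v e).le_opNorm a
    have e2 := v.le_opNorm e
    rw [ha, mul_one] at e1
    rw [he, mul_one] at e2
    exact e1.trans e2

lemma abs_integral_comp_sub_mul_le {h ψ : Euc n → ℝ} {α r m : ℝ} (hα : 0 ≤ α) (hr : 0 ≤ r)
    (hh : Continuous h) (hhα : ∀ x y, |h x - h y| ≤ ‖x - y‖ ^ α) (hψ : Continuous ψ)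
    (hψs : ∀ t ∉ closedBall (0 : Euc n) r, ψ t = 0) (hψ0 : ∫ t, ψ t = 0) (hm : ∀ t, |ψ t| ≤ m)
    (x : Euc n) :
    |∫ t, h (x - t) * ψ t| ≤ r ^ α * m * volume.real (closedBall (0 : Euc n) r) := by
  have hψc : HasCompactSupport ψ := HasCompactSupport.intro (isCompact_closedBall 0 r) hψs
  have e1 : ∫ t, h (x - t) * ψ t = ∫ t in closedBall 0 r, (h (x - t) - h x) * ψ t := by
    rw [setIntegral_eq_integral_of_forall_compl_eq_zero fun t ht => by rw [hψs t ht, mul_zero]]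
    simp_rw [sub_mul]
    rw [integral_sub, integral_const_mul, hψ0, mul_zero, sub_zero]
    · exact Continuous.integrable_of_hasCompactSupport (by fun_prop) hψc.mul_left
    · exact Continuous.integrable_of_hasCompactSupport (by fun_prop) hψc.mul_left
  rw [e1, ← Real.norm_eq_abs]
  refine norm_setIntegral_le_of_norm_le_const measure_closedBall_lt_top fun t ht => ?_
  rw [norm_mul]
  refine mul_le_mul ((hhα _ _).trans ?_) (hm t) (norm_nonneg _) (by positivity)
  rw [sub_sub_cancel_left, norm_neg]
  exact Real.rpow_le_rpow (norm_nonneg _) (by simpa using ht) hα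

lemma scaledAvg_one (φ h : Euc n → ℝ) (x : Euc n) : scaledAvg 1 φ h x = ∫ t, h (x - t) * φ t := by
  simp [scaledAvg]

namespace SmoothBd

variable {B α : ℝ} {χ h : Euc n → ℝ}

lemma integrable_comp_sub_mul (hχ : SmoothBd B χ) (hh : Continuous h) (x : Euc n) :
    Integrable fun t => h (x - t) * χ t :=
  Continuous.integrable_of_hasCompactSupport
    ((hh.comp (continuous_const.sub continuous_id)).mul hχ.contDiff.continuous)
    hχ.hasCompactSupport.mul_left

lemma integrable_comp_sub_mul_fderiv (hχ : SmoothBd B χ) (hh : Continuous h) (x y : Euc n) :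
    Integrable fun t => h (x - t) * fderiv ℝ χ t y :=
  Continuous.integrable_of_hasCompactSupport
    ((hh.comp (continuous_const.sub continuous_id)).mul (hχ.contDiff_fderiv_apply y).continuous)
    (hχ.hasCompactSupport_fderiv_apply y).mul_left

lemma abs_scaledAvg_one_sub_le (hχ : SmoothBd B χ) (hh : Continuous h)
    (hhα : ∀ x y, |h x - h y| ≤ ‖x - y‖ ^ α) (x y : Euc n) :
    |scaledAvg 1 χ h x - scaledAvg 1 χ h y| ≤ ‖x - y‖ ^ α * ∫ t, |χ t| := by
  rw [scaledAvg_one, scaledAvg_one, ← integral_sub (hχ.integrable_comp_sub_mul hh x)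
    (hχ.integrable_comp_sub_mul hh y), ← integral_const_mul]
  rw [← Real.norm_eq_abs]
  refine norm_integral_le_of_norm_le ((hχ.contDiff.continuous.integrable_of_hasCompactSupport
    hχ.hasCompactSupport).norm.const_mul _) (ae_of_all _ fun t => ?_)
  rw [← sub_mul, norm_mul]
  refine mul_le_mul_of_nonneg_right ((hhα _ _).trans_eq ?_) (norm_nonneg _)
  rw [sub_sub_sub_cancel_right]

lemma integral_abs_le (hχ : SmoothBd B χ) :
    ∫ t, |χ t| ≤ B * volume.real (closedBall (0 : Euc n) 1) := by
  rw [← setIntegral_eq_integral_of_forall_compl_eq_zero (s := closedBall (0 : Euc n) 1)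
    fun t ht => by
      rw [image_eq_zero_of_notMem_tsupport fun h' => ht (hχ.tsupport_subset h'), abs_zero]]
  refine (Real.le_norm_self _).trans (norm_setIntegral_le_of_norm_le_const
    measure_closedBall_lt_top fun t _ => ?_)
  rw [norm_abs_eq_norm]
  exact hχ.abs_le t

lemma scaledAvg_one_add (hχ : SmoothBd B χ) (hh : Continuous h) (x y : Euc n) :
    scaledAvg 1 χ h (x + y) - scaledAvg 1 χ h x - scaledAvg 1 (fun t => fderiv ℝ χ t y) h x =
      ∫ t, h (x - t) * (χ (t + y) - χ t - fderiv ℝ χ t y) := by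
  have e : scaledAvg 1 χ h (x + y) = ∫ t, h (x - t) * χ (t + y) := by
    rw [scaledAvg_one, ← integral_add_right_eq_self _ y]
    simp only [add_sub_add_right_eq_sub]
  have i : Integrable fun t => h (x - t) * χ (t + y) := by
    have := (hχ.integrable_comp_sub_mul hh (x + y)).comp_add_right y
    simpa only [add_sub_add_right_eq_sub] using this
  rw [e, scaledAvg_one, scaledAvg_one, ← integral_sub i (hχ.integrable_comp_sub_mul hh x),
    ← integral_sub (by exact i.sub (hχ.integrable_comp_sub_mul hh x))
      (hχ.integrable_comp_sub_mul_fderiv hh x y)]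
  simp only [mul_sub]

end SmoothBd

lemma exists_scaledAvg_bounds (n : ℕ) {α B : ℝ} (hα : 0 ≤ α) (hα1 : α ≤ 1) (hB : 0 ≤ B) :
    ∃ C > 0, ∀ χ : Euc n → ℝ, SmoothBd B χ → ∀ h : Euc n → ℝ, Continuous h →
      (∀ x y, |h x - h y| ≤ ‖x - y‖ ^ α) →
      (∫ t, χ t = 0 → ∀ x, |scaledAvg 1 χ h x| ≤ C) ∧
      ∀ x y, |scaledAvg 1 χ h (x + y) - scaledAvg 1 χ h x -
        scaledAvg 1 (fun t => fderiv ℝ χ t y) h x| ≤ C * ‖y‖ ^ 2 := by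
  set V₁ := volume.real (closedBall (0 : Euc n) 1)
  set V₂ := volume.real (closedBall (0 : Euc n) 2)
  have hV₁ : 0 ≤ V₁ := measureReal_nonneg
  have hV₂ : 0 ≤ V₂ := measureReal_nonneg
  have h2 : (0 : ℝ) ≤ 2 ^ α := by positivity
  have hBV : 0 ≤ B * V₁ := mul_nonneg hB hV₁
  have hBV2 : 0 ≤ 2 ^ α * B * V₂ := by positivity
  refine ⟨1 + 2 * (B * V₁) + 2 ^ α * B * V₂, by positivity, fun χ hχ h hh hhα =>
    ⟨fun h0 x => ?_, fun x y => ?_⟩⟩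
  · have := abs_integral_comp_sub_mul_le hα zero_le_one hh hhα hχ.contDiff.continuous
      (fun t ht => image_eq_zero_of_notMem_tsupport fun h' => ht (hχ.tsupport_subset h')) h0
      hχ.abs_le x
    rw [Real.one_rpow, one_mul] at this
    rw [scaledAvg_one]
    linarith
  · have hd := hχ.contDiff_fderiv_apply y
    have hds := hχ.hasCompactSupport_fderiv_apply y
    rcases le_total ‖y‖ 1 with hy | hy
    · rw [hχ.scaledAvg_one_add hh]
      have iχ := hχ.contDiff.continuous.integrable_of_hasCompactSupport hχ.hasCompactSupport
        (μ := volume)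
      have := abs_integral_comp_sub_mul_le (ψ := fun t => χ (t + y) - χ t - fderiv ℝ χ t y)
        (m := B * ‖y‖ ^ 2) hα zero_le_two hh hhα
        (((hχ.contDiff.continuous.comp (continuous_add_const y)).sub
          hχ.contDiff.continuous).sub hd.continuous) (fun t ht => ?_) ?_
        (fun t => hχ.abs_taylor_le t y) x
      · refine this.trans ?_
        have : (2 : ℝ) ^ α * (B * ‖y‖ ^ 2) * V₂ = (2 ^ α * B * V₂) * ‖y‖ ^ 2 := by ring
        rw [this]
        exact mul_le_mul_of_nonneg_right (by linarith) (by positivity)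
      · have ht : 2 < ‖t‖ := by simpa using ht
        have z1 : χ (t + y) = 0 := image_eq_zero_of_notMem_tsupport fun h' => by
          have h1 := mem_closedBall_zero_iff.1 (hχ.tsupport_subset h')
          have h2 := norm_sub_le (t + y) y
          rw [add_sub_cancel_right] at h2
          linarith
        have z2 : χ t = 0 := image_eq_zero_of_notMem_tsupport fun h' => by
          have h1 := mem_closedBall_zero_iff.1 (hχ.tsupport_subset h')
          linarith
        have z3 : fderiv ℝ χ t y = 0 :=
          image_eq_zero_of_notMem_tsupport (f := fun t => fderiv ℝ χ t y) fun h' => by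
            have h1 := mem_closedBall_zero_iff.1 (hχ.tsupport_fderiv_apply_subset y h')
            linarith
        rw [z1, z2, z3, sub_zero, sub_zero]
      · rw [integral_sub (by exact (iχ.comp_add_right y).sub iχ)
          (hd.continuous.integrable_of_hasCompactSupport hds), integral_sub (iχ.comp_add_right y) iχ,
          integral_add_right_eq_self, hχ.integral_fderiv_apply, sub_self, sub_zero]
    · have a1 := hχ.abs_scaledAvg_one_sub_le hh hhα (x + y) x
      have a2 := abs_integral_comp_sub_mul_le (m := B * ‖y‖) hα zero_le_one hh hhα hd.continuous
        (fun t ht => image_eq_zero_of_notMem_tsupport (f := fun t => fderiv ℝ χ t y) fun h' =>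
          ht (hχ.tsupport_fderiv_apply_subset y h')) (hχ.integral_fderiv_apply y)
        (fun t => ((fderiv ℝ χ t).le_opNorm y).trans
          (mul_le_mul_of_nonneg_right (hχ.norm_fderiv_le t) (norm_nonneg _))) x
      rw [← scaledAvg_one, Real.one_rpow, one_mul] at a2
      rw [add_sub_cancel_left] at a1
      have a3 : ‖y‖ ^ α * ∫ t, |χ t| ≤ ‖y‖ ^ 2 * (B * V₁) := by
        refine mul_le_mul ?_ hχ.integral_abs_le (integral_nonneg fun t => abs_nonneg _)
          (by positivity)
        rw [← Real.rpow_natCast]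
        exact Real.rpow_le_rpow_of_exponent_le hy (by push_cast; linarith)
      have a4 : B * ‖y‖ * V₁ ≤ ‖y‖ ^ 2 * (B * V₁) := by
        have : ‖y‖ ≤ ‖y‖ ^ 2 := by nlinarith
        calc B * ‖y‖ * V₁ = ‖y‖ * (B * V₁) := by ring
          _ ≤ _ := mul_le_mul_of_nonneg_right this hBV
      have a5 := abs_sub (scaledAvg 1 χ h (x + y) - scaledAvg 1 χ h x)
        (scaledAvg 1 (fun t => fderiv ℝ χ t y) h x)
      have a6 : 0 ≤ (1 + 2 ^ α * B * V₂) * ‖y‖ ^ 2 := by positivity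
      nlinarith

lemma scaledAvg_neg (κ : ℝ) (φ h : Euc n → ℝ) (x : Euc n) :
    scaledAvg κ (fun t => -φ t) h x = -scaledAvg κ φ h x := by
  simp only [scaledAvg, mul_neg, integral_neg]

lemma abs_secDiff_le_of_taylor {w P : Euc n → ℝ} {C : ℝ} {x y : Euc n} (hP : P (-y) = -P y)
    (h : ∀ y, |w (x + y) - w x - P y| ≤ C * ‖y‖ ^ 2) : |secDiff w x y| ≤ 2 * C * ‖y‖ ^ 2 := by
  have h1 := h y
  have h2 := h (-y)
  rw [hP, norm_neg, ← sub_eq_add_neg] at h2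
  have e : secDiff w x y = (w (x + y) - w x - P y) + (w (x - y) - w x - -P y) := by
    unfold secDiff
    ring
  rw [e]
  refine (abs_add_le _ _).trans ?_
  linarith

lemma integrable_comp_sub_smul {F : Type*} [NormedAddCommGroup F] [NormedSpace ℝ F]
    {h : Euc n → ℝ} {Φ : Euc n → F} (hh : Continuous h) (hΦ : Continuous Φ)
    (hc : HasCompactSupport Φ) (x : Euc n) : Integrable fun t => h (x - t) • Φ t :=
  Continuous.integrable_of_hasCompactSupport
    ((hh.comp (continuous_const.sub continuous_id)).smul hΦ) hc.smul_left

lemma exists_mollified_gradient (h ρ : Euc n → ℝ) {B : ℝ} (hρ : SmoothBd B ρ)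
    (hh : Continuous h) (x : Euc n) :
    ∃ p : Euc n, ∀ y, ⟪p, y⟫ = scaledAvg 1 (fun t => fderiv ℝ ρ t y) h x := by
  have hi : Integrable fun t => h (x - t) • fderiv ℝ ρ t :=
    integrable_comp_sub_smul (F := Euc n →L[ℝ] ℝ) hh (hρ.contDiff.continuous_fderiv (by simp))
      (hρ.hasCompactSupport.fderiv ℝ) x
  refine ⟨(InnerProductSpace.toDual ℝ (Euc n)).symm (∫ t, h (x - t) • fderiv ℝ ρ t), fun y => ?_⟩
  rw [InnerProductSpace.toDual_symm_apply, ContinuousLinearMap.integral_apply hi, scaledAvg_one]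
  simp

lemma exists_mollified_bernstein {s α lam D B δ : ℝ} (hα : 0 < α) (hαs : α < s) (hs : s < 1)
    (hlam : 0 < lam) (hD : 0 < D) (hB : 0 ≤ B) (hδ : 0 < δ)
    {ρ : Euc n → ℝ} (hρ : IsMollifier B ρ) :
    ∃ R ≥ 1, ∃ E > 0, ∀ e : Euc n, ‖e‖ = 1 → ∀ ν : Measure (Euc n), AnnBd (2 * s) D ν →
      (∀ r, 0 < r → ∀ e : Euc n, ‖e‖ = 1 →
        ENNReal.ofReal lam ≤ ENNReal.ofReal (r ^ (2 * s - 2)) *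
          ∫⁻ y in ball 0 r, ENNReal.ofReal (⟪e, y⟫ ^ 2) ∂ν) →
      ∀ h : Euc n → ℝ, Continuous h → (∀ x y, |h x - h y| ≤ ‖x - y‖ ^ α) →
      (∀ x, ‖x‖ ≤ R → |∫ y, secDiff (scaledAvg 1 ρ h) x y ∂ν| ≤ E ∧
        |∫ y, secDiff (scaledAvg 1 (fun t => fderiv ℝ ρ t e) h) x y ∂ν| ≤ E) →
      |scaledAvg 1 (fun t => fderiv ℝ ρ t e) h 0| ≤ δ := by
  obtain ⟨C, hC, hbd⟩ := exists_scaledAvg_bounds n hα.le (hαs.trans hs).le hB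
  obtain ⟨R, hR, E, hE, hbern⟩ := exists_bernstein hα hαs hs hlam hD
    (show 0 < 2 * C by linarith) hδ
  refine ⟨R, hR, E, hE, fun e he ν hν hell h hh hhα hint => ?_⟩
  choose p hp using exists_mollified_gradient h ρ hρ.smoothBd hh
  have hρe := hρ.smoothBd_fderiv e he
  have hz := hbd _ hρe h hh hhα
  have hsec : ∀ y, ‖y‖ ^ 2 * C ≤ 2 * C * ‖y‖ ^ 2 := fun y : Euc n => by
    nlinarith [mul_nonneg hC.le (sq_nonneg ‖y‖)]
  refine hbern ν hν hell (scaledAvg 1 ρ h) _ p e he (fun x => (hp x e).symm) ?_ ?_ (fun x y => ?_)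
    (fun x => ?_) (fun x y => ?_) hint
  · refine continuous_iff_continuousAt.2 fun x => ?_
    refine tendsto_iff_norm_sub_tendsto_zero.2 ?_
    refine squeeze_zero (fun _ => norm_nonneg _)
      (fun y => hρe.abs_scaledAvg_one_sub_le hh hhα y x) ?_
    have : Continuous fun y : Euc n => ‖y - x‖ ^ α * ∫ t, |fderiv ℝ ρ t e| :=
      ((continuous_id.sub continuous_const).norm.rpow_const fun _ => Or.inr hα.le).mul_const _
    have := this.tendsto x
    simpa [Real.zero_rpow hα.ne'] using this
  · intro x y
    have := hρ.smoothBd.abs_scaledAvg_one_sub_le hh hhα x y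
    simp_rw [fun t => abs_of_nonneg (hρ.nonneg t)] at this
    rwa [hρ.integral_eq_one, mul_one] at this
  · rw [hp]
    have := (hbd ρ hρ.smoothBd h hh hhα).2 x y
    nlinarith [hsec y]
  · have := hz.1 (hρ.smoothBd.integral_fderiv_apply e) x
    linarith
  · refine abs_secDiff_le_of_taylor (P := fun y => scaledAvg 1
      (fun t => fderiv ℝ (fun t => fderiv ℝ ρ t e) t y) h x) ?_ (hz.2 x)
    simp only [map_neg]
    exact scaledAvg_neg _ _ _ _

/-- The kernel of order `2 * s` obtained from `ν` by zooming in at scale `κ`. -/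
def rescale (s κ : ℝ) (ν : Measure (Euc n)) : Measure (Euc n) :=
  ENNReal.ofReal (κ ^ (2 * s)) • ν.map fun y => κ⁻¹ • y

lemma measurableEmbedding_inv_smul {κ : ℝ} (hκ : 0 < κ) :
    MeasurableEmbedding fun y : Euc n => κ⁻¹ • y :=
  measurableEmbedding_const_smul₀ (inv_ne_zero hκ.ne')

lemma preimage_inv_smul_ball {κ : ℝ} (hκ : 0 < κ) (r : ℝ) :
    (fun y : Euc n => κ⁻¹ • y) ⁻¹' ball 0 r = ball 0 (κ * r) := by
  ext y
  simp only [mem_preimage, mem_ball_zero_iff, norm_smul, norm_inv, Real.norm_of_nonneg hκ.le]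
  exact inv_mul_lt_iff₀ hκ

lemma integral_rescale {s κ : ℝ} (hκ : 0 < κ) (ν : Measure (Euc n)) (F : Euc n → ℝ) :
    ∫ y, F y ∂(rescale s κ ν) = κ ^ (2 * s) * ∫ y, F (κ⁻¹ • y) ∂ν := by
  rw [rescale, integral_smul_measure, (measurableEmbedding_inv_smul hκ).integral_map,
    ENNReal.toReal_ofReal (by positivity), smul_eq_mul]

lemma AnnBd.rescale {s κ D : ℝ} (hκ : 0 < κ) {ν : Measure (Euc n)} (h : AnnBd (2 * s) D ν) :
    AnnBd (2 * s) D (rescale s κ ν) := by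
  intro ρ hρ
  have h1 := h (κ * ρ) (by positivity)
  rw [_root_.rescale, Measure.smul_apply, (measurableEmbedding_inv_smul hκ).map_apply,
    preimage_sdiff, preimage_inv_smul_ball hκ, preimage_inv_smul_ball hκ, smul_eq_mul,
    show κ * (2 * ρ) = 2 * (κ * ρ) by ring]
  refine (mul_le_mul_right h1 _).trans_eq ?_
  rw [← ENNReal.ofReal_mul (by positivity), Real.mul_rpow hκ.le hρ.le, Real.rpow_neg hκ.le]
  congr 1
  field_simp

lemma le_lintegral_rescale {s κ lam : ℝ} (hκ : 0 < κ) {ν : Measure (Euc n)}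
    (h : ∀ r, 0 < r → ∀ e : Euc n, ‖e‖ = 1 →
      ENNReal.ofReal lam ≤ ENNReal.ofReal (r ^ (2 * s - 2)) *
        ∫⁻ y in ball 0 r, ENNReal.ofReal (⟪e, y⟫ ^ 2) ∂ν)
    (r : ℝ) (hr : 0 < r) (e : Euc n) (he : ‖e‖ = 1) :
    ENNReal.ofReal lam ≤ ENNReal.ofReal (r ^ (2 * s - 2)) *
      ∫⁻ y in ball 0 r, ENNReal.ofReal (⟪e, y⟫ ^ 2) ∂(rescale s κ ν) := by
  refine (h (κ * r) (by positivity) e he).trans_eq ?_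
  have e1 : ∀ y : Euc n, ENNReal.ofReal (⟪e, κ⁻¹ • y⟫ ^ 2) =
      ENNReal.ofReal ((κ ^ 2)⁻¹) * ENNReal.ofReal (⟪e, y⟫ ^ 2) := fun y => by
    rw [← ENNReal.ofReal_mul (by positivity), inner_smul_right]
    congr 1
    ring
  rw [rescale, Measure.restrict_smul, lintegral_smul_measure,
    (measurableEmbedding_inv_smul hκ).restrict_map, (measurableEmbedding_inv_smul hκ).lintegral_map,
    preimage_inv_smul_ball hκ]
  simp_rw [e1]
  rw [lintegral_const_mul' _ _ ENNReal.ofReal_ne_top, smul_eq_mul, ← mul_assoc, ← mul_assoc,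
    ← ENNReal.ofReal_mul (by positivity), ← ENNReal.ofReal_mul (by positivity)]
  congr 2
  rw [Real.mul_rpow hκ.le hr.le, Real.rpow_sub hκ, Real.rpow_two]
  ring

lemma scaledAvg_fderiv_apply {u φ : Euc n → ℝ} (hu : ContDiff ℝ 1 u) (hφ : ContDiff ℝ 1 φ)
    (hφc : HasCompactSupport φ) {κ : ℝ} (hκ : 0 < κ) (a x : Euc n) :
    scaledAvg κ φ (fun x => fderiv ℝ u x a) x =
      κ⁻¹ * scaledAvg κ (fun t => fderiv ℝ φ t a) u x := by
  have hinner : ∀ t, HasFDerivAt (fun t : Euc n => x - κ • t)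
      (-(κ • ContinuousLinearMap.id ℝ (Euc n))) t := fun t =>
    ((hasFDerivAt_id t).const_smul κ).const_sub x
  have hd' : ∀ t, HasFDerivAt (fun t => u (x - κ • t)) ((fderiv ℝ u (x - κ • t)).comp
      (-(κ • ContinuousLinearMap.id ℝ (Euc n)))) t := fun t =>
    (hu.differentiable one_ne_zero (x - κ • t)).hasFDerivAt.comp t (hinner t)
  have hd : ∀ t, fderiv ℝ (fun t => u (x - κ • t)) t a = -κ * fderiv ℝ u (x - κ • t) a :=
    fun t => by
      rw [(hd' t).fderiv]
      simp
  have hφ' : Continuous fun t => fderiv ℝ φ t a :=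
    (hφ.continuous_fderiv one_ne_zero).clm_apply continuous_const
  have hφc' : HasCompactSupport fun t => fderiv ℝ φ t a :=
    hφc.fderiv_apply (𝕜 := ℝ) a
  have hg : Continuous fun x => fderiv ℝ u x a :=
    (hu.continuous_fderiv one_ne_zero).clm_apply continuous_const
  have i0 := integrable_comp_sub_smul_mul hu.continuous hφ.continuous hφc κ x
  have i1 := integrable_comp_sub_smul_mul hu.continuous hφ' hφc' κ x
  have i2 : Integrable fun t => fderiv ℝ (fun t => u (x - κ • t)) t a * φ t := by
    simp_rw [hd, mul_assoc]
    exact (integrable_comp_sub_smul_mul hg hφ.continuous hφc κ x).const_mul _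
  have := integral_mul_fderiv_eq_neg_fderiv_mul_of_integrable (μ := (volume : Measure (Euc n)))
    (f := fun t => u (x - κ • t)) (g := φ) (v := a) i2 i1 i0
    (fun t _ => (hd' t).differentiableAt) (fun t _ => hφ.differentiable one_ne_zero t)
  simp_rw [hd, mul_assoc] at this
  rw [integral_const_mul] at this
  rw [scaledAvg, scaledAvg, this]
  field_simp

lemma scaledAvg_one_comp {g φ : Euc n → ℝ} (c κ : ℝ) (x₀ X : Euc n) :
    scaledAvg 1 φ (fun X => c * g (x₀ + κ • X)) X = c * scaledAvg κ φ g (x₀ + κ • X) := by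
  rw [scaledAvg_one, scaledAvg, ← integral_const_mul]
  congr 1
  ext t
  rw [smul_sub, add_sub_assoc, mul_assoc]

lemma secDiff_comp {w v : Euc n → ℝ} {c κ : ℝ} {x₀ : Euc n}
    (h : ∀ X, v X = c * w (x₀ + κ • X)) (X y : Euc n) :
    secDiff v X y = c * secDiff w (x₀ + κ • X) (κ • y) := by
  simp only [secDiff, h, smul_add, smul_sub, ← add_assoc, ← add_sub_assoc]
  ring

/-- The directional derivatives of `u` have unit Hölder seminorm after zooming in at scale `κ`. -/
lemma abs_rescaled_fderiv_sub_le {u : Euc n → ℝ} {α T κ : ℝ} (hκ : 0 < κ) (hT : 0 < T)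
    (huT : ∀ x y, ‖fderiv ℝ u x - fderiv ℝ u y‖ ≤ T * ‖x - y‖ ^ α) {a : Euc n} (ha : ‖a‖ = 1)
    (x₀ x y : Euc n) :
    |(κ ^ α * T)⁻¹ * fderiv ℝ u (x₀ + κ • x) a - (κ ^ α * T)⁻¹ * fderiv ℝ u (x₀ + κ • y) a| ≤
      ‖x - y‖ ^ α := by
  rw [← mul_sub, abs_mul, abs_of_pos (by positivity), inv_mul_le_iff₀ (by positivity)]
  have e2 := (fderiv ℝ u (x₀ + κ • x) - fderiv ℝ u (x₀ + κ • y)).le_opNorm a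
  rw [ha, mul_one, Real.norm_eq_abs] at e2
  refine e2.trans ((huT _ _).trans_eq ?_)
  rw [add_sub_add_left_eq_sub, ← smul_sub, norm_smul, Real.norm_of_nonneg hκ.le,
    Real.mul_rpow hκ.le (norm_nonneg _)]
  ring

/-- At small scales, the mollified second derivatives of a weak solution are small compared with the
`C^{1+α}` seminorm. -/
lemma exists_mollified_hessian_small (hn : 0 < n) {s α lam Lam M B δ : ℝ}
    (hs : s ∈ Ioo (1 / 2 : ℝ) 1) (hα : 0 < α) (hα2 : 1 + α < 2 * s) (hM : 0 < M) (hlam : 0 < lam)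
    (hLam : 0 < Lam) (hB : 0 < B) (hδ : 0 < δ) {ρ : Euc n → ℝ} (hρ : IsMollifier B ρ) :
    ∃ R ≥ 1, ∃ C > 0, ∀ K : Euc n → Measure (Euc n), MeasKernel K → DivSymmetric K →
      DivElliptic s lam Lam K → XReg s α M K → AlmostEven s α M K →
      ∀ (u f : Euc n → ℝ) (A F T : ℝ), 0 ≤ A → 0 ≤ F → 0 < T → C * (A + F) ≤ T →
      HasCompactSupport u → ContDiff ℝ 1 u → (∀ x y, |u x - u y| ≤ A * ‖x - y‖) →
      (∀ x y, ‖fderiv ℝ u x - fderiv ℝ u y‖ ≤ T * ‖x - y‖ ^ α) → WeakSol K u f (ball 0 1) →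
      eLpNorm f (ENNReal.ofReal ((n : ℝ) / (2 * s - 1 - α))) (volume.restrict (ball 0 1)) ≤
        ENNReal.ofReal F →
      ∀ (x₀ a e : Euc n) (κ : ℝ), x₀ ∈ ball (0 : Euc n) (1 / 2) → ‖a‖ = 1 → ‖e‖ = 1 → 0 < κ →
      (R + 2) * κ ≤ 1 / 2 →
      |scaledAvg κ (fun t => fderiv ℝ ρ t e) (fun x => fderiv ℝ u x a) x₀| ≤ δ * T * κ ^ α := by
  obtain ⟨hs1, hs2⟩ := id hs
  obtain ⟨R, hR, E, hE, hbern⟩ := exists_mollified_bernstein (D := 2 * Lam) hα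
    (by linarith) hs2 hlam (by linarith) hB.le hδ hρ
  have hR0 : 0 ≤ R := by linarith
  obtain ⟨C, hC, hfroz⟩ := exists_frozen_estimate (lam := lam) hn hs hα hα2 hM hLam hB hR0
  refine ⟨R, hR, C / E, by positivity, fun K h1 h2 h3 h4 h5 u f A F T hA hF hT hAF hu hu1 huA huT
    hweak hf x₀ a e κ hx₀ ha he hκ hRκ => ?_⟩
  have hT' : C * (A + F) / T ≤ E := by
    rw [div_le_iff₀ hT]
    rw [div_mul_eq_mul_div, div_le_iff₀ hE] at hAF
    linarith
  set g : Euc n → ℝ := fun x => fderiv ℝ u x a with hg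
  have hgc : Continuous g := (hu1.continuous_fderiv one_ne_zero).clm_apply continuous_const
  have hκα : 0 < κ ^ α := by positivity
  obtain ⟨c, hc⟩ : ∃ c, c = (κ ^ α * T)⁻¹ := ⟨_, rfl⟩
  have hc0 : 0 < c := by rw [hc]; positivity
  set ν := evenCentred K x₀
  have key : ∀ φ : Euc n → ℝ, SmoothBd B φ → SmoothBd B (fun t => fderiv ℝ φ t a) →
      ∀ X, ‖X‖ ≤ R →
      |∫ y, secDiff (scaledAvg 1 φ fun X => c * g (x₀ + κ • X)) X y ∂(rescale s κ ν)| ≤ E := by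
    intro φ hφ hφa X hX
    have e1 : ∀ X y, secDiff (scaledAvg 1 φ fun X => c * g (x₀ + κ • X)) X (κ⁻¹ • y) =
        c * κ⁻¹ * secDiff (scaledAvg κ (fun t => fderiv ℝ φ t a) u) (x₀ + κ • X) y :=
      fun X y => by
        rw [secDiff_comp (w := scaledAvg κ (fun t => fderiv ℝ φ t a) u) (c := c * κ⁻¹) (κ := κ)
          (x₀ := x₀) (fun X => ?_), smul_inv_smul₀ hκ.ne']
        rw [scaledAvg_one_comp, scaledAvg_fderiv_apply hu1 (hφ.contDiff.of_le (by simp))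
          hφ.hasCompactSupport hκ, mul_assoc]
    have e2 := hfroz K h1 h2 h3 h4 h5 u f A F hA hF hu hu1.continuous huA hweak hf _ hφa.contDiff
      hφa.tsupport_subset hφa.abs_le hφa.abs_sub_le x₀ (x₀ + κ • X) κ hκ hx₀ hRκ (by
        rw [add_sub_cancel_left, norm_smul, Real.norm_of_nonneg hκ.le, mul_comm]
        exact mul_le_mul_of_nonneg_right hX hκ.le)
    rw [integral_rescale hκ]
    simp_rw [e1]
    rw [integral_const_mul, ← mul_assoc, abs_mul, abs_of_pos (by positivity)]
    refine (mul_le_mul_of_nonneg_left e2 (by positivity)).trans (le_trans (le_of_eq ?_) hT')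
    have e3 : κ ^ (1 + α - 2 * s) = κ * κ ^ α * (κ ^ (2 * s))⁻¹ := by
      rw [Real.rpow_sub hκ, Real.rpow_add hκ, Real.rpow_one, div_eq_mul_inv]
    have e4 : 0 < κ ^ (2 * s) := by positivity
    rw [e3, hc]
    field_simp
  have := hbern e he (rescale s κ ν) ((annBd_evenCentred hLam.le h3 x₀).rescale hκ)
    (le_lintegral_rescale hκ fun r hr e he => le_lintegral_evenCentred h3 x₀ hr he)
    (fun X => c * g (x₀ + κ • X)) (by fun_prop) (fun x y => ?_)
    (fun X hX => ⟨key _ hρ.smoothBd (hρ.smoothBd_fderiv a ha) X hX,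
      key _ (hρ.smoothBd_fderiv e he) (hρ.smoothBd_fderiv_fderiv e a he ha) X hX⟩)
  · rw [scaledAvg_one_comp, smul_zero, add_zero, abs_mul, abs_of_pos hc0, hc,
      inv_mul_le_iff₀ (by positivity)] at this
    linarith
  · rw [hc]
    exact abs_rescaled_fderiv_sub_le hκ hT huT ha x₀ x y

lemma hasDerivAt_of_abs_sub_le_sq {φ : ℝ → ℝ} {t φ' C : ℝ}
    (h : ∀ r, |φ (t + r) - φ t - r * φ'| ≤ C * r ^ 2) : HasDerivAt φ φ' t := by
  rw [hasDerivAt_iff_isLittleO_nhds_zero]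
  refine Asymptotics.IsBigO.trans_isLittleO (g := fun r : ℝ => r ^ 2)
    (Asymptotics.IsBigO.of_bound C (Filter.Eventually.of_forall fun r => ?_))
    (Asymptotics.isLittleO_pow_id one_lt_two)
  rw [norm_pow, Real.norm_eq_abs, Real.norm_eq_abs, sq_abs, smul_eq_mul]
  exact h r

lemma SmoothBd.abs_scaledAvg_one_smul_sub_le {B α : ℝ} {χ h : Euc n → ℝ} (hχ : SmoothBd B χ)
    (hB : 0 ≤ B) (hα : 0 ≤ α) (hα1 : α ≤ 1) (hh : Continuous h)
    (hhα : ∀ x y, |h x - h y| ≤ ‖x - y‖ ^ α) {e : Euc n} (he : ‖e‖ = 1) {l m : ℝ} (hl : 0 ≤ l)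
    (hm : ∀ r ∈ Icc 0 l, |scaledAvg 1 (fun t => fderiv ℝ χ t e) h (r • e)| ≤ m) :
    |scaledAvg 1 χ h (l • e) - scaledAvg 1 χ h 0| ≤ m * l := by
  obtain ⟨C, _, hC⟩ := exists_scaledAvg_bounds n hα hα1 hB
  have hd : ∀ t : ℝ, HasDerivAt (fun r : ℝ => scaledAvg 1 χ h (r • e))
      (scaledAvg 1 (fun t => fderiv ℝ χ t e) h (t • e)) t := fun t => by
    refine hasDerivAt_of_abs_sub_le_sq (C := C) fun r => ?_
    have := (hC χ hχ h hh hhα).2 (t • e) (r • e)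
    rw [norm_smul, he, mul_one, Real.norm_eq_abs, sq_abs, ← add_smul] at this
    refine le_trans (le_of_eq ?_) this
    congr 2
    rw [scaledAvg, scaledAvg, ← integral_const_mul]
    congr 1
    ext u
    rw [map_smul, smul_eq_mul]
    ring
  have := norm_image_sub_le_of_norm_deriv_le_segment' (fun t _ => (hd t).hasDerivWithinAt)
    (fun t ht => hm t (Ico_subset_Icc_self ht)) l (right_mem_Icc.2 hl)
  simpa using this

lemma IsMollifier.abs_sub_scaledAvg_le {B : ℝ} {ρ g : Euc n → ℝ} (hρ : IsMollifier B ρ)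
    (hg : Continuous g) {α κ T : ℝ} (hα : 0 ≤ α) (hκ : 0 < κ) (hT : 0 ≤ T)
    (hgT : ∀ x y, |g x - g y| ≤ T * ‖x - y‖ ^ α) (x : Euc n) :
    |g x - scaledAvg κ ρ g x| ≤ T * κ ^ α := by
  have hρc := hρ.smoothBd.contDiff.continuous
  have hρi : Integrable ρ :=
    hρc.integrable_of_hasCompactSupport hρ.smoothBd.hasCompactSupport
  have e1 : g x - scaledAvg κ ρ g x = ∫ t, (g x - g (x - κ • t)) * ρ t := by
    simp_rw [sub_mul]
    rw [integral_sub (hρi.const_mul _)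
      (integrable_comp_sub_smul_mul hg hρc hρ.smoothBd.hasCompactSupport κ x), integral_const_mul,
      hρ.integral_eq_one, mul_one, scaledAvg]
  rw [e1, ← Real.norm_eq_abs]
  refine (norm_integral_le_of_norm_le (hρi.const_mul (T * κ ^ α))
    (ae_of_all _ fun t => ?_)).trans_eq ?_
  · rw [norm_mul, Real.norm_of_nonneg (hρ.nonneg t)]
    by_cases ht : t ∈ closedBall (0 : Euc n) 1
    · refine mul_le_mul_of_nonneg_right ((hgT _ _).trans (mul_le_mul_of_nonneg_left ?_ hT))
        (hρ.nonneg t)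
      rw [sub_sub_cancel, norm_smul, Real.norm_of_nonneg hκ.le]
      exact Real.rpow_le_rpow (by positivity)
        (mul_le_of_le_one_right hκ.le (mem_closedBall_zero_iff.1 ht)) hα
    · rw [image_eq_zero_of_notMem_tsupport fun h' => ht (hρ.smoothBd.tsupport_subset h'), mul_zero,
        mul_zero]
  · rw [integral_const_mul, hρ.integral_eq_one, mul_one]

/-- Interior estimate of the Hölder seminorm of the gradient, with a small multiple of the global
seminorm on the right-hand side. -/
lemma exists_gradient_holder_estimate (hn : 0 < n) {s α lam Lam M δ : ℝ}
    (hs : s ∈ Ioo (1 / 2 : ℝ) 1) (hα : 0 < α) (hα2 : 1 + α < 2 * s) (hM : 0 < M) (hlam : 0 < lam)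
    (hLam : 0 < Lam) (hδ : 0 < δ) :
    ∃ C > 0, ∀ K : Euc n → Measure (Euc n), MeasKernel K → DivSymmetric K →
      DivElliptic s lam Lam K → XReg s α M K → AlmostEven s α M K →
      ∀ (u f : Euc n → ℝ) (A F T : ℝ), 0 ≤ A → 0 ≤ F → 0 < T → C * (A + F) ≤ T →
      HasCompactSupport u → ContDiff ℝ 1 u → (∀ x, ‖fderiv ℝ u x‖ ≤ A) →
      (∀ x y, ‖fderiv ℝ u x - fderiv ℝ u y‖ ≤ T * ‖x - y‖ ^ α) → WeakSol K u f (ball 0 1) →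
      eLpNorm f (ENNReal.ofReal ((n : ℝ) / (2 * s - 1 - α))) (volume.restrict (ball 0 1)) ≤
        ENNReal.ofReal F →
      ∀ x ∈ ball (0 : Euc n) (1 / 2), ∀ y ∈ ball (0 : Euc n) (1 / 2),
        ‖fderiv ℝ u x - fderiv ℝ u y‖ ≤ (δ * T + C * A) * ‖x - y‖ ^ α := by
  obtain ⟨B, hB, ρ, hρ⟩ := exists_isMollifier n
  obtain ⟨ε, hε⟩ : ∃ ε, ε = (δ / 3) ^ (1 / α) := ⟨_, rfl⟩
  have hε0 : 0 < ε := by rw [hε]; positivity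
  have hεα : 3 * ε ^ α = δ := by
    rw [hε, ← Real.rpow_mul (by positivity), one_div_mul_cancel hα.ne', Real.rpow_one]
    ring
  obtain ⟨R, hR, C, hC, hsmall⟩ := exists_mollified_hessian_small hn hs hα hα2 hM hlam hLam hB hε0
    hρ
  have hR0 : 0 < R + 2 := by linarith
  have hC' : 0 < 2 * (2 * (R + 2) * ε) ^ α := by positivity
  have hα1 : α ≤ 1 := by linarith [hs.2]
  refine ⟨C + 2 * (2 * (R + 2) * ε) ^ α, by positivity, fun K h1 h2 h3 h4 h5 u f A F T hA hF hT hAF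
    hu hu1 huA huT hweak hf x hx y hy => ?_⟩
  have hAF' : C * (A + F) ≤ T := le_trans (mul_le_mul_of_nonneg_right (by linarith)
    (by linarith)) hAF
  rcases eq_or_ne x y with rfl | hxy
  · rw [sub_self, norm_zero]
    positivity
  obtain ⟨τ, hτ⟩ : ∃ τ, τ = ‖x - y‖ := ⟨_, rfl⟩
  have hτ0 : 0 < τ := by rw [hτ]; exact norm_pos_iff.2 (sub_ne_zero.2 hxy)
  rw [← hτ]
  have hτα : 0 < τ ^ α := by positivity
  have hκ0 : 0 < ε * τ := by positivity
  rcases le_or_gt ((R + 2) * (ε * τ)) (1 / 2) with hκ | hκ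
  · refine le_trans ?_ (mul_le_mul_of_nonneg_right
      (show δ * T ≤ δ * T + (C + 2 * (2 * (R + 2) * ε) ^ α) * A by
        linarith [mul_nonneg (add_pos hC hC').le hA]) hτα.le)
    refine ContinuousLinearMap.opNorm_le_of_unit_norm (by positivity) fun a ha => ?_
    set g : Euc n → ℝ := fun x => fderiv ℝ u x a
    have hgc : Continuous g := (hu1.continuous_fderiv one_ne_zero).clm_apply continuous_const
    have hgT : ∀ x y, |g x - g y| ≤ T * ‖x - y‖ ^ α := fun x y => by
      have := (fderiv ℝ u x - fderiv ℝ u y).le_opNorm a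
      rw [ha, mul_one] at this
      exact this.trans (huT x y)
    obtain ⟨e, he⟩ : ∃ e, e = τ⁻¹ • (y - x) := ⟨_, rfl⟩
    have he1 : ‖e‖ = 1 := by
      rw [he, norm_smul, norm_sub_rev, ← hτ, norm_inv, Real.norm_of_nonneg hτ0.le,
        inv_mul_cancel₀ hτ0.ne']
    have hκα : 0 < (ε * τ) ^ α := by positivity
    have hmv := hρ.smoothBd.abs_scaledAvg_one_smul_sub_le hB.le hα.le hα1
      (h := fun X => ((ε * τ) ^ α * T)⁻¹ * g (x + (ε * τ) • X)) (by fun_prop)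
      (abs_rescaled_fderiv_sub_le hκ0 hT huT ha x) he1 (l := ε⁻¹) (m := ε) (by positivity)
      (fun r hr => by
        rw [scaledAvg_one_comp, abs_mul, abs_of_pos (by positivity), inv_mul_le_iff₀ (by positivity)]
        have hmem : x + (ε * τ) • r • e ∈ ball (0 : Euc n) (1 / 2) := by
          have := (convex_ball (0 : Euc n) (1 / 2)).add_smul_sub_mem hx hy (t := ε * r)
            ⟨mul_nonneg hε0.le hr.1, by
              have := mul_le_mul_of_nonneg_left hr.2 hε0.le
              rwa [mul_inv_cancel₀ hε0.ne'] at this⟩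
          rw [he, smul_smul, smul_smul]
          convert this using 3
          field_simp
        refine (hsmall K h1 h2 h3 h4 h5 u f A F T hA hF hT hAF' hu hu1 (fun x y => ?_) huT hweak hf
          _ a e (ε * τ) hmem ha he1 hκ0 hκ).trans_eq (by ring)
        exact convex_univ.norm_image_sub_le_of_norm_fderiv_le
          (fun x _ => hu1.differentiable one_ne_zero x) (fun x _ => huA x) (mem_univ _)
          (mem_univ _))
    rw [scaledAvg_one_comp, scaledAvg_one_comp, smul_zero, add_zero, ← mul_sub, abs_mul,
      abs_of_pos (by positivity), inv_mul_le_iff₀ (by positivity), mul_inv_cancel₀ hε0.ne', mul_one,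
      show x + (ε * τ) • ε⁻¹ • e = y by
        rw [he, smul_smul, smul_smul, show ε * τ * ε⁻¹ * τ⁻¹ = 1 by field_simp, one_smul]
        abel] at hmv
    have m1 := hρ.abs_sub_scaledAvg_le hgc hα.le hκ0 hT.le hgT x
    have m2 := hρ.abs_sub_scaledAvg_le hgc hα.le hκ0 hT.le hgT y
    have e1 : (fderiv ℝ u x - fderiv ℝ u y) a = (g x - scaledAvg (ε * τ) ρ g x) -
        (g y - scaledAvg (ε * τ) ρ g y) -
        (scaledAvg (ε * τ) ρ g y - scaledAvg (ε * τ) ρ g x) := by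
      rw [sub_apply]
      ring
    have e2 : δ * T * τ ^ α = 3 * ((ε * τ) ^ α * T) := by
      rw [← hεα, Real.mul_rpow hε0.le hτ0.le]
      ring
    rw [e1, e2]
    refine (abs_sub _ _).trans ((add_le_add_left (abs_sub _ _) _).trans ?_)
    linarith
  · have e1 : ‖fderiv ℝ u x - fderiv ℝ u y‖ ≤ 2 * A :=
      (norm_sub_le _ _).trans (by linarith [huA x, huA y])
    have e2 : 1 ≤ (2 * (R + 2) * ε) ^ α * τ ^ α := by
      rw [← Real.mul_rpow (by positivity) hτ0.le]
      exact Real.one_le_rpow (by linarith) hα.le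
    refine e1.trans ?_
    have e3 := mul_le_mul_of_nonneg_left e2 hA
    have e4 : 0 ≤ (δ * T + C * A) * τ ^ α := by positivity
    nlinarith

lemma hDeg_one_add {α : ℝ} (hα : 0 < α) (hα1 : α < 1) : hDeg (1 + α) = 1 := by
  have : ⌈1 + α⌉₊ = 2 := by
    rw [Nat.ceil_eq_iff two_ne_zero]
    norm_num
    exact ⟨hα, by linarith⟩
  rw [hDeg, this]

lemma norm_iteratedFDerivWithin_one_sub {Ω : Set (Euc n)} (hΩ : IsOpen Ω) (u : Euc n → ℝ)
    {x y : Euc n} (hx : x ∈ Ω) (hy : y ∈ Ω) :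
    ‖iteratedFDerivWithin ℝ 1 u Ω x - iteratedFDerivWithin ℝ 1 u Ω y‖ =
      ‖fderiv ℝ u x - fderiv ℝ u y‖ := by
  have e : ∀ x, iteratedFDeriv ℝ 1 u x =
      (continuousMultilinearCurryFin1 ℝ (Euc n) ℝ).symm (fderiv ℝ u x) := fun x => by
    ext m
    rw [iteratedFDeriv_one_apply, continuousMultilinearCurryFin1_symm_apply]
  rw [iteratedFDerivWithin_of_isOpen 1 hΩ hx, iteratedFDerivWithin_of_isOpen 1 hΩ hy, e, e,
    ← map_sub (continuousMultilinearCurryFin1 ℝ (Euc n) ℝ).symm, LinearIsometryEquiv.norm_map]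

lemma hSemi_one_add {α : ℝ} (hα : 0 < α) (hα1 : α < 1) {Ω : Set (Euc n)} (hΩ : IsOpen Ω)
    (u : Euc n → ℝ) :
    hSemi (1 + α) Ω u = ⨆ (x : Ω) (y : Ω), ENNReal.ofReal
      (‖fderiv ℝ u x - fderiv ℝ u y‖ / ‖(x : Euc n) - (y : Euc n)‖ ^ α) := by
  rw [hSemi, hSemiOn, hDeg_one_add hα hα1]
  refine iSup_congr fun x => iSup_congr fun y => ?_
  rw [norm_iteratedFDerivWithin_one_sub hΩ u x.2 y.2, Nat.cast_one, add_sub_cancel_left]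

lemma norm_fderiv_sub_le_of_hSemi {α : ℝ} (hα : 0 < α) (hα1 : α < 1) {u : Euc n → ℝ}
    (h : hSemi (1 + α) univ u ≠ ⊤) (x y : Euc n) :
    ‖fderiv ℝ u x - fderiv ℝ u y‖ ≤ (hSemi (1 + α) univ u).toReal * ‖x - y‖ ^ α := by
  rcases eq_or_ne x y with rfl | hxy
  · simp [Real.zero_rpow hα.ne']
  have hr : 0 < ‖x - y‖ := norm_pos_iff.2 (sub_ne_zero.2 hxy)
  rw [← div_le_iff₀ (by positivity), ← ENNReal.ofReal_le_iff_le_toReal h,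
    hSemi_one_add hα hα1 isOpen_univ]
  exact le_iSup₂_of_le (⟨x, mem_univ x⟩ : (univ : Set (Euc n))) ⟨y, mem_univ y⟩ le_rfl

lemma norm_fderiv_le_of_gradSup {u : Euc n → ℝ} (h : gradSup u ≠ ⊤) (x : Euc n) :
    ‖fderiv ℝ u x‖ ≤ (gradSup u).toReal := by
  rw [← ENNReal.ofReal_le_iff_le_toReal h]
  exact le_iSup (fun x => ENNReal.ofReal ‖fderiv ℝ u x‖) x

lemma hSemi_one_add_le {α c : ℝ} (hα : 0 < α) (hα1 : α < 1) (hc : 0 ≤ c) {Ω : Set (Euc n)}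
    (hΩ : IsOpen Ω) {u : Euc n → ℝ}
    (h : ∀ x ∈ Ω, ∀ y ∈ Ω, ‖fderiv ℝ u x - fderiv ℝ u y‖ ≤ c * ‖x - y‖ ^ α) :
    hSemi (1 + α) Ω u ≤ ENNReal.ofReal c := by
  rw [hSemi_one_add hα hα1 hΩ]
  exact iSup₂_le fun x y => ENNReal.ofReal_le_ofReal
    (div_le_of_le_mul₀ (by positivity) hc (h x x.2 y y.2))

/-- **Interpolation-type a priori estimate for divergence-form equations** (Proposition 4.3).
For a uniformly elliptic divergence-form kernel, `C^α` in `x` and almost even, and for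
`q = n/(2s−1−α)`: for any `δ > 0` there is `C_δ` such that
`[u]_{C^{1+α}(B_{1/2})} ≤ δ [u]_{C^{1+α}(ℝⁿ)} + C_δ (‖u‖_{L^∞(B₁)} + ‖∇u‖_{L^∞(ℝⁿ)} + ‖f‖_{L^q(B₁)})`
for any compactly supported `u ∈ C^{1+α}(ℝⁿ)` weakly solving `L(u,x) = f` in `B₁`. -/
theorem stmt8 (n : ℕ) (s α lam Lam M : ℝ)
    (hs : s ∈ Set.Ioo (1 / 2 : ℝ) 1) (hα : α ∈ Set.Ioo (0 : ℝ) 1) (hα2 : 1 + α < 2 * s)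
    (hM : 0 < M) (hlam : 0 < lam) (hlamLam : lam ≤ Lam) :
    ∀ δ > (0 : ℝ), ∃ Cδ > (0 : ℝ),
      ∀ K : Euc n → Measure (Euc n),
        MeasKernel K → DivSymmetric K → DivElliptic s lam Lam K →
        XReg s α M K → AlmostEven s α M K →
        ∀ u f : Euc n → ℝ,
          HasCompactSupport u →
          HolderMem (1 + α) Set.univ u →
          WeakSol K u f (ball 0 1) →
          hSemi (1 + α) (ball 0 (1 / 2)) u ≤
            ENNReal.ofReal δ * hSemi (1 + α) Set.univ u +
              ENNReal.ofReal Cδ *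
                (supNorm (ball 0 1) u + gradSup u +
                  eLpNorm f (ENNReal.ofReal ((n : ℝ) / (2 * s - 1 - α)))
                    (volume.restrict (ball 0 1))) := by
  intro δ hδ
  obtain ⟨hα0, hα1⟩ := hα
  have hLam : 0 < Lam := hlam.trans_le hlamLam
  rcases Nat.eq_zero_or_pos n with rfl | hn
  · refine ⟨1, one_pos, fun K _ _ _ _ _ u f _ _ _ => ?_⟩
    refine (hSemi_one_add_le hα0 hα1 le_rfl isOpen_ball fun x _ y _ => ?_).trans
      (by rw [ENNReal.ofReal_zero]; exact zero_le)
    rw [Subsingleton.elim x y, sub_self, norm_zero, zero_mul]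
  obtain ⟨C, hC, hest⟩ := exists_gradient_holder_estimate hn hs hα0 hα2 hM hlam hLam hδ
  refine ⟨δ * C + C, by positivity, fun K h1 h2 h3 h4 h5 u f hu hu1 hweak => ?_⟩
  have hCδ : ENNReal.ofReal (δ * C + C) ≠ 0 := by simpa using by positivity
  by_cases hN : hSemi (1 + α) univ u = ⊤
  · rw [hN, ENNReal.mul_top (by simpa using hδ), top_add]
    exact le_top
  by_cases hA : gradSup u = ⊤
  · rw [hA, add_top, top_add, ENNReal.mul_top hCδ, add_top]
    exact le_top
  by_cases hF : eLpNorm f (ENNReal.ofReal ((n : ℝ) / (2 * s - 1 - α)))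
      (volume.restrict (ball 0 1)) = ⊤
  · rw [hF, add_top, ENNReal.mul_top hCδ, add_top]
    exact le_top
  have hu1' : ContDiff ℝ 1 u := by
    have := hu1.1
    rwa [hDeg_one_add hα0 hα1, contDiffOn_univ, Nat.cast_one] at this
  have hA' := norm_fderiv_le_of_gradSup hA
  have hN' := norm_fderiv_sub_le_of_hSemi hα0 hα1 hN
  have hF' := (ENNReal.ofReal_toReal hF).ge
  rw [← ENNReal.ofReal_toReal hN, ← ENNReal.ofReal_toReal hA, ← ENNReal.ofReal_toReal hF]
  set N := (hSemi (1 + α) univ u).toReal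
  set A := (gradSup u).toReal
  set F := (eLpNorm f (ENNReal.ofReal ((n : ℝ) / (2 * s - 1 - α)))
    (volume.restrict (ball 0 1))).toReal
  have hN0 : 0 ≤ N := ENNReal.toReal_nonneg
  have hA0 : 0 ≤ A := ENNReal.toReal_nonneg
  have hF0 : 0 ≤ F := ENNReal.toReal_nonneg
  have hAF : 0 ≤ C * (A + F) := by positivity
  have hCF : 0 ≤ C * F := by positivity
  have main : hSemi (1 + α) (ball 0 (1 / 2)) u ≤
      ENNReal.ofReal (δ * N + (δ * C + C) * (A + F)) := by
    refine hSemi_one_add_le hα0 hα1 (by positivity) isOpen_ball fun x hx y hy => ?_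
    have hr : 0 ≤ ‖x - y‖ ^ α := by positivity
    refine le_of_forall_pos_le_add fun τ hτ => ?_
    obtain ⟨τ', hτ', hττ'⟩ : ∃ τ' > 0, δ * τ' * ‖x - y‖ ^ α ≤ τ := by
      refine ⟨τ / (δ * (1 + ‖x - y‖ ^ α)), by positivity, ?_⟩
      rw [mul_div_assoc', div_mul_eq_mul_div, div_le_iff₀ (by positivity)]
      nlinarith [mul_pos hδ hτ]
    refine (hest K h1 h2 h3 h4 h5 u f A F (N + C * (A + F) + τ') hA0 hF0 (by positivity)
      (by linarith) hu hu1' hA' (fun x y => (hN' x y).trans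
        (mul_le_mul_of_nonneg_right (by linarith) (by positivity))) hweak hF' x hx y hy).trans ?_
    nlinarith [mul_nonneg hCF hr]
  refine main.trans ?_
  rw [ENNReal.ofReal_add (by positivity) (by positivity), ENNReal.ofReal_mul hδ.le,
    ENNReal.ofReal_mul (by positivity), ENNReal.ofReal_add hA0 hF0]
  gcongr
  exact le_add_self

end
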